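/- arXiv:1302.0454 — 2 statements merged into one kernel-verified Lean document; each statement's English description precedes it below -/
import Mathlib

section
/- Let P be a non-empty Π⁰₁ class and let c be a benign cost function. Then there is an ω-c.a. set Z ∈ P such that every computably enumerable set A with A ≤_T Z obeys c. -/
/-! Basic definitions: Cantor space, initial segments, computable approximations,
Martin-Löf randomness, change counting, cost functions, oracle computability. -/

/-- The length-`n` initial segment of `Z : ℕ → Bool`, as a list of booleans. -/
def restr (Z : ℕ → Bool) (n : ℕ) : List Bool := (List.range n).map Z

/-- `σ` is an initial segment of `Z`. -/
def InitSeg (σ : List Bool) (Z : ℕ → Bool) : Prop := σ = restr Z σ.length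

/-- `Z` is Martin-Löf random: for every computable sequence of strings with
finite total measure, only finitely many are initial segments of `Z`. -/
def MLRandom (Z : ℕ → Bool) : Prop :=
  ∀ σ : ℕ → List Bool, Computable σ →
    Summable (fun i => ((1 : ℝ) / 2) ^ (σ i).length) →
    {i | InitSeg (σ i) Z}.Finite

/-- `(Zs s) s∈ℕ` converges pointwise to `Z`. -/
def Approx (Zs : ℕ → ℕ → Bool) (Z : ℕ → Bool) : Prop :=
  ∀ x, ∃ t, ∀ s, t ≤ s → Zs s x = Z x

/-- `Zs` is a computable approximation of `Z`. -/
def CompApprox (Zs : ℕ → ℕ → Bool) (Z : ℕ → Bool) : Prop :=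
  Computable₂ Zs ∧ Approx Zs Z

/-- `Z` is Δ⁰₂: it has a computable approximation. -/
def Delta02 (Z : ℕ → Bool) : Prop := ∃ Zs, CompApprox Zs Z

/-- The set of stages `s ≥ 1` at which the length-`n` initial segment of the
approximation changes. -/
def changeStages (Zs : ℕ → ℕ → Bool) (n : ℕ) : Set ℕ :=
  {s | 1 ≤ s ∧ restr (Zs s) n ≠ restr (Zs (s - 1)) n}

/-- `Z` is a `g`-change set. -/
def GChangeSet (Z : ℕ → Bool) (g : ℕ → ℕ) : Prop :=
  ∃ Zs, CompApprox Zs Z ∧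
    ∀ n, (changeStages Zs n).Finite ∧ (changeStages Zs n).ncard ≤ g n

/-- `Z` is ω-c.a.: a `g`-change set for some computable `g`. -/
def OmegaCA (Z : ℕ → Bool) : Prop := ∃ g : ℕ → ℕ, Computable g ∧ GChangeSet Z g

/-- Lexicographic order on Cantor space. -/
def LexLE (X Y : ℕ → Bool) : Prop :=
  X = Y ∨ ∃ n, (∀ i, i < n → X i = Y i) ∧ X n = false ∧ Y n = true

/-- `Z` is left-c.e. -/
def LeftCE (Z : ℕ → Bool) : Prop :=
  ∃ Zs, CompApprox Zs Z ∧ ∀ s, LexLE (Zs s) (Zs (s + 1))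

/-- `c` is a cost function: computable, nonnegative, nondecreasing in the stage,
nonincreasing in the number. -/
def CostFunction (c : ℕ → ℕ → ℚ) : Prop :=
  Computable₂ c ∧ (∀ x s, 0 ≤ c x s) ∧
    (∀ x s t, s ≤ t → c x s ≤ c x t) ∧ (∀ x y s, x ≤ y → c y s ≤ c x s)

/-- The limit condition for a cost function. -/
def LimitCondition (c : ℕ → ℕ → ℚ) : Prop :=
  ∀ ε : ℚ, 0 < ε → ∃ x₀, ∀ x, x₀ ≤ x → ∀ s, c x s ≤ ε

/-- A benign cost function: the number of pairwise disjoint intervals `[x,s)` with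
`c x s ≥ 2^{-k}` is computably bounded in `k`. -/
def Benign (c : ℕ → ℕ → ℚ) : Prop :=
  ∃ b : ℕ → ℕ, Computable b ∧
    ∀ k m (x s : ℕ → ℕ), (∀ i, i < m → x i < s i) →
      (∀ i, i + 1 < m → s i ≤ x (i + 1)) →
      (∀ i, i < m → ((1 : ℚ) / 2) ^ k ≤ c (x i) (s i)) → m ≤ b k

open Classical in
/-- The cost paid at stage `s` by the approximation `As`: if `s ≥ 1` and the
approximation changes at `s`, it is `c x s` where `x` is the least changed number. -/
noncomputable def stageCost (c : ℕ → ℕ → ℚ) (As : ℕ → ℕ → Bool) (s : ℕ) : ℚ :=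
  if s = 0 then 0
  else if h : ∃ x, As s x ≠ As (s - 1) x then c (Nat.find h) s else 0

/-- `A` obeys the cost function `c`: some computable approximation of `A` has
finite total cost. -/
def Obeys (A : ℕ → Bool) (c : ℕ → ℕ → ℚ) : Prop :=
  ∃ As, CompApprox As A ∧ ∃ B : ℚ, ∀ F : Finset ℕ, ∑ s ∈ F, stageCost c As s ≤ B

/-- Functions partial recursive in the oracle `O`. -/
inductive RecIn (O : ℕ →. ℕ) : (ℕ →. ℕ) → Prop
  | oracle : RecIn O O
  | zero : RecIn O (pure 0)
  | succ : RecIn O ↑Nat.succ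
  | left : RecIn O ↑fun n : ℕ => n.unpair.1
  | right : RecIn O ↑fun n : ℕ => n.unpair.2
  | pair {f g} : RecIn O f → RecIn O g → RecIn O fun n => Nat.pair <$> f n <*> g n
  | comp {f g} : RecIn O f → RecIn O g → RecIn O fun n => g n >>= f
  | prec {f g} : RecIn O f → RecIn O g → RecIn O (Nat.unpaired fun a n =>
      n.rec (f a) fun y IH => do let i ← IH; g (Nat.pair a (Nat.pair y i)))
  | rfind {f} : RecIn O f → RecIn O fun a =>
      Nat.rfind fun n => (fun m => m = 0) <$> f (Nat.pair a n)

/-- The characteristic function of `A` as a partial function ℕ →. ℕ. -/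
def charFn (A : ℕ → Bool) : ℕ →. ℕ := fun n => Part.some (cond (A n) 1 0)

/-- Turing reducibility: `A ≤_T Z`. -/
def TuringLE (A Z : ℕ → Bool) : Prop := RecIn (charFn Z) (charFn A)

/-- `A` is computably enumerable: the domain of a partial computable function. -/
def CE (A : ℕ → Bool) : Prop :=
  ∃ f : ℕ →. ℕ, Nat.Partrec f ∧ ∀ x, A x = true ↔ (f x).Dom

/-- A Π⁰₁ class of elements of Cantor space. -/
def Pi01 (P : Set (ℕ → Bool)) : Prop :=
  ∃ f : ℕ → Option (List Bool), Computable f ∧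
    P = {Z | ∀ i σ, f i = some σ → ¬ InitSeg σ Z}

/-- The c.e. set `W_e`: the domain of the `e`-th partial computable function. -/
def Wset (e : ℕ) : Set ℕ :=
  {x | ((Denumerable.ofNat Nat.Partrec.Code e).eval x).Dom}

/-- The stage-`s` approximation to `W_e`, via step-bounded evaluation. -/
def WAt (e s x : ℕ) : Prop :=
  (Nat.Partrec.Code.evaln s (Denumerable.ofNat Nat.Partrec.Code e) x).isSome

/-- `A` is promptly simple. -/
def PromptlySimple (A : ℕ → Bool) : Prop :=
  CE A ∧ {x | A x = false}.Infinite ∧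
    ∃ As : ℕ → ℕ → Bool, Computable₂ As ∧
      (∀ s x, As s x = true → As (s + 1) x = true) ∧
      (∀ x, A x = true ↔ ∃ s, As s x = true) ∧
      ∀ e, (Wset e).Infinite →
        ∃ s x, 1 ≤ s ∧ WAt e s x ∧ ¬ WAt e (s - 1) x ∧ As s x = true

section
/-! Part A: general computability helpers. -/

/-- Bounded universal quantifier. -/
def allLT (p : ℕ → Bool) (n : ℕ) : Bool := Nat.rec true (fun i ih => ih && p i) n

theorem allLT_iff (p : ℕ → Bool) (n : ℕ) : allLT p n = true ↔ ∀ i < n, p i = true := by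
  induction n with
  | zero => simp [allLT]
  | succ n ih =>
    have : allLT p (n+1) = (allLT p n && p n) := rfl
    rw [this, Bool.and_eq_true, ih]
    constructor
    · rintro ⟨h1, h2⟩ i hi
      rcases Nat.lt_succ_iff_lt_or_eq.1 hi with h | h
      · exact h1 i h
      · exact h ▸ h2
    · intro h
      exact ⟨fun i hi => h i (by omega), h n (by omega)⟩

/-- Bounded existential quantifier. -/
def anyLT (p : ℕ → Bool) (n : ℕ) : Bool := !(allLT (fun i => !(p i)) n)

theorem anyLT_iff (p : ℕ → Bool) (n : ℕ) : anyLT p n = true ↔ ∃ i < n, p i = true := by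
  unfold anyLT
  rw [Bool.not_eq_true', ← Bool.not_eq_true, allLT_iff]
  push Not
  simp

/-- Quantifier over a list. -/
def allL {β : Type*} (p : β → Bool) (l : List β) : Bool :=
  allLT (fun i => Option.casesOn (l[i]?) true p) l.length

theorem allL_iff {β : Type*} (p : β → Bool) (l : List β) :
    allL p l = true ↔ ∀ x ∈ l, p x = true := by
  unfold allL
  rw [allLT_iff]
  constructor
  · intro h x hx
    obtain ⟨i, hi, rfl⟩ := List.getElem_of_mem hx
    have := h i hi
    simpa [List.getElem?_eq_getElem hi] using this
  · intro h i hi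
    rw [List.getElem?_eq_getElem hi]
    exact h _ (List.getElem_mem hi)

section
variable {α β σ : Type*} [Primcodable α] [Primcodable β] [Primcodable σ]

theorem comp_not {p : α → Bool} (hp : Computable p) : Computable fun a => !(p a) :=
  Primrec.not.to_comp.comp hp

theorem comp_and {p q : α → Bool} (hp : Computable p) (hq : Computable q) :
    Computable fun a => (p a && q a) :=
  Primrec.and.to_comp.comp hp hq

theorem comp_or {p q : α → Bool} (hp : Computable p) (hq : Computable q) :
    Computable fun a => (p a || q a) :=
  Primrec.or.to_comp.comp hp hq

theorem comp_eq [DecidableEq β] {p q : α → β} (hp : Computable p) (hq : Computable q) :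
    Computable fun a => decide (p a = q a) :=
  (Primrec.eq (α := β)).decide.to_comp.comp hp hq

theorem comp_le {p q : α → ℕ} (hp : Computable p) (hq : Computable q) :
    Computable fun a => decide (p a ≤ q a) :=
  Primrec.nat_le.decide.to_comp.comp hp hq

theorem comp_lt {p q : α → ℕ} (hp : Computable p) (hq : Computable q) :
    Computable fun a => decide (p a < q a) :=
  Primrec.nat_lt.decide.to_comp.comp hp hq

theorem comp_add {p q : α → ℕ} (hp : Computable p) (hq : Computable q) :
    Computable fun a => p a + q a :=
  Primrec.nat_add.to_comp.comp hp hq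

theorem comp_sub {p q : α → ℕ} (hp : Computable p) (hq : Computable q) :
    Computable fun a => p a - q a :=
  Primrec.nat_sub.to_comp.comp hp hq

theorem comp_mul {p q : α → ℕ} (hp : Computable p) (hq : Computable q) :
    Computable fun a => p a * q a :=
  Primrec.nat_mul.to_comp.comp hp hq

theorem comp_div {p q : α → ℕ} (hp : Computable p) (hq : Computable q) :
    Computable fun a => p a / q a :=
  Primrec.nat_div.to_comp.comp hp hq

theorem comp_mod {p q : α → ℕ} (hp : Computable p) (hq : Computable q) :
    Computable fun a => p a % q a :=
  Primrec.nat_mod.to_comp.comp hp hq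

theorem comp_pow {p q : α → ℕ} (hp : Computable p) (hq : Computable q) :
    Computable fun a => p a ^ q a := by
  have : Primrec₂ ((· ^ ·) : ℕ → ℕ → ℕ) := Primrec₂.unpaired'.1 Nat.Primrec.pow
  exact this.to_comp.comp hp hq

theorem comp_allLT {n : α → ℕ} {p : α → ℕ → Bool} (hn : Computable n) (hp : Computable₂ p) :
    Computable fun a => allLT (p a) (n a) := by
  unfold allLT
  refine Computable.nat_rec (h := fun a (q : ℕ × Bool) => (q.2 && p a q.1)) hn
    (Computable.const true) ?_
  exact comp_and (Computable.snd.comp Computable.snd)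
    (hp.comp Computable.fst (Computable.fst.comp Computable.snd))

theorem comp_anyLT {n : α → ℕ} {p : α → ℕ → Bool} (hn : Computable n) (hp : Computable₂ p) :
    Computable fun a => anyLT (p a) (n a) :=
  comp_not (comp_allLT hn (comp_not hp))

theorem comp_allL {l : α → List β} {p : α → β → Bool} (hl : Computable l) (hp : Computable₂ p) :
    Computable fun a => allL (p a) (l a) := by
  unfold allL
  refine comp_allLT (p := fun a i => Option.casesOn ((l a)[i]?) true (p a))
    (Computable.list_length.comp hl) ?_
  refine Computable.option_casesOn (o := fun q : α × ℕ => (l q.1)[q.2]?) (f := fun _ => true)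
    (g := fun q x => p q.1 x) ?_ (Computable.const true) ?_
  · exact Computable.list_getElem?.comp (hl.comp Computable.fst) Computable.snd
  · exact hp.comp (Computable.fst.comp Computable.fst) Computable.snd

theorem comp_map_range {n : α → ℕ} {X : α → ℕ → σ} (hn : Computable n) (hX : Computable₂ X) :
    Computable fun a => (List.range (n a)).map (X a) := by
  have : Computable fun a => (Nat.rec [] (fun i l => l ++ [X a i]) (n a) : List σ) := by
    refine Computable.nat_rec (h := fun a (q : ℕ × List σ) => q.2 ++ [X a q.1]) hn
      (Computable.const []) ?_
    exact Computable.list_concat.comp (Computable.snd.comp Computable.snd)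
      (hX.comp Computable.fst (Computable.fst.comp Computable.snd))
  refine this.of_eq fun a => ?_
  induction n a with
  | zero => rfl
  | succ k ih => simp [List.range_succ, ih]

/-- Unbounded search for a total function. -/
theorem comp_find {p : α → ℕ → Bool} (hp : Computable₂ p) (g : α → ℕ)
    (h1 : ∀ a, p a (g a) = true) (h2 : ∀ a, ∀ m < g a, p a m = false) : Computable g := by
  have : Partrec fun a => Nat.rfind fun n => (Part.some (p a n)) :=
    Partrec.rfind (p := fun a n => Part.some (p a n)) hp
  refine this.of_eq_tot fun a => ?_
  refine Nat.mem_rfind.2 ⟨?_, ?_⟩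
  · change true ∈ Part.some (p a (g a))
    rw [h1]; exact Part.mem_some _
  · intro m hm
    change false ∈ Part.some (p a m)
    rw [h2 a m hm]; exact Part.mem_some _
end


end

section
/-! Part B: comparison of rationals is computable. -/

theorem coprime_iff_allLT (a d : ℕ) (hd : 0 < d) :
    Nat.Coprime a d ↔ allLT (fun x => !(decide (a % x = 0) && decide (d % x = 0)) || decide (x ≤ 1))
      (a + d + 1) = true := by
  rw [allLT_iff]
  constructor
  · intro h x hx
    by_cases h1 : a % x = 0 <;> by_cases h2 : d % x = 0 <;> simp [h1, h2]
    have := Nat.dvd_gcd (Nat.dvd_of_mod_eq_zero h1) (Nat.dvd_of_mod_eq_zero h2)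
    rw [h] at this
    exact Nat.le_of_dvd one_pos this
  · intro h
    unfold Nat.Coprime
    have hg : Nat.gcd a d < a + d + 1 := by
      have := Nat.gcd_le_right a hd
      omega
    have := h _ hg
    have e1 : a % Nat.gcd a d = 0 := Nat.mod_eq_zero_of_dvd (Nat.gcd_dvd_left a d)
    have e2 : d % Nat.gcd a d = 0 := Nat.mod_eq_zero_of_dvd (Nat.gcd_dvd_right a d)
    simp [e1, e2] at this
    have : Nat.gcd a d ≠ 0 := by
      rw [Ne, Nat.gcd_eq_zero_iff]; omega
    omega


theorem comp_subtype_ofNat (s : Set ℕ) [DecidablePred (· ∈ s)] [Infinite s] (p : ℕ → Bool)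
    (hp : Computable p) (hps : ∀ x, p x = true ↔ x ∈ s) :
    Computable fun n => (Nat.Subtype.ofNat s n : ℕ) := by
  -- next element
  have hex : ∀ y : ℕ, ∃ z, y < z ∧ z ∈ s := fun y => by
    have : s.Infinite := Set.infinite_coe_iff.1 inferInstance
    obtain ⟨z, hz, hyz⟩ := this.exists_gt y
    exact ⟨z, hyz, hz⟩
  have hnext : Computable fun y : ℕ => Nat.find (hex y) := by
    refine comp_find (p := fun y z => decide (y < z) && p z) ?_ _ ?_ ?_
    · exact comp_and (comp_lt Computable.fst Computable.snd) (hp.comp Computable.snd)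
    · intro y
      have := Nat.find_spec (hex y)
      simp [hps, this]
    · intro y m hm
      have := Nat.find_min (hex y) hm
      rw [← Bool.not_eq_true]
      simpa [hps] using this
  have h : Computable fun n : ℕ => (Nat.rec ((⊥ : s) : ℕ) (fun _ y => Nat.find (hex y)) n : ℕ) := by
    refine Computable.nat_rec (h := fun _ (q : ℕ × ℕ) => Nat.find (hex q.2)) Computable.id
      (Computable.const _) ?_
    exact hnext.comp (Computable.snd.comp Computable.snd)
  refine h.of_eq fun n => ?_
  induction n with
  | zero => rfl
  | succ n ih =>
    have e1 : (Nat.Subtype.ofNat s (n+1)) = Nat.Subtype.succ (Nat.Subtype.ofNat s n) := rfl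
    rw [e1]
    dsimp only
    rw [ih]
    rw [Nat.find_eq_iff]
    refine ⟨⟨Nat.Subtype.lt_succ_self _, Subtype.prop _⟩, ?_⟩
    rintro m hm ⟨h1, h2⟩
    have := Nat.Subtype.succ_le_of_lt (s := s) (x := ⟨m, h2⟩) (y := Nat.Subtype.ofNat s n) h1
    exact absurd (lt_of_lt_of_le hm this) (lt_irrefl _)

/-- The natural code of a rational. -/
def ratCode (q : ℚ) : ℕ := @Encodable.encode ℚ Rat.instEncodable q

theorem ratCode_eq (q : ℚ) : ratCode q = Nat.pair (Equiv.intEquivNat q.num) q.den := rfl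

theorem intEquivNat_ofNat (n : ℕ) : Equiv.intEquivNat (Int.ofNat n) = 2 * n := by
  rfl

theorem intEquivNat_negSucc (n : ℕ) : Equiv.intEquivNat (Int.negSucc n) = 2 * n + 1 := by
  simp [Equiv.intEquivNat, Equiv.intEquivNatSumNat]

theorem ratCode_ofNat [DecidablePred (· ∈ Set.range (@Encodable.encode ℚ Rat.instEncodable))]
    [Infinite (Set.range (@Encodable.encode ℚ Rat.instEncodable))] (n : ℕ) : ratCode (Denumerable.ofNat ℚ n) =
    (Nat.Subtype.ofNat (Set.range (@Encodable.encode ℚ Rat.instEncodable)) n : ℕ) := by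
  have e : Denumerable.ofNat ℚ n = (Encodable.equivRangeEncode ℚ).symm
    (Nat.Subtype.ofNat (Set.range (@Encodable.encode ℚ Rat.instEncodable)) n) := by
      let _ : Denumerable (Set.range (@Encodable.encode ℚ Rat.instEncodable)) :=
        @Nat.Subtype.denumerable _ (Encodable.decidableRangeEncode ℚ) _
      have := Denumerable.ofEquiv_ofNat _ (Encodable.equivRangeEncode ℚ) n
      refine Eq.trans this ?_
      congr 1
      change @Nat.Subtype.ofNat _ (Encodable.decidableRangeEncode ℚ) _ n = _
      congr!
  rw [e]
  have : ∀ y, ratCode ((Encodable.equivRangeEncode ℚ).symm y) = (y : ℕ) := by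
    intro y
    have := congrArg Subtype.val ((Encodable.equivRangeEncode ℚ).apply_symm_apply y)
    exact this
  rw [this]

/-- Decision procedure for being the code of a rational. -/
def isRatCode (y : ℕ) : Bool :=
  decide (0 < y.unpair.2) &&
  allLT (fun x => !(decide (((y.unpair.1 + 1) / 2) % x = 0) && decide (y.unpair.2 % x = 0))
    || decide (x ≤ 1)) ((y.unpair.1 + 1) / 2 + y.unpair.2 + 1)

theorem natAbs_intEquivNat (z : ℤ) : (Equiv.intEquivNat z + 1) / 2 = z.natAbs := by
  cases z with
  | ofNat n => rw [intEquivNat_ofNat]; simp; omega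
  | negSucc n => rw [intEquivNat_negSucc]; simp; omega

theorem isRatCode_iff (y : ℕ) :
    isRatCode y = true ↔ y ∈ Set.range (@Encodable.encode ℚ Rat.instEncodable) := by
  have h0 : isRatCode y = true ↔ 0 < y.unpair.2 ∧
      Nat.Coprime ((y.unpair.1 + 1) / 2) y.unpair.2 := by
    unfold isRatCode
    rw [Bool.and_eq_true, decide_eq_true_iff]
    exact and_congr_right fun h => (coprime_iff_allLT _ _ h).symm
  rw [h0]
  constructor
  · rintro ⟨h1, h2⟩
    refine ⟨⟨Equiv.intEquivNat.symm y.unpair.1, y.unpair.2, h1.ne_bot, ?_⟩, ?_⟩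
    · rw [← natAbs_intEquivNat, Equiv.apply_symm_apply]; exact h2
    · refine (ratCode_eq _).trans ?_
      simp
  · rintro ⟨q, rfl⟩
    change 0 < (ratCode q).unpair.2 ∧ _
    have : @Encodable.encode ℚ Rat.instEncodable q = ratCode q := rfl
    rw [this, ratCode_eq, Nat.unpair_pair]
    refine ⟨q.den_pos, ?_⟩
    simp only
    rw [natAbs_intEquivNat]
    exact q.reduced

theorem comp_isRatCode : Computable isRatCode := by
  unfold isRatCode
  have u1 : Computable fun y : ℕ => y.unpair.1 := Computable.fst.comp Computable.unpair
  have u2 : Computable fun y : ℕ => y.unpair.2 := Computable.snd.comp Computable.unpair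
  have w : Computable fun y : ℕ => (y.unpair.1 + 1) / 2 :=
    comp_div (comp_add u1 (Computable.const 1)) (Computable.const 2)
  have h1 : Computable fun q : ℕ × ℕ => decide (((q.1.unpair.1 + 1) / 2) % q.2 = 0) :=
    comp_eq (comp_mod (w.comp Computable.fst) Computable.snd) (Computable.const 0)
  have h2 : Computable fun q : ℕ × ℕ => decide (q.1.unpair.2 % q.2 = 0) :=
    comp_eq (comp_mod (u2.comp Computable.fst) Computable.snd) (Computable.const 0)
  have h3 : Computable fun q : ℕ × ℕ => decide (q.2 ≤ 1) :=
    comp_le Computable.snd (Computable.const 1)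
  have h4 : Computable fun q : ℕ × ℕ => (!(decide (((q.1.unpair.1 + 1) / 2) % q.2 = 0)
      && decide (q.1.unpair.2 % q.2 = 0)) || decide (q.2 ≤ 1)) :=
    comp_or (comp_not (comp_and h1 h2)) h3
  have h5 : Computable fun y : ℕ => (y.unpair.1 + 1) / 2 + y.unpair.2 + 1 :=
    comp_add (comp_add w u2) (Computable.const 1)
  have h6 : Computable fun y : ℕ => decide (0 < y.unpair.2) := comp_lt (Computable.const 0) u2
  exact comp_and h6 (comp_allLT h5 h4)

theorem comp_ratCode : Computable ratCode := by
  classical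
  have _ : Infinite (Set.range (@Encodable.encode ℚ Rat.instEncodable)) :=
    Infinite.of_injective _ (Encodable.equivRangeEncode ℚ).injective
  have h := comp_subtype_ofNat (Set.range (@Encodable.encode ℚ Rat.instEncodable)) isRatCode
    comp_isRatCode isRatCode_iff
  have h2 : Computable fun q : ℚ => ((Nat.Subtype.ofNat
    (Set.range (@Encodable.encode ℚ Rat.instEncodable))
      (@Encodable.encode ℚ Primcodable.toEncodable q)) : ℕ) :=
    h.comp Computable.encode
  refine h2.of_eq fun q => ?_
  rw [← ratCode_ofNat]
  congr 1
  exact Denumerable.ofNat_encode q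

theorem pow_le_iff_ratCode (m : ℕ) (q : ℚ) : ((1 : ℚ) / 2) ^ m ≤ q ↔
    ((ratCode q).unpair.1 % 2 = 0 ∧ (ratCode q).unpair.2 ≤ (ratCode q).unpair.1 / 2 * 2 ^ m) := by
  rw [ratCode_eq, Nat.unpair_pair]
  simp only
  have hd : (0 : ℚ) < q.den := by exact_mod_cast q.den_pos
  have h1 : ((1 : ℚ) / 2) ^ m ≤ q ↔ (q.den : ℤ) ≤ q.num * 2 ^ m := by
    conv_lhs => rw [← Rat.num_div_den q]
    rw [one_div, inv_pow, inv_le_iff_one_le_mul₀ (by positivity), div_mul_eq_mul_div,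
      one_le_div hd]
    constructor
    · intro h; exact_mod_cast h
    · intro h; exact_mod_cast h
  rw [h1]
  rcases hq : q.num with n | n
  · rw [intEquivNat_ofNat]
    have e1 : 2 * n % 2 = 0 := by omega
    have e2 : 2 * n / 2 = n := by omega
    rw [e1, e2]
    simp only [true_and]
    constructor
    · intro h; simp at h; exact_mod_cast h
    · intro h; simp; exact_mod_cast h
  · rw [intEquivNat_negSucc]
    constructor
    · intro h
      exfalso
      have : (0 : ℤ) < q.den := by exact_mod_cast q.den_pos
      have h3 : Int.negSucc n * 2 ^ m ≤ 0 :=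
        mul_nonpos_of_nonpos_of_nonneg (Int.negSucc_lt_zero n).le (by positivity)
      omega
    · rintro ⟨h, -⟩; omega

/-- Comparing a computable rational with a power of one half. -/
theorem comp_pow_le {α : Type*} [Primcodable α] {m : α → ℕ} {q : α → ℚ} (hm : Computable m)
    (hq : Computable q) : Computable fun a => decide (((1 : ℚ) / 2) ^ m a ≤ q a) := by
  have u1 : Computable fun a => (ratCode (q a)).unpair.1 :=
    Computable.fst.comp (Computable.unpair.comp (comp_ratCode.comp hq))
  have u2 : Computable fun a => (ratCode (q a)).unpair.2 :=
    Computable.snd.comp (Computable.unpair.comp (comp_ratCode.comp hq))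
  have := comp_and (comp_eq (comp_mod u1 (Computable.const 2)) (Computable.const 0))
    (comp_le u2 (comp_mul (comp_div u1 (Computable.const 2))
      (comp_pow (Computable.const 2) hm)))
  refine this.of_eq fun a => ?_
  rw [Bool.eq_iff_iff]
  simp only [Bool.and_eq_true, decide_eq_true_iff]
  exact (pow_le_iff_ratCode _ _).symm

end

section
/-! Part C: the use principle. -/

theorem comp_natPair {α : Type*} [Primcodable α] {p q : α → ℕ} (hp : Computable p)
    (hq : Computable q) : Computable fun a => Nat.pair (p a) (q a) :=
  Primrec₂.natPair.to_comp.comp hp hq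

theorem restr_length (Z : ℕ → Bool) (n : ℕ) : (restr Z n).length = n := by simp [restr]

theorem restr_getElem? (Z : ℕ → Bool) (n i : ℕ) (h : i < n) : (restr Z n)[i]? = some (Z i) := by
  simp [restr, h]

theorem restr_take (Z : ℕ → Bool) {m n : ℕ} (h : m ≤ n) : (restr Z n).take m = restr Z m := by
  rw [restr, ← List.map_take, List.take_range, Nat.min_eq_left h, restr]

theorem restr_prefix (Z : ℕ → Bool) {m n : ℕ} (h : m ≤ n) : restr Z m <+: restr Z n := by
  rw [← restr_take Z h]; exact List.take_prefix _ _

theorem restr_eq_iff (X Y : ℕ → Bool) (n : ℕ) : restr X n = restr Y n ↔ ∀ i < n, X i = Y i := by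
  simp [restr]

/-- `F` is a monotone computable functional, computing `f` from `Z`. -/
def UsesFn (Z : ℕ → Bool) (f : ℕ →. ℕ) (F : List Bool → ℕ → Option ℕ) : Prop :=
  Computable₂ F ∧ (∀ σ τ n v, σ <+: τ → F σ n = some v → F τ n = some v) ∧
    ∀ n v, v ∈ f n ↔ ∃ m, F (restr Z m) n = some v

theorem UsesFn.mono {Z : ℕ → Bool} {f : ℕ →. ℕ} {F : List Bool → ℕ → Option ℕ}
    (h : UsesFn Z f F) {m m' n v : ℕ} (hm : m ≤ m')
    (hv : F (restr Z m) n = some v) : F (restr Z m') n = some v :=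
  h.2.1 _ _ _ _ (restr_prefix Z hm) hv

theorem usesFn_total (Z : ℕ → Bool) (g : ℕ → ℕ) (hg : Computable g) :
    UsesFn Z (g : ℕ →. ℕ) (fun _ n => some (g n)) := by
  refine ⟨Computable.option_some.comp (hg.comp Computable.snd), fun _ _ _ _ _ h => h, ?_⟩
  intro n v
  simp [eq_comm]

theorem usesFn_oracle (Z : ℕ → Bool) :
    UsesFn Z (charFn Z) (fun σ n => (σ[n]?).map (fun b => cond b 1 0)) := by
  refine ⟨?_, ?_, ?_⟩
  · refine Computable.option_map (f := fun q : List Bool × ℕ => q.1[q.2]?)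
      (g := fun _ b => cond b 1 0) Computable.list_getElem? ?_
    exact Computable.cond Computable.snd (Computable.const 1) (Computable.const 0)
  · rintro σ _ n v ⟨ρ, rfl⟩ h
    rw [Option.map_eq_some_iff] at h ⊢
    obtain ⟨b, hb, hv⟩ := h
    refine ⟨b, ?_, hv⟩
    have hn : n < σ.length := (List.getElem?_eq_some_iff.1 hb).1
    rw [List.getElem?_append_left hn, hb]
  · intro n v
    constructor
    · intro h
      refine ⟨n+1, ?_⟩
      change ((restr Z (n+1))[n]?).map _ = _
      rw [restr_getElem? Z (n+1) n (by omega)]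
      simp only [charFn, Part.mem_some_iff] at h
      simp [h]
    · rintro ⟨m, h⟩
      rw [Option.map_eq_some_iff] at h
      obtain ⟨b, hb, hv⟩ := h
      have hn : n < m := by
        have := (List.getElem?_eq_some_iff.1 hb).1
        rwa [restr_length] at this
      rw [restr_getElem? _ _ _ hn] at hb
      simp only [charFn, Part.mem_some_iff]
      rw [← hv, Option.some.inj hb]

theorem usesFn_pair {Z : ℕ → Bool} {f g : ℕ →. ℕ} {F G : List Bool → ℕ → Option ℕ}
    (hf : UsesFn Z f F) (hg : UsesFn Z g G) :
    UsesFn Z (fun n => Nat.pair <$> f n <*> g n)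
      (fun σ n => (F σ n).bind fun a => (G σ n).map fun b => Nat.pair a b) := by
  refine ⟨?_, ?_, ?_⟩
  · refine Computable.option_bind (f := fun q : List Bool × ℕ => F q.1 q.2)
      (g := fun q a => (G q.1 q.2).map fun b => Nat.pair a b) hf.1 ?_
    refine Computable.option_map (f := fun q : (List Bool × ℕ) × ℕ => G q.1.1 q.1.2)
      (g := fun q b => Nat.pair q.2 b) (Computable.comp hg.1 Computable.fst) ?_
    exact comp_natPair (Computable.snd.comp Computable.fst) Computable.snd
  · intro σ τ n v hst h
    simp only [Option.bind_eq_some_iff, Option.map_eq_some_iff] at h ⊢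
    obtain ⟨a, ha, b, hb, hv⟩ := h
    exact ⟨a, hf.2.1 _ _ _ _ hst ha, b, hg.2.1 _ _ _ _ hst hb, hv⟩
  · intro n v
    simp only [Option.bind_eq_some_iff, Option.map_eq_some_iff]
    have : v ∈ (Nat.pair <$> f n <*> g n) ↔ ∃ a ∈ f n, ∃ b ∈ g n, Nat.pair a b = v := by
      simp [Seq.seq]
    rw [this]
    constructor
    · rintro ⟨a, ha, b, hb, hv⟩
      obtain ⟨m1, h1⟩ := (hf.2.2 _ _).1 ha
      obtain ⟨m2, h2⟩ := (hg.2.2 _ _).1 hb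
      exact ⟨max m1 m2, a, hf.mono (le_max_left _ _) h1, b, hg.mono (le_max_right _ _) h2, hv⟩
    · rintro ⟨m, a, ha, b, hb, hv⟩
      exact ⟨a, (hf.2.2 _ _).2 ⟨m, ha⟩, b, (hg.2.2 _ _).2 ⟨m, hb⟩, hv⟩

theorem usesFn_comp {Z : ℕ → Bool} {f g : ℕ →. ℕ} {F G : List Bool → ℕ → Option ℕ}
    (hf : UsesFn Z f F) (hg : UsesFn Z g G) :
    UsesFn Z (fun n => g n >>= f) (fun σ n => (G σ n).bind fun a => F σ a) := by
  refine ⟨?_, ?_, ?_⟩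
  · refine Computable.option_bind (f := fun q : List Bool × ℕ => G q.1 q.2)
      (g := fun q a => F q.1 a) hg.1 ?_
    exact hf.1.comp (Computable.fst.comp Computable.fst) Computable.snd
  · intro σ τ n v hst h
    simp only [Option.bind_eq_some_iff] at h ⊢
    obtain ⟨a, ha, hv⟩ := h
    exact ⟨a, hg.2.1 _ _ _ _ hst ha, hf.2.1 _ _ _ _ hst hv⟩
  · intro n v
    simp only [Option.bind_eq_some_iff]
    have : v ∈ (g n >>= f) ↔ ∃ a ∈ g n, v ∈ f a := Part.mem_bind_iff
    rw [this]
    constructor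
    · rintro ⟨a, ha, hv⟩
      obtain ⟨m1, h1⟩ := (hg.2.2 _ _).1 ha
      obtain ⟨m2, h2⟩ := (hf.2.2 _ _).1 hv
      exact ⟨max m1 m2, a, hg.mono (le_max_left _ _) h1, hf.mono (le_max_right _ _) h2⟩
    · rintro ⟨m, a, ha, hv⟩
      exact ⟨a, (hg.2.2 _ _).2 ⟨m, ha⟩, (hf.2.2 _ _).2 ⟨m, hv⟩⟩

/-- Primitive recursion with values in `Option`. -/
def precF (F G : List Bool → ℕ → Option ℕ) (σ : List Bool) (a : ℕ) (n : ℕ) : Option ℕ :=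
  Nat.rec (F σ a) (fun y IH => IH.bind fun i => G σ (Nat.pair a (Nat.pair y i))) n

theorem usesFn_prec {Z : ℕ → Bool} {f g : ℕ →. ℕ} {F G : List Bool → ℕ → Option ℕ}
    (hf : UsesFn Z f F) (hg : UsesFn Z g G) :
    UsesFn Z (Nat.unpaired fun a n =>
      n.rec (f a) fun y IH => do let i ← IH; g (Nat.pair a (Nat.pair y i)))
      (fun σ n => precF F G σ n.unpair.1 n.unpair.2) := by
  have hmono : ∀ σ τ a n v, σ <+: τ → precF F G σ a n = some v → precF F G τ a n = some v := by
    intro σ τ a n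
    induction n with
    | zero => intro v hst h; exact hf.2.1 _ _ _ _ hst h
    | succ n ih =>
      intro v hst h
      simp only [precF, Option.bind_eq_some_iff] at h ⊢
      obtain ⟨i, hi, hv⟩ := h
      exact ⟨i, ih _ hst hi, hg.2.1 _ _ _ _ hst hv⟩
  refine ⟨?_, ?_, ?_⟩
  · unfold precF
    have u1 : Computable fun q : List Bool × ℕ => q.2.unpair.1 :=
      Computable.fst.comp (Computable.unpair.comp Computable.snd)
    have u2 : Computable fun q : List Bool × ℕ => q.2.unpair.2 :=
      Computable.snd.comp (Computable.unpair.comp Computable.snd)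
    refine Computable.nat_rec (f := fun q : List Bool × ℕ => q.2.unpair.2)
      (g := fun q => F q.1 q.2.unpair.1)
      (h := fun q (r : ℕ × Option ℕ) => r.2.bind fun i =>
        G q.1 (Nat.pair q.2.unpair.1 (Nat.pair r.1 i))) u2 (hf.1.comp Computable.fst u1) ?_
    refine Computable.option_bind (f := fun q : (List Bool × ℕ) × (ℕ × Option ℕ) => q.2.2)
      (g := fun q i => G q.1.1 (Nat.pair q.1.2.unpair.1 (Nat.pair q.2.1 i)))
      (Computable.snd.comp Computable.snd) ?_
    have w1 : Computable fun q : ((List Bool × ℕ) × (ℕ × Option ℕ)) × ℕ => q.1.1.2.unpair.1 :=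
      u1.comp (Computable.fst.comp Computable.fst)
    have w2 : Computable fun q : ((List Bool × ℕ) × (ℕ × Option ℕ)) × ℕ => q.1.2.1 :=
      Computable.fst.comp (Computable.snd.comp Computable.fst)
    exact hg.1.comp (Computable.fst.comp (Computable.fst.comp Computable.fst))
      (comp_natPair w1 (comp_natPair w2 Computable.snd))
  · intro σ τ n v hst h
    exact hmono _ _ _ _ _ hst h
  · intro n v
    have key : ∀ a n v, v ∈ (Nat.rec (f a) (fun y IH => do
        let i ← IH; g (Nat.pair a (Nat.pair y i))) n : Part ℕ) ↔
        ∃ m, precF F G (restr Z m) a n = some v := by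
      intro a n
      induction n with
      | zero => intro v; exact hf.2.2 _ _
      | succ n ih =>
        intro v
        simp only [precF, Option.bind_eq_some_iff]
        have : v ∈ ((Nat.rec (f a) (fun y IH => do
            let i ← IH; g (Nat.pair a (Nat.pair y i))) n : Part ℕ) >>= fun i =>
              g (Nat.pair a (Nat.pair n i))) ↔ ∃ i ∈ (Nat.rec (f a) (fun y IH => do
            let i ← IH; g (Nat.pair a (Nat.pair y i))) n : Part ℕ),
              v ∈ g (Nat.pair a (Nat.pair n i)) := by simp
        rw [this]
        constructor
        · rintro ⟨i, hi, hv⟩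
          obtain ⟨m1, h1⟩ := (ih _).1 hi
          obtain ⟨m2, h2⟩ := (hg.2.2 _ _).1 hv
          exact ⟨max m1 m2, i, hmono _ _ _ _ _ (restr_prefix Z (le_max_left _ _)) h1,
            hg.mono (le_max_right _ _) h2⟩
        · rintro ⟨m, i, hi, hv⟩
          exact ⟨i, (ih _).2 ⟨m, hi⟩, (hg.2.2 _ _).2 ⟨m, hv⟩⟩
    exact key _ _ _

/-- Test used for unbounded search. -/
def rfindQ (F : List Bool → ℕ → Option ℕ) (σ : List Bool) (a n : ℕ) : Bool :=
  decide (F σ (Nat.pair a n) = some 0) &&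
    allLT (fun j => decide (0 < (F σ (Nat.pair a j)).getD 0)) n

theorem rfindQ_iff (F : List Bool → ℕ → Option ℕ) (σ : List Bool) (a n : ℕ) : rfindQ F σ a n = true ↔
    F σ (Nat.pair a n) = some 0 ∧ ∀ j < n, ∃ v, 0 < v ∧ F σ (Nat.pair a j) = some v := by
  unfold rfindQ
  rw [Bool.and_eq_true, allLT_iff, decide_eq_true_iff]
  refine and_congr_right fun _ => forall₂_congr fun j _ => ?_
  rw [decide_eq_true_iff]
  cases F σ (Nat.pair a j) <;> simp

/-- Bounded search. -/
def rfindF (F : List Bool → ℕ → Option ℕ) (σ : List Bool) (a : ℕ) : ℕ → Option ℕ :=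
  Nat.rec none (fun n r => cond (rfindQ F σ a n) (some n) r)

theorem rfindF_iff (F : List Bool → ℕ → Option ℕ) (σ : List Bool) (a k v : ℕ) : rfindF F σ a k = some v ↔ v < k ∧ rfindQ F σ a v = true := by
  have huniq : ∀ n n', rfindQ F σ a n = true → rfindQ F σ a n' = true → n' ≤ n := by
    intro n n' h h'
    rw [rfindQ_iff] at h h'
    by_contra hlt
    obtain ⟨v, hv, hv'⟩ := h'.2 n (by omega)
    rw [h.1] at hv'
    have := Option.some.inj hv'
    omega
  induction k with
  | zero => simp [rfindF]
  | succ k ih =>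
    have e : rfindF F σ a (k+1) = cond (rfindQ F σ a k) (some k) (rfindF F σ a k) := rfl
    rw [e]
    cases hq : rfindQ F σ a k with
    | true =>
      simp only [cond_true, Option.some.injEq]
      constructor
      · rintro rfl; exact ⟨by omega, hq⟩
      · rintro ⟨_, h2⟩; exact le_antisymm (huniq _ _ h2 hq) (huniq _ _ hq h2)
    | false =>
      simp only [cond_false]
      refine ih.trans ?_
      constructor
      · rintro ⟨h1, h2⟩; exact ⟨by omega, h2⟩
      · rintro ⟨h1, h2⟩
        refine ⟨?_, h2⟩
        by_contra hk
        have : v = k := by omega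
        rw [this, hq] at h2
        exact absurd h2 (by simp)

theorem usesFn_rfind {Z : ℕ → Bool} {f : ℕ →. ℕ} {F : List Bool → ℕ → Option ℕ}
    (hf : UsesFn Z f F) :
    UsesFn Z (fun a => Nat.rfind fun n => (fun m => m = 0) <$> f (Nat.pair a n))
      (fun σ a => rfindF F σ a σ.length) := by
  refine ⟨?_, ?_, ?_⟩
  · have hQ : Computable fun q : (List Bool × ℕ) × ℕ => rfindQ F q.1.1 q.1.2 q.2 := by
      unfold rfindQ
      have p1 : Computable fun q : (List Bool × ℕ) × ℕ => F q.1.1 (Nat.pair q.1.2 q.2) :=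
        hf.1.comp (Computable.fst.comp Computable.fst)
          (comp_natPair (Computable.snd.comp Computable.fst) Computable.snd)
      have p2 : Computable fun q : ((List Bool × ℕ) × ℕ) × ℕ =>
          F q.1.1.1 (Nat.pair q.1.1.2 q.2) :=
        hf.1.comp (Computable.fst.comp (Computable.fst.comp Computable.fst))
          (comp_natPair (Computable.snd.comp (Computable.fst.comp Computable.fst)) Computable.snd)
      have p3 : Computable fun q : ((List Bool × ℕ) × ℕ) × ℕ =>
          (F q.1.1.1 (Nat.pair q.1.1.2 q.2)).getD 0 :=
        Computable.option_getD p2 (Computable.const 0)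
      have p4 : Computable fun q : ((List Bool × ℕ) × ℕ) × ℕ =>
          decide (0 < (F q.1.1.1 (Nat.pair q.1.1.2 q.2)).getD 0) :=
        comp_lt (Computable.const 0) p3
      have p5 : Computable fun q : (List Bool × ℕ) × ℕ =>
          decide (F q.1.1 (Nat.pair q.1.2 q.2) = some 0) :=
        comp_eq p1 (Computable.const (some 0))
      exact comp_and p5 (comp_allLT Computable.snd p4)
    unfold rfindF
    refine Computable.nat_rec (f := fun q : List Bool × ℕ => q.1.length)
      (g := fun q => none) (h := fun q (r : ℕ × Option ℕ) =>
        cond (rfindQ F q.1 q.2 r.1) (some r.1) r.2)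
      (Computable.list_length.comp Computable.fst) (Computable.const none) ?_
    have hQ2 := hQ.comp (g := fun q : (List Bool × ℕ) × (ℕ × Option ℕ) => (q.1, q.2.1))
      (Computable.pair Computable.fst (Computable.fst.comp Computable.snd))
    refine Computable.cond hQ2
      (Computable.option_some.comp (Computable.fst.comp Computable.snd))
      (Computable.snd.comp Computable.snd)
  · intro σ τ a v hst h
    rw [rfindF_iff, rfindQ_iff] at h ⊢
    refine ⟨lt_of_lt_of_le h.1 hst.length_le, hf.2.1 _ _ _ _ hst h.2.1, fun j hj => ?_⟩
    obtain ⟨w, hw, hw'⟩ := h.2.2 j hj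
    exact ⟨w, hw, hf.2.1 _ _ _ _ hst hw'⟩
  · intro a v
    have e1 : v ∈ Nat.rfind (fun n => (fun m => decide (m = 0)) <$> f (Nat.pair a n)) ↔
        0 ∈ f (Nat.pair a v) ∧ ∀ j < v, ∃ w, 0 < w ∧ w ∈ f (Nat.pair a j) := by
      refine Nat.mem_rfind.trans (and_congr ?_ (forall₂_congr fun j _ => ?_))
      · refine (Part.mem_map_iff _).trans ?_
        simp
      · refine (Part.mem_map_iff _).trans ?_
        simp [Nat.pos_iff_ne_zero, and_comm]
    refine e1.trans ?_
    constructor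
    · rintro ⟨h1, h2⟩
      obtain ⟨m1, h1⟩ := (hf.2.2 _ _).1 h1
      have : ∀ k, ∃ M, ∀ j < v, j < k →
          ∃ w, 0 < w ∧ F (restr Z M) (Nat.pair a j) = some w := by
        intro k
        induction k with
        | zero => exact ⟨0, fun j _ h => by omega⟩
        | succ k ih =>
          obtain ⟨M, hM⟩ := ih
          by_cases hk : k < v
          · obtain ⟨w, hw, hw'⟩ := h2 k hk
            obtain ⟨m2, h2'⟩ := (hf.2.2 _ _).1 hw'
            refine ⟨max M m2, fun j hj hjk => ?_⟩
            rcases Nat.lt_succ_iff_lt_or_eq.1 hjk with h | h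
            · obtain ⟨x, hx, hx'⟩ := hM j hj h
              exact ⟨x, hx, hf.mono (le_max_left _ _) hx'⟩
            · subst h; exact ⟨w, hw, hf.mono (le_max_right _ _) h2'⟩
          · exact ⟨M, fun j hj _ => hM j hj (by omega)⟩
      obtain ⟨M, hM⟩ := this v
      refine ⟨max (max m1 M) (v+1), ?_⟩
      rw [rfindF_iff, rfindQ_iff, restr_length]
      refine ⟨by omega, hf.mono (by omega) h1, fun j hj => ?_⟩
      obtain ⟨x, hx, hx'⟩ := hM j hj hj
      exact ⟨x, hx, hf.mono (by omega) hx'⟩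
    · rintro ⟨m, h⟩
      rw [rfindF_iff, rfindQ_iff] at h
      refine ⟨(hf.2.2 _ _).2 ⟨m, h.2.1⟩, fun j hj => ?_⟩
      obtain ⟨w, hw, hw'⟩ := h.2.2 j hj
      exact ⟨w, hw, (hf.2.2 _ _).2 ⟨m, hw'⟩⟩

theorem use_principle (Z : ℕ → Bool) {f : ℕ →. ℕ} (h : RecIn (charFn Z) f) :
    ∃ F, UsesFn Z f F := by
  induction h with
  | oracle => exact ⟨_, usesFn_oracle Z⟩
  | zero =>
    exact ⟨_, usesFn_total Z (fun _ => 0) (Computable.const 0)⟩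
  | succ => exact ⟨_, usesFn_total Z Nat.succ Computable.succ⟩
  | left => exact ⟨_, usesFn_total Z _ (Computable.fst.comp Computable.unpair)⟩
  | right => exact ⟨_, usesFn_total Z _ (Computable.snd.comp Computable.unpair)⟩
  | pair _ _ ih1 ih2 =>
    obtain ⟨F, hF⟩ := ih1
    obtain ⟨G, hG⟩ := ih2
    exact ⟨_, usesFn_pair hF hG⟩
  | comp _ _ ih1 ih2 =>
    obtain ⟨F, hF⟩ := ih1
    obtain ⟨G, hG⟩ := ih2
    exact ⟨_, usesFn_comp hF hG⟩
  | prec _ _ ih1 ih2 =>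
    obtain ⟨F, hF⟩ := ih1
    obtain ⟨G, hG⟩ := ih2
    exact ⟨_, usesFn_prec hF hG⟩
  | rfind _ ih =>
    obtain ⟨F, hF⟩ := ih
    exact ⟨_, usesFn_rfind hF⟩

end

section
/-! Part D: the construction. -/
open Nat.Partrec (Code)

section
variable {α : Type*} [Primcodable α]

theorem comp_evaln {k : α → ℕ} {e : α → ℕ} {n : α → ℕ} (hk : Computable k) (he : Computable e)
    (hn : Computable n) :
    Computable fun a => Code.evaln (k a) (Denumerable.ofNat Code (e a)) (n a) := by
  have h := Code.primrec_evaln.to_comp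
  have h2 : Computable fun a => Denumerable.ofNat Code (e a) := (Computable.ofNat Code).comp he
  have h3 : Computable fun a => ((k a, Denumerable.ofNat Code (e a)), n a) :=
    Computable.pair (Computable.pair hk h2) hn
  exact h.comp h3
end

/-- Stage `s` of the `e`-th c.e. set. -/
def Aof (e s x : ℕ) : Bool := (Code.evaln s (Denumerable.ofNat Code e.unpair.1) x).isSome

/-- The `e`-th test that an oracle string `σ` computes the string `α`. -/
def conv (e : ℕ) (σ α : List Bool) : Bool :=
  anyLT (fun m => decide (Code.evaln σ.length (Denumerable.ofNat Code e.unpair.2)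
    (Encodable.encode (σ.take m, α)) = some 1)) (σ.length + 1)

section
variable {α : Type*} [Primcodable α]

theorem comp_Aof {e s x : α → ℕ} (he : Computable e) (hs : Computable s) (hx : Computable x) :
    Computable fun a => Aof (e a) (s a) (x a) := by
  have h1 : Computable fun a => (e a).unpair.1 :=
    Computable.fst.comp (Computable.unpair.comp he)
  exact Primrec.option_isSome.to_comp.comp (comp_evaln hs h1 hx)

theorem comp_restrA {e s n : α → ℕ} (he : Computable e) (hs : Computable s) (hn : Computable n) :
    Computable fun a => restr (Aof (e a) (s a)) (n a) := by
  have h : Computable fun q : α × ℕ => Aof (e q.1) (s q.1) q.2 :=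
    comp_Aof (he.comp Computable.fst) (hs.comp Computable.fst) Computable.snd
  exact comp_map_range hn h

theorem comp_conv {e : α → ℕ} {σ τ : α → List Bool} (he : Computable e) (hσ : Computable σ)
    (hτ : Computable τ) : Computable fun a => conv (e a) (σ a) (τ a) := by
  have h1 : Computable fun q : α × ℕ => (e q.1).unpair.2 :=
    Computable.snd.comp (Computable.unpair.comp (he.comp Computable.fst))
  have hl : Computable fun a => (σ a).length := Computable.list_length.comp hσ
  have h2 : Computable fun q : α × ℕ => (σ q.1).length := hl.comp Computable.fst
  have h3 : Computable fun q : α × ℕ => (σ q.1).take q.2 :=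
    Primrec.list_take.to_comp.comp Computable.snd (hσ.comp Computable.fst)
  have h4 : Computable fun q : α × ℕ => ((σ q.1).take q.2, τ q.1) :=
    Computable.pair h3 (hτ.comp Computable.fst)
  have h5 : Computable fun q : α × ℕ => Encodable.encode ((σ q.1).take q.2, τ q.1) :=
    Computable.encode.comp h4
  have h6 : Computable fun q : α × ℕ => decide (Code.evaln (σ q.1).length
      (Denumerable.ofNat Code (e q.1).unpair.2) (Encodable.encode ((σ q.1).take q.2, τ q.1))
        = some 1) :=
    comp_eq (comp_evaln h2 h1 h5) (Computable.const (some 1))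
  have h7 : Computable fun a => (σ a).length + 1 := comp_add hl (Computable.const 1)
  exact comp_anyLT h7 h6
end

theorem Aof_mono {e s s' x : ℕ} (h : s ≤ s') (hx : Aof e s x = true) : Aof e s' x = true := by
  unfold Aof at *
  obtain ⟨v, hv⟩ := Option.isSome_iff_exists.1 hx
  exact Option.isSome_iff_exists.2 ⟨v, Code.evaln_mono h hv⟩

theorem conv_mono {e : ℕ} {X : ℕ → Bool} {t t' : ℕ} {α : List Bool} (h : t ≤ t')
    (hc : conv e (restr X t) α = true) : conv e (restr X t') α = true := by
  unfold conv at *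
  rw [anyLT_iff] at *
  obtain ⟨m, hm, h1⟩ := hc
  rw [restr_length] at *
  refine ⟨m, by omega, ?_⟩
  rw [decide_eq_true_iff] at *
  rw [restr_take _ (by omega)] at *
  exact Code.evaln_mono h h1

theorem exists_index {A Z : ℕ → Bool} (hA : CE A) (hZ : TuringLE A Z) :
    ∃ e, (∀ α, (∃ M, conv e (restr Z M) α = true) ↔ α = restr A α.length) ∧
      (∀ x, A x = true ↔ ∃ s, Aof e s x = true) := by
  obtain ⟨f, hf, hfA⟩ := hA
  obtain ⟨c1, hc1⟩ := Code.exists_code.1 hf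
  obtain ⟨F, hF⟩ := use_principle Z hZ
  let Ψ : List Bool × List Bool → Bool := fun q =>
    allLT (fun i => decide (F q.1 i = some (cond (q.2.getD i false) 1 0))) q.2.length
  have hΨ : Computable Ψ := by
    have g1 : Computable fun q : (List Bool × List Bool) × ℕ => F q.1.1 q.2 :=
      hF.1.comp (Computable.fst.comp Computable.fst) Computable.snd
    have g2 : Computable fun q : (List Bool × List Bool) × ℕ => q.1.2.getD q.2 false :=
      (Primrec.list_getD false).to_comp.comp (Computable.snd.comp Computable.fst) Computable.snd
    have g3 : Computable fun q : (List Bool × List Bool) × ℕ =>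
        some (cond (q.1.2.getD q.2 false) 1 0) :=
      Computable.option_some.comp (Computable.cond g2 (Computable.const 1) (Computable.const 0))
    have g4 : Computable fun q : (List Bool × List Bool) × ℕ =>
        decide (F q.1.1 q.2 = some (cond (q.1.2.getD q.2 false) 1 0)) := comp_eq g1 g3
    exact comp_allLT (Computable.list_length.comp Computable.snd) g4
  obtain ⟨c2, hc2⟩ := Code.exists_code.1 hΨ
  have hΨ_iff : ∀ M α, Ψ (restr Z M, α) = true ↔
      ∀ i < α.length, F (restr Z M) i = some (cond (α.getD i false) 1 0) := by
    intro M α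
    simp only [Ψ, allLT_iff, decide_eq_true_iff]
  have heval : ∀ q, c2.eval (Encodable.encode q) = Part.some (Encodable.encode (Ψ q)) := by
    intro q
    rw [hc2]
    simp
  have hFA : ∀ i v, (∃ m, F (restr Z m) i = some v) ↔ v = cond (A i) 1 0 := by
    intro i v
    rw [← hF.2.2]
    simp [charFn]
  refine ⟨Nat.pair (Encodable.encode c1) (Encodable.encode c2), ?_, ?_⟩
  · intro α
    constructor
    · rintro ⟨M, hM⟩
      unfold conv at hM
      rw [anyLT_iff] at hM
      obtain ⟨m, hm, h1⟩ := hM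
      rw [restr_length] at hm h1
      rw [decide_eq_true_iff, Nat.unpair_pair, Denumerable.ofNat_encode,
        restr_take _ (by omega)] at h1
      have h2 := Code.evaln_sound h1
      rw [heval] at h2
      have h3 : Ψ (restr Z m, α) = true := by
        cases hh : Ψ (restr Z m, α) with
        | true => rfl
        | false => rw [hh] at h2; simp at h2
      rw [hΨ_iff] at h3
      refine List.ext_getElem (by rw [restr_length]) fun i hi _ => ?_
      have h4 := (hFA i _).1 ⟨m, h3 i hi⟩
      rw [List.getD_eq_getElem _ _ hi] at h4
      simp only [restr, List.getElem_map, List.getElem_range]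
      revert h4
      cases α[i] <;> cases A i <;> simp
    · intro hα
      have : ∀ k, ∃ M, ∀ i < α.length, i < k →
          F (restr Z M) i = some (cond (α.getD i false) 1 0) := by
        intro k
        induction k with
        | zero => exact ⟨0, fun _ _ h => by omega⟩
        | succ k ih =>
          obtain ⟨M, hM⟩ := ih
          by_cases hk : k < α.length
          · have : α.getD k false = A k := by
              rw [hα, List.getD_eq_getElem _ _ (by rwa [restr_length])]
              simp [restr]
            obtain ⟨M2, h2⟩ := (hFA k _).2 rfl
            refine ⟨max M M2, fun i hi hik => ?_⟩
            rcases Nat.lt_succ_iff_lt_or_eq.1 hik with h | h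
            · exact hF.mono (le_max_left _ _) (hM i hi h)
            · subst h; rw [this]; exact hF.mono (le_max_right _ _) h2
          · exact ⟨M, fun i hi _ => hM i hi (by omega)⟩
      obtain ⟨M, hM⟩ := this α.length
      have hP : Ψ (restr Z M, α) = true := (hΨ_iff _ _).2 fun i hi => hM i hi hi
      have h2 : 1 ∈ c2.eval (Encodable.encode (restr Z M, α)) := by
        rw [heval, hP]; simp
      obtain ⟨k, hk⟩ := Code.evaln_complete.1 h2
      refine ⟨max M k, ?_⟩
      unfold conv
      rw [anyLT_iff, restr_length]
      refine ⟨M, by omega, ?_⟩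
      rw [decide_eq_true_iff, Nat.unpair_pair, Denumerable.ofNat_encode,
        restr_take _ (by omega)]
      exact Code.evaln_mono (le_max_right _ _) hk
  · intro x
    rw [hfA, ← hc1]
    unfold Aof
    rw [Nat.unpair_pair, Denumerable.ofNat_encode]
    constructor
    · intro h
      obtain ⟨v, hv⟩ := Part.dom_iff_mem.1 h
      obtain ⟨k, hk⟩ := Code.evaln_complete.1 hv
      exact ⟨k, Option.isSome_iff_exists.2 ⟨v, hk⟩⟩
    · rintro ⟨s, hs⟩
      obtain ⟨v, hv⟩ := Option.isSome_iff_exists.1 hs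
      exact Part.dom_iff_mem.2 ⟨v, Code.evaln_sound hv⟩

end

section
/-! Part E: the construction: definitions and computability. -/

/-- Block and index of a level. -/
def blk (p : ℕ) : ℕ × ℕ :=
  Nat.rec (0, 0) (fun _ q => bif decide (q.2 = q.1) then (q.1 + 1, 0) else (q.1, q.2 + 1)) p

/-- Rank of a level. -/
def rho (p : ℕ) : ℕ := p - (blk p).2 + ((blk p).1 - (blk p).2)

/-- Parameters of the construction. -/
structure Par where
  f : ℕ → Option (List Bool)
  hf : Computable f
  c : ℕ → ℕ → ℚ
  hc : CostFunction c
  N : ℕ → ℕ → List ℕ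
  hN : Computable₂ N
  b : ℕ → ℕ
  hb : Computable b
  N_len : ∀ m s, (N m s).length ≤ b m
  N_mono : ∀ m s, N m s <+: N m (s + 1)
  N_spec : ∀ m x s, x < s → ((1 : ℚ) / 2) ^ m ≤ c x s → ∃ n ∈ N m s, x < n
  lim : ∀ k, ∃ y0, ∀ y ≥ y0, ∀ s, c y s < ((1 : ℚ) / 2) ^ k
  X0 : ℕ → Bool
  hX0 : ∀ i σ, f i = some σ → ¬ InitSeg σ X0

/-- Labels. -/
abbrev Lab := ℕ × ℕ × ℕ × ℕ
/-- States of a node. -/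
abbrev St := List (ℕ × ℕ) × ℕ × ℕ × ℕ

/-- Is the string consistent with a label? -/
def okL (l : Lab) (σ : List Bool) : Bool :=
  bif decide (l.1 = 0) then true
  else bif decide (l.1 = 1) then
    decide ((σ.getD l.2.1 (decide (l.2.2.1 = 1))) = decide (l.2.2.1 = 1))
  else bif decide (l.1 = 2) then
    allLT (fun i => !(conv l.2.1 σ (restr (Aof l.2.1 (l.2.2.1 + i)) l.2.2.1)))
      (σ.length + 1 - l.2.2.1)
  else !(conv l.2.1 σ (restr (Aof l.2.1 l.2.2.2) l.2.2.1))

/-- Does the node have a restricting label for `e`? -/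
def hasLab (e : ℕ) (τ : List Lab) : Bool :=
  !(allL (fun l : Lab => !(decide (2 ≤ l.1) && decide (l.2.1 = e))) τ)

/-- The label of the child determined by the state. -/
def labOf (τ : List Lab) (st : St) : Lab :=
  bif decide ((blk τ.length).2 = (blk τ.length).1) then (1, (blk τ.length).1, st.2.1, 0)
  else bif decide (st.2.1 = 0) then (0, 0, 0, 0)
  else bif decide (st.2.1 = 1) then (2, (blk τ.length).2, st.2.2.1, 0)
  else (3, (blk τ.length).2, st.2.2.1, st.2.2.2)

namespace Par
variable (Q : Par)

/-- Consistency with the class. -/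
def okP (σ : List Bool) : Bool :=
  allLT (fun i => Option.casesOn (Q.f i) true (fun ρ => !(decide (σ.take ρ.length = ρ)))) σ.length

/-- Consistency with the class and all labels. -/
def okAll (τ : List Lab) (σ : List Bool) : Bool := Q.okP σ && allL (fun l => okL l σ) τ

/-- The class given by the labels looks nonempty at stage `t`. -/
def alive (τ : List Lab) (t : ℕ) : Bool :=
  anyLT (fun x => Q.okAll τ (restr x.testBit t)) (2 ^ t)

/-- The sequence `G`. -/
def G (t : ℕ) : ℕ := Nat.rec 1 (fun t g => g * (3 * Q.b (g + t) + 2)) t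
/-- The threshold exponents. -/
def mm (t : ℕ) : ℕ := Q.G t + t
/-- Bound on the number of states. -/
def W (t : ℕ) : ℕ := 3 * Q.b (Q.mm t) + 2

/-- One step of the node process. -/
def step (τ : List Lab) (s : ℕ) (st : St) : St :=
  bif decide ((blk τ.length).2 = (blk τ.length).1) then
    (bif decide (st.2.1 = 0) && !(Q.alive (labOf τ st :: τ) s) then ([], 1, 0, 0) else st)
  else bif hasLab (blk τ.length).2 τ then st
  else bif decide (st.2.1 = 0) then
    Option.casesOn ((Q.N (Q.mm (rho τ.length)) s)[st.1.length]?) st (fun n => (st.1, 1, n, 0))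
  else bif Q.alive (labOf τ st :: τ) s then st
  else bif decide (st.2.1 = 1) then (st.1, 2, st.2.2.1, s)
  else (st.1 ++ [(st.2.2.1, st.2.2.2)], 0, 0, 0)

/-- State of the node process. -/
def state (τ : List Lab) (s : ℕ) : St :=
  Nat.rec ([], 0, 0, 0) (fun s st => Q.step τ (s + 1) st) s

/-- The path at stage `s`. -/
def path (s p : ℕ) : List Lab := Nat.rec [] (fun _ τ => labOf τ (Q.state τ s) :: τ) p

end Par

section
variable {α : Type*} [Primcodable α]

theorem comp_blk : Computable blk := by
  unfold blk
  have h1 : Computable fun q : ℕ × ℕ × ℕ × ℕ => q.2.2.1 :=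
    Computable.fst.comp (Computable.snd.comp Computable.snd)
  have h2 : Computable fun q : ℕ × ℕ × ℕ × ℕ => q.2.2.2 :=
    Computable.snd.comp (Computable.snd.comp Computable.snd)
  have h3 : Computable fun q : ℕ × ℕ × ℕ × ℕ => (bif decide (q.2.2.2 = q.2.2.1) then
      (q.2.2.1 + 1, 0) else (q.2.2.1, q.2.2.2 + 1)) :=
    Computable.cond (comp_eq h2 h1)
      (Computable.pair (comp_add h1 (Computable.const 1)) (Computable.const 0))
      (Computable.pair h1 (comp_add h2 (Computable.const 1)))
  exact Computable.nat_rec (h := fun _ (q : ℕ × ℕ × ℕ) => bif decide (q.2.2 = q.2.1) then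
      (q.2.1 + 1, 0) else (q.2.1, q.2.2 + 1)) Computable.id (Computable.const (0, 0)) h3

theorem comp_blk1 : Computable fun p => (blk p).1 := Computable.fst.comp comp_blk
theorem comp_blk2 : Computable fun p => (blk p).2 := Computable.snd.comp comp_blk

theorem comp_rho : Computable rho :=
  comp_add (comp_sub Computable.id comp_blk2) (comp_sub comp_blk1 comp_blk2)

theorem comp_okL {l : α → Lab} {σ : α → List Bool} (hl : Computable l) (hσ : Computable σ) :
    Computable fun a => okL (l a) (σ a) := by
  have l1 : Computable fun a => (l a).1 := Computable.fst.comp hl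
  have l2 : Computable fun a => (l a).2.1 := Computable.fst.comp (Computable.snd.comp hl)
  have l3 : Computable fun a => (l a).2.2.1 :=
    Computable.fst.comp (Computable.snd.comp (Computable.snd.comp hl))
  have l4 : Computable fun a => (l a).2.2.2 :=
    Computable.snd.comp (Computable.snd.comp (Computable.snd.comp hl))
  have hlen : Computable fun a => (σ a).length := Computable.list_length.comp hσ
  unfold okL
  refine Computable.cond (comp_eq l1 (Computable.const 0)) (Computable.const true) ?_
  refine Computable.cond (comp_eq l1 (Computable.const 1)) ?_ ?_
  · have d : Computable fun a => decide ((l a).2.2.1 = 1) := comp_eq l3 (Computable.const 1)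
    have g : Computable fun a => (σ a)[(l a).2.1]? := Computable.list_getElem?.comp hσ l2
    have g2 : Computable fun a => (σ a).getD (l a).2.1 (decide ((l a).2.2.1 = 1)) :=
      (Computable.option_getD g d).of_eq fun a => by rw [List.getD_eq_getElem?_getD]
    exact comp_eq g2 d
  refine Computable.cond (comp_eq l1 (Computable.const 2)) ?_ ?_
  · have r1 : Computable fun q : α × ℕ => (l q.1).2.2.1 + q.2 :=
      comp_add (l3.comp Computable.fst) Computable.snd
    have r2 : Computable fun q : α × ℕ => restr (Aof (l q.1).2.1 ((l q.1).2.2.1 + q.2))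
        (l q.1).2.2.1 :=
      comp_restrA (l2.comp Computable.fst) r1 (l3.comp Computable.fst)
    have r3 : Computable fun q : α × ℕ => !(conv (l q.1).2.1 (σ q.1)
        (restr (Aof (l q.1).2.1 ((l q.1).2.2.1 + q.2)) (l q.1).2.2.1)) :=
      comp_not (comp_conv (l2.comp Computable.fst) (hσ.comp Computable.fst) r2)
    have r4 : Computable fun a => (σ a).length + 1 - (l a).2.2.1 :=
      comp_sub (comp_add hlen (Computable.const 1)) l3
    exact comp_allLT r4 r3
  · exact comp_not (comp_conv l2 hσ (comp_restrA l2 l4 l3))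

theorem comp_hasLab {e : α → ℕ} {τ : α → List Lab} (he : Computable e) (hτ : Computable τ) :
    Computable fun a => hasLab (e a) (τ a) := by
  have h1 : Computable fun q : α × Lab => decide (2 ≤ q.2.1) :=
    comp_le (Computable.const 2) (Computable.fst.comp Computable.snd)
  have h2 : Computable fun q : α × Lab => decide (q.2.2.1 = e q.1) :=
    comp_eq (Computable.fst.comp (Computable.snd.comp Computable.snd)) (he.comp Computable.fst)
  have h3 : Computable fun q : α × Lab => !(decide (2 ≤ q.2.1) && decide (q.2.2.1 = e q.1)) :=
    comp_not (comp_and h1 h2)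
  exact comp_not (comp_allL hτ h3)

theorem comp_labOf {τ : α → List Lab} {st : α → St} (hτ : Computable τ) (hst : Computable st) :
    Computable fun a => labOf (τ a) (st a) := by
  have hl : Computable fun a => (τ a).length := Computable.list_length.comp hτ
  have b1 : Computable fun a => (blk (τ a).length).1 := comp_blk1.comp hl
  have b2 : Computable fun a => (blk (τ a).length).2 := comp_blk2.comp hl
  have s1 : Computable fun a => (st a).2.1 := Computable.fst.comp (Computable.snd.comp hst)
  have s2 : Computable fun a => (st a).2.2.1 :=
    Computable.fst.comp (Computable.snd.comp (Computable.snd.comp hst))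
  have s3 : Computable fun a => (st a).2.2.2 :=
    Computable.snd.comp (Computable.snd.comp (Computable.snd.comp hst))
  unfold labOf
  refine Computable.cond (comp_eq b2 b1) ?_ ?_
  · exact Computable.pair (Computable.const 1) (Computable.pair b1 (Computable.pair s1
      (Computable.const 0)))
  refine Computable.cond (comp_eq s1 (Computable.const 0)) (Computable.const _) ?_
  refine Computable.cond (comp_eq s1 (Computable.const 1)) ?_ ?_
  · exact Computable.pair (Computable.const 2) (Computable.pair b2 (Computable.pair s2
      (Computable.const 0)))
  · exact Computable.pair (Computable.const 3) (Computable.pair b2 (Computable.pair s2 s3))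

variable (Q : Par)

theorem comp_okP {σ : α → List Bool} (hσ : Computable σ) : Computable fun a => Q.okP (σ a) := by
  have h1 : Computable fun q : α × ℕ => Q.f q.2 := Q.hf.comp Computable.snd
  have h2 : Computable fun q : (α × ℕ) × List Bool => !(decide ((σ q.1.1).take q.2.length = q.2)) :=
    comp_not (comp_eq (Primrec.list_take.to_comp.comp (Computable.list_length.comp Computable.snd)
      (hσ.comp (Computable.fst.comp Computable.fst))) Computable.snd)
  have h3 : Computable fun q : α × ℕ => (Option.casesOn (Q.f q.2) true
      (fun ρ => !(decide ((σ q.1).take ρ.length = ρ))) : Bool) :=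
    Computable.option_casesOn h1 (Computable.const true) h2
  exact comp_allLT (Computable.list_length.comp hσ) h3

theorem comp_okAll {τ : α → List Lab} {σ : α → List Bool} (hτ : Computable τ)
    (hσ : Computable σ) : Computable fun a => Q.okAll (τ a) (σ a) := by
  have h1 : Computable fun q : α × Lab => okL q.2 (σ q.1) :=
    comp_okL Computable.snd (hσ.comp Computable.fst)
  exact comp_and (comp_okP Q hσ) (comp_allL hτ h1)

theorem testBit_eq (x i : ℕ) : x.testBit i = decide (x / 2 ^ i % 2 = 1) := by
  rw [Nat.testBit_eq_decide_div_mod_eq]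

theorem comp_alive {τ : α → List Lab} {t : α → ℕ} (hτ : Computable τ) (ht : Computable t) :
    Computable fun a => Q.alive (τ a) (t a) := by
  have h1 : Computable fun q : (α × ℕ) × ℕ => q.1.2.testBit q.2 := by
    have : Computable fun q : (α × ℕ) × ℕ => decide (q.1.2 / 2 ^ q.2 % 2 = 1) :=
      comp_eq (comp_mod (comp_div (Computable.snd.comp Computable.fst)
        (comp_pow (Computable.const 2) Computable.snd)) (Computable.const 2)) (Computable.const 1)
    exact this.of_eq fun q => (testBit_eq _ _).symm
  have h2 : Computable fun q : α × ℕ => restr q.2.testBit (t q.1) :=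
    comp_map_range (ht.comp Computable.fst) h1
  have h3 : Computable fun q : α × ℕ => Q.okAll (τ q.1) (restr q.2.testBit (t q.1)) :=
    comp_okAll Q (hτ.comp Computable.fst) h2
  have h4 : Computable fun a => 2 ^ (t a) := comp_pow (Computable.const 2) ht
  exact comp_anyLT h4 h3

theorem comp_G : Computable Q.G := by
  unfold Par.G
  have h1 : Computable fun q : ℕ × ℕ × ℕ => q.2.1 := Computable.fst.comp Computable.snd
  have h2 : Computable fun q : ℕ × ℕ × ℕ => q.2.2 := Computable.snd.comp Computable.snd
  have h4 : Computable fun q : ℕ × ℕ × ℕ => Q.b (q.2.2 + q.2.1) := Q.hb.comp (comp_add h2 h1)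
  have h3 : Computable fun q : ℕ × ℕ × ℕ => q.2.2 * (3 * Q.b (q.2.2 + q.2.1) + 2) :=
    comp_mul h2 (comp_add (comp_mul (Computable.const 3) h4) (Computable.const 2))
  exact Computable.nat_rec (h := fun _ (q : ℕ × ℕ) => q.2 * (3 * Q.b (q.2 + q.1) + 2))
    Computable.id (Computable.const 1) h3

theorem comp_mm : Computable Q.mm := comp_add (comp_G Q) Computable.id

theorem comp_step {τ : α → List Lab} {s : α → ℕ} {st : α → St} (hτ : Computable τ)
    (hs : Computable s) (hst : Computable st) : Computable fun a => Q.step (τ a) (s a) (st a) := by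
  have hl : Computable fun a => (τ a).length := Computable.list_length.comp hτ
  have b1 : Computable fun a => (blk (τ a).length).1 := comp_blk1.comp hl
  have b2 : Computable fun a => (blk (τ a).length).2 := comp_blk2.comp hl
  have s0 : Computable fun a => (st a).1 := Computable.fst.comp hst
  have s1 : Computable fun a => (st a).2.1 := Computable.fst.comp (Computable.snd.comp hst)
  have s2 : Computable fun a => (st a).2.2.1 :=
    Computable.fst.comp (Computable.snd.comp (Computable.snd.comp hst))
  have s3 : Computable fun a => (st a).2.2.2 :=
    Computable.snd.comp (Computable.snd.comp (Computable.snd.comp hst))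
  have hlab : Computable fun a => labOf (τ a) (st a) :: τ a :=
    Computable.list_cons.comp (comp_labOf hτ hst) hτ
  have hal : Computable fun a => Q.alive (labOf (τ a) (st a) :: τ a) (s a) := comp_alive Q hlab hs
  unfold Par.step
  refine Computable.cond (comp_eq b2 b1) ?_ ?_
  · exact Computable.cond (comp_and (comp_eq s1 (Computable.const 0)) (comp_not hal))
      (Computable.const _) hst
  refine Computable.cond (comp_hasLab b2 hτ) hst ?_
  refine Computable.cond (comp_eq s1 (Computable.const 0)) ?_ ?_
  · have m1 : Computable fun a => Q.mm (rho (τ a).length) := (comp_mm Q).comp (comp_rho.comp hl)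
    have m2 : Computable fun a => Q.N (Q.mm (rho (τ a).length)) (s a) := Q.hN.comp m1 hs
    have m3 : Computable fun a => (Q.N (Q.mm (rho (τ a).length)) (s a))[(st a).1.length]? :=
      Computable.list_getElem?.comp m2 (Computable.list_length.comp s0)
    have m4 : Computable fun q : α × ℕ => (((st q.1).1, 1, q.2, 0) : St) :=
      Computable.pair (s0.comp Computable.fst) (Computable.pair (Computable.const 1)
        (Computable.pair Computable.snd (Computable.const 0)))
    exact Computable.option_casesOn m3 hst m4
  refine Computable.cond hal hst ?_
  refine Computable.cond (comp_eq s1 (Computable.const 1)) ?_ ?_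
  · exact Computable.pair s0 (Computable.pair (Computable.const 2) (Computable.pair s2 hs))
  · exact Computable.pair (Computable.list_concat.comp s0 (Computable.pair s2 s3))
      (Computable.const _)

theorem comp_state {τ : α → List Lab} {s : α → ℕ} (hτ : Computable τ) (hs : Computable s) :
    Computable fun a => Q.state (τ a) (s a) := by
  have h : Computable fun q : α × (ℕ × St) => Q.step (τ q.1) (q.2.1 + 1) q.2.2 :=
    comp_step Q (hτ.comp Computable.fst)
      (comp_add (Computable.fst.comp Computable.snd) (Computable.const 1))
      (Computable.snd.comp Computable.snd)
  exact Computable.nat_rec (h := fun a (q : ℕ × St) => Q.step (τ a) (q.1 + 1) q.2) hs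
    (Computable.const ([], 0, 0, 0)) h

theorem comp_path {s p : α → ℕ} (hs : Computable s) (hp : Computable p) :
    Computable fun a => Q.path (s a) (p a) := by
  have h1 : Computable fun q : α × (ℕ × List Lab) => q.2.2 := Computable.snd.comp Computable.snd
  have h : Computable fun q : α × (ℕ × List Lab) =>
      labOf q.2.2 (Q.state q.2.2 (s q.1)) :: q.2.2 :=
    Computable.list_cons.comp (comp_labOf h1 (comp_state Q h1 (hs.comp Computable.fst))) h1
  exact Computable.nat_rec (h := fun a (q : ℕ × List Lab) =>
    labOf q.2 (Q.state q.2 (s a)) :: q.2) hp (Computable.const []) h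
end

end

section
/-! Part F: basic verification. -/

/-- Triangular numbers. -/
def tri (k : ℕ) : ℕ := Nat.rec 0 (fun k t => t + k + 1) k

theorem tri_succ (k : ℕ) : tri (k + 1) = tri k + k + 1 := rfl

theorem comp_tri : Computable tri := by
  have h : Computable fun q : ℕ × ℕ × ℕ => q.2.2 + q.2.1 + 1 :=
    comp_add (comp_add (Computable.snd.comp Computable.snd) (Computable.fst.comp Computable.snd))
      (Computable.const 1)
  exact Computable.nat_rec (h := fun _ (q : ℕ × ℕ) => q.2 + q.1 + 1) Computable.id
    (Computable.const 0) h

theorem le_tri (k : ℕ) : k ≤ tri k := by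
  induction k with
  | zero => simp
  | succ k ih => rw [tri_succ]; omega

theorem tri_mono {j k : ℕ} (h : j ≤ k) : tri j ≤ tri k := by
  induction h with
  | refl => exact le_rfl
  | step _ ih => rw [tri_succ]; omega

theorem blk_succ (p : ℕ) : blk (p + 1) =
    bif decide ((blk p).2 = (blk p).1) then ((blk p).1 + 1, 0) else ((blk p).1, (blk p).2 + 1) :=
  rfl

theorem blk_spec (p : ℕ) : (blk p).2 ≤ (blk p).1 ∧ p = tri (blk p).1 + (blk p).2 := by
  induction p with
  | zero => exact ⟨le_rfl, rfl⟩
  | succ p ih =>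
    rw [blk_succ]
    by_cases h : (blk p).2 = (blk p).1
    · simp only [h, decide_true, cond_true, tri_succ]
      omega
    · simp only [h, decide_false, cond_false]
      omega

theorem tri_add_inj {k e k' e' : ℕ} (h : e ≤ k) (h' : e' ≤ k') (he : tri k + e = tri k' + e') :
    k = k' ∧ e = e' := by
  rcases lt_trichotomy k k' with hk | hk | hk
  · have := tri_mono (Nat.succ_le_of_lt hk)
    rw [Nat.succ_eq_add_one, tri_succ] at this
    omega
  · subst hk; omega
  · have := tri_mono (Nat.succ_le_of_lt hk)
    rw [Nat.succ_eq_add_one, tri_succ] at this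
    omega

theorem blk_tri {k e : ℕ} (h : e ≤ k) : blk (tri k + e) = (k, e) := by
  obtain ⟨h1, h2⟩ := blk_spec (tri k + e)
  obtain ⟨h3, h4⟩ := tri_add_inj h h1 h2
  exact Prod.ext h3.symm h4.symm

theorem rho_tri {k e : ℕ} (h : e ≤ k) : rho (tri k + e) = tri k + (k - e) := by
  unfold rho
  rw [blk_tri h]
  simp

theorem rho_eq (p : ℕ) : rho p = tri (blk p).1 + ((blk p).1 - (blk p).2) := by
  obtain ⟨h1, h2⟩ := blk_spec p
  conv_lhs => rw [h2]
  exact rho_tri h1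

theorem rho_inj {p q : ℕ} (h : rho p = rho q) : p = q := by
  obtain ⟨h1, h2⟩ := blk_spec p
  obtain ⟨h3, h4⟩ := blk_spec q
  rw [rho_eq, rho_eq] at h
  obtain ⟨h5, h6⟩ := tri_add_inj (by omega) (by omega) h
  rw [h2, h4, h5]
  omega

theorem rho_lt_tri {q n : ℕ} (h : q < tri n) : rho q < tri n := by
  obtain ⟨h1, h2⟩ := blk_spec q
  have hk : (blk q).1 < n := by
    by_contra hk
    have := tri_mono (not_lt.1 hk)
    omega
  have := tri_mono (Nat.succ_le_of_lt hk)
  rw [Nat.succ_eq_add_one, tri_succ] at this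
  rw [rho_eq]
  omega

/-- Weight of a state. -/
def wt (st : St) : ℕ := 3 * st.1.length + st.2.1

/-- Bit level. -/
def isBit (p : ℕ) : Prop := (blk p).2 = (blk p).1

namespace Par
variable (Q : Par)

theorem G_succ (t : ℕ) : Q.G (t + 1) = Q.G t * Q.W t := rfl

theorem W_pos (t : ℕ) : 0 < Q.W t := by unfold W; omega

theorem G_eq_prod (n : ℕ) : ∏ t ∈ Finset.range n, Q.W t = Q.G n := by
  induction n with
  | zero => rfl
  | succ n ih => rw [Finset.prod_range_succ, ih, G_succ]

theorem prod_le_G (S : Finset ℕ) (t : ℕ) (h : ∀ q ∈ S, rho q < t) :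
    ∏ q ∈ S, Q.W (rho q) ≤ Q.G t := by
  rw [← G_eq_prod, ← Finset.prod_image (s := S) (g := rho) (f := Q.W)]
  · refine Finset.prod_le_prod_of_subset_of_one_le' ?_ (fun i _ _ => Q.W_pos i)
    intro i hi
    obtain ⟨q, hq, rfl⟩ := Finset.mem_image.1 hi
    exact Finset.mem_range.2 (h q hq)
  · intro a _ b _ hab
    exact rho_inj hab

theorem state_succ (τ : List Lab) (s : ℕ) :
    Q.state τ (s + 1) = Q.step τ (s + 1) (Q.state τ s) := rfl

theorem path_succ (s p : ℕ) :
    Q.path s (p + 1) = labOf (Q.path s p) (Q.state (Q.path s p) s) :: Q.path s p := rfl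

theorem path_length (s p : ℕ) : (Q.path s p).length = p := by
  induction p with
  | zero => rfl
  | succ p ih => rw [path_succ, List.length_cons, ih]

/-- Case description of a step. -/
theorem step_cases (τ : List Lab) (s : ℕ) (st : St) :
    (isBit τ.length ∧ ((st.2.1 = 0 ∧ Q.alive (labOf τ st :: τ) s = false ∧
        Q.step τ s st = ([], 1, 0, 0)) ∨
      ((st.2.1 = 0 → Q.alive (labOf τ st :: τ) s = true) ∧ Q.step τ s st = st))) ∨
    (¬ isBit τ.length ∧ hasLab (blk τ.length).2 τ = true ∧ Q.step τ s st = st) ∨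
    (¬ isBit τ.length ∧ hasLab (blk τ.length).2 τ = false ∧ st.2.1 = 0 ∧
      (((Q.N (Q.mm (rho τ.length)) s)[st.1.length]? = none ∧ Q.step τ s st = st) ∨
      ∃ n, (Q.N (Q.mm (rho τ.length)) s)[st.1.length]? = some n ∧
        Q.step τ s st = (st.1, 1, n, 0))) ∨
    (¬ isBit τ.length ∧ hasLab (blk τ.length).2 τ = false ∧ st.2.1 ≠ 0 ∧
      Q.alive (labOf τ st :: τ) s = true ∧ Q.step τ s st = st) ∨
    (¬ isBit τ.length ∧ hasLab (blk τ.length).2 τ = false ∧ st.2.1 = 1 ∧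
      Q.alive (labOf τ st :: τ) s = false ∧ Q.step τ s st = (st.1, 2, st.2.2.1, s)) ∨
    (¬ isBit τ.length ∧ hasLab (blk τ.length).2 τ = false ∧ st.2.1 ≠ 0 ∧ st.2.1 ≠ 1 ∧
      Q.alive (labOf τ st :: τ) s = false ∧
      Q.step τ s st = (st.1 ++ [(st.2.2.1, st.2.2.2)], 0, 0, 0)) := by
  unfold step isBit
  by_cases h1 : (blk τ.length).2 = (blk τ.length).1
  · by_cases h2 : st.2.1 = 0 <;> cases h3 : Q.alive (labOf τ st :: τ) s <;> simp [h1, h2]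
  · cases h2 : hasLab (blk τ.length).2 τ
    · by_cases h3 : st.2.1 = 0
      · cases h4 : (Q.N (Q.mm (rho τ.length)) s)[st.1.length]? <;> simp [h1, h3]
      · cases h4 : Q.alive (labOf τ st :: τ) s
        · by_cases h5 : st.2.1 = 1 <;> simp [h1, h3, h5]
        · simp [h1, h3]
    · simp [h1]

theorem N_mono_getElem? {m s s' i n : ℕ} (h : s ≤ s') (hi : (Q.N m s)[i]? = some n) :
    (Q.N m s')[i]? = some n := by
  induction h with
  | refl => exact hi
  | step _ ih =>
    obtain ⟨ρ, hρ⟩ := Q.N_mono m _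
    rw [← hρ, List.getElem?_append_left (List.getElem?_eq_some_iff.1 ih).1, ih]

/-- Invariant of the node process. -/
structure Inv (τ : List Lab) (s : ℕ) (st : St) : Prop where
  ph : st.2.1 ≤ 2
  bit : isBit τ.length → st.1 = [] ∧ st.2.1 ≤ 1
  bit1 : isBit τ.length → st.2.1 = 1 →
    ∃ t ≤ s, Q.alive ((1, (blk τ.length).1, 0, 0) :: τ) t = false
  cert : ¬ isBit τ.length → ∀ (i : ℕ) (q : ℕ × ℕ), st.1[i]? = some q →
    (Q.N (Q.mm (rho τ.length)) s)[i]? = some q.1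
  cur : ¬ isBit τ.length → st.2.1 ≠ 0 →
    (Q.N (Q.mm (rho τ.length)) s)[st.1.length]? = some st.2.2.1
  idle : ¬ isBit τ.length → hasLab (blk τ.length).2 τ = true → st = ([], 0, 0, 0)
  ph2 : ¬ isBit τ.length → st.2.1 = 2 →
    Q.alive ((2, (blk τ.length).2, st.2.2.1, 0) :: τ) st.2.2.2 = false
  dead : ¬ isBit τ.length → ∀ q : ℕ × ℕ, q ∈ st.1 →
    ∃ t ≤ s, Q.alive ((3, (blk τ.length).2, q.1, q.2) :: τ) t = false

theorem Inv.mono {τ : List Lab} {s s' : ℕ} {st : St} (h : Q.Inv τ s st) (hs : s ≤ s') :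
    Q.Inv τ s' st where
  ph := h.ph
  bit := h.bit
  bit1 h1 h2 := by
    obtain ⟨t, ht, h3⟩ := h.bit1 h1 h2
    exact ⟨t, ht.trans hs, h3⟩
  cert h1 i q hq := Q.N_mono_getElem? hs (h.cert h1 i q hq)
  cur h1 h2 := Q.N_mono_getElem? hs (h.cur h1 h2)
  idle := h.idle
  ph2 := h.ph2
  dead h1 q hq := by
    obtain ⟨t, ht, h3⟩ := h.dead h1 q hq
    exact ⟨t, ht.trans hs, h3⟩

theorem inv_state (τ : List Lab) (s : ℕ) : Q.Inv τ s (Q.state τ s) := by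
  induction s with
  | zero =>
    have : Q.state τ 0 = ([], 0, 0, 0) := rfl
    rw [this]
    constructor <;> simp
  | succ s ih =>
    rw [state_succ]
    have ih := Inv.mono Q ih (Nat.le_succ s)
    generalize Q.state τ s = st at ih
    rcases Q.step_cases τ (s+1) st with ⟨h1, ⟨h2, h3, h4⟩ | ⟨h2, h4⟩⟩ | ⟨h1, h2, h4⟩ |
      ⟨h1, h2, h3, ⟨h5, h4⟩ | ⟨n, h5, h4⟩⟩ | ⟨h1, h2, h3, h5, h4⟩ | ⟨h1, h2, h3, h5, h4⟩ |
      ⟨h1, h2, h3, h3', h5, h4⟩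
    · rw [h4]
      constructor <;> try simp [h1]
      refine ⟨s+1, le_rfl, ?_⟩
      have h1' : (blk τ.length).2 = (blk τ.length).1 := h1
      simpa [labOf, h1', h2] using h3
    · rw [h4]; exact ih
    · rw [h4]; exact ih
    · rw [h4]; exact ih
    · rw [h4]
      constructor <;> try simp [h1, h2]
      · intro i q q' hq; exact ih.cert h1 i (q, q') hq
      · exact h5
      · intro a b hab; exact ih.dead h1 (a, b) hab
    · rw [h4]; exact ih
    · rw [h4]
      have h1' : ¬ (blk τ.length).2 = (blk τ.length).1 := h1
      constructor <;> try simp [h1, h2]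
      · intro i q q' hq; exact ih.cert h1 i (q, q') hq
      · exact ih.cur h1 (by omega)
      · simpa [labOf, h1', h3] using h5
      · intro a b hab; exact ih.dead h1 (a, b) hab
    · rw [h4]
      have h1' : ¬ (blk τ.length).2 = (blk τ.length).1 := h1
      constructor <;> try simp [h1, h2]
      · intro i q q' hq
        rcases lt_or_ge i st.1.length with hi | hi
        · rw [List.getElem?_append_left hi] at hq
          exact ih.cert h1 i (q, q') hq
        · rw [List.getElem?_append_right hi] at hq
          have : i - st.1.length = 0 := by
            by_contra h0
            rw [List.getElem?_eq_none (by simp; omega)] at hq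
            exact absurd hq (by simp)
          rw [this] at hq
          simp at hq
          have h6 : i = st.1.length := by omega
          have h7 := ih.cur h1 h3
          rw [hq] at h7
          rw [h6]; exact h7
      · rintro a b (hab | hab)
        · exact ih.dead h1 (a, b) hab
        · refine ⟨s+1, le_rfl, ?_⟩
          simpa [labOf, h1', h3, h3', hab] using h5

theorem wt_lt (τ : List Lab) (s : ℕ) : wt (Q.state τ s) < Q.W (rho τ.length) := by
  have h := Q.inv_state τ s
  unfold wt W
  by_cases hb : isBit τ.length
  · obtain ⟨h1, h2⟩ := h.bit hb
    rw [h1]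
    simp only [List.length_nil]
    omega
  · have hN := Q.N_len (Q.mm (rho τ.length)) s
    have hph := h.ph
    by_cases h0 : (Q.state τ s).2.1 = 0
    · have : (Q.state τ s).1.length ≤ (Q.N (Q.mm (rho τ.length)) s).length := by
        by_contra hlt
        push Not at hlt
        have := h.cert hb _ _ (List.getElem?_eq_getElem hlt)
        rw [List.getElem?_eq_none le_rfl] at this
        exact absurd this (by simp)
      omega
    · have := (List.getElem?_eq_some_iff.1 (h.cur hb h0)).1
      omega

theorem step_wt {τ : List Lab} {s t : ℕ} {st : St} (h : Q.Inv τ t st) :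
    wt st ≤ wt (Q.step τ s st) ∧ (wt st = wt (Q.step τ s st) → Q.step τ s st = st) ∧
      st.1 <+: (Q.step τ s st).1 := by
  have hph := h.ph
  rcases Q.step_cases τ s st with ⟨h1, ⟨h2, h3, h4⟩ | ⟨h2, h4⟩⟩ | ⟨h1, h2, h4⟩ |
      ⟨h1, h2, h3, ⟨h5, h4⟩ | ⟨n, h5, h4⟩⟩ | ⟨h1, h2, h3, h5, h4⟩ | ⟨h1, h2, h3, h5, h4⟩ |
      ⟨h1, h2, h3, h3', h5, h4⟩ <;> rw [h4]
  · have := (h.bit h1).1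
    simp [wt, this, h2]
  · simp
  · simp
  · simp
  · simp [wt, h3]
  · simp
  · simp [wt, h3]
  · simp only [wt, List.length_append, List.length_cons, List.length_nil]
    refine ⟨by omega, fun h => by omega, List.prefix_append _ _⟩

theorem wt_mono {τ : List Lab} {s s' : ℕ} (h : s ≤ s') :
    wt (Q.state τ s) ≤ wt (Q.state τ s') := by
  induction h with
  | refl => exact le_rfl
  | step _ ih => exact ih.trans (Q.step_wt (Q.inv_state τ _)).1

theorem certs_mono {τ : List Lab} {s s' : ℕ} (h : s ≤ s') :
    (Q.state τ s).1 <+: (Q.state τ s').1 := by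
  induction h with
  | refl => exact List.prefix_rfl
  | step _ ih => exact ih.trans (Q.step_wt (Q.inv_state τ _)).2.2

theorem state_const {τ : List Lab} {s s' : ℕ} (h : s ≤ s')
    (he : wt (Q.state τ s) = wt (Q.state τ s')) : Q.state τ s' = Q.state τ s := by
  induction h with
  | refl => rfl
  | @step t ht ih =>
    have h1 := Q.wt_mono (τ := τ) ht
    have h2 := Q.step_wt (s := t+1) (Q.inv_state τ t)
    rw [Nat.succ_eq_add_one, state_succ] at he ⊢
    have h3 : wt (Q.state τ t) = wt (Q.step τ (t+1) (Q.state τ t)) := by omega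
    rw [h2.2.1 h3]
    exact ih (by omega)

/-- Label on the path at level `q`. -/
def lb (s q : ℕ) : Lab := labOf (Q.path s q) (Q.state (Q.path s q) s)

theorem path_succ' (s p : ℕ) : Q.path s (p + 1) = Q.lb s p :: Q.path s p := rfl

theorem lb_eq_of_path_eq {s s' p : ℕ} (h : Q.path s p = Q.path s' p) :
    ∀ q < p, Q.lb s q = Q.lb s' q := by
  induction p with
  | zero => intro q hq; omega
  | succ p ih =>
    rw [path_succ', path_succ', List.cons.injEq] at h
    intro q hq
    rcases Nat.lt_succ_iff_lt_or_eq.1 hq with h' | h'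
    · exact ih h.2 q h'
    · rw [h']; exact h.1

theorem path_eq_of_lb_eq {s s' p : ℕ} (h : ∀ q < p, Q.lb s q = Q.lb s' q) :
    Q.path s p = Q.path s' p := by
  induction p with
  | zero => rfl
  | succ p ih =>
    rw [path_succ', path_succ', ih fun q hq => h q (by omega), h p (by omega)]

/-- The counting lemma. -/
theorem counting (u : ℕ → ℕ) (hu : Monotone u) (p : ℕ) (S I : Finset ℕ) (j1 : ℕ)
    (hI : ∀ j ∈ I, j1 ≤ j ∧ Q.path (u j) p ≠ Q.path (u (j + 1)) p)
    (hconst : ∀ q < p, q ∉ S → ∀ j ≥ j1, ∀ j' ≥ j1, Q.lb (u j) q = Q.lb (u j') q) :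
    I.card ≤ ∏ q ∈ S, Q.W (rho q) := by
  have hcard : (S.pi fun q => Finset.range (Q.W (rho q))).card = ∏ q ∈ S, Q.W (rho q) := by
    rw [Finset.card_pi]; simp
  rw [← hcard]
  refine Finset.card_le_card_of_injOn
    (fun j => fun q _ => wt (Q.state (Q.path (u j) q) (u j))) ?_ ?_
  · intro j _
    simp only [Finset.mem_coe, Finset.mem_pi, Finset.mem_range]
    intro q _
    have := Q.wt_lt (Q.path (u j) q) (u j)
    rwa [path_length] at this
  · have key : ∀ j ∈ I, ∀ j' ∈ I, j < j' →
        (∀ q ∈ S, wt (Q.state (Q.path (u j) q) (u j)) =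
          wt (Q.state (Q.path (u j') q) (u j'))) → False := by
      intro j hj j' _ hjj heq
      have hq : ∀ q ≤ p, ∀ i, j ≤ i → i ≤ j' → Q.path (u i) q = Q.path (u j) q := by
        intro q
        induction q with
        | zero => intro _ _ _ _; rfl
        | succ q ih =>
          intro hqp i h1 h2
          have ih := ih (by omega)
          rw [path_succ', path_succ', ih i h1 h2]
          congr 1
          by_cases hS : q ∈ S
          · have h3 := heq q hS
            rw [ih j' (by omega) le_rfl] at h3
            have h4 := Q.wt_mono (τ := Q.path (u j) q) (hu h1)
            have h5 := Q.wt_mono (τ := Q.path (u j) q) (hu h2)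
            have h6 := Q.state_const (τ := Q.path (u j) q) (hu h1) (by omega)
            unfold lb
            rw [ih i h1 h2, h6]
          · have := (hI j hj).1
            exact hconst q (by omega) hS i (by omega) j (by omega)
      exact (hI j hj).2 (hq p le_rfl (j+1) (by omega) (by omega)).symm
    intro j hj j' hj' heq
    have h1 : ∀ q ∈ S, wt (Q.state (Q.path (u j) q) (u j)) =
        wt (Q.state (Q.path (u j') q) (u j')) := fun q hq => congrFun (congrFun heq q) hq
    rcases lt_trichotomy j j' with h | h | h
    · exact (key j hj j' hj' h h1).elim
    · exact h
    · exact (key j' hj' j hj h fun q hq => (h1 q hq).symm).elim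

end Par

end

section
/-! Part G: limits, the true path and the set `Z`. -/

theorem okL_zero (a b c : ℕ) (σ : List Bool) : okL (0, a, b, c) σ = true := by
  simp [okL]

theorem okL_one (a v d M : ℕ) (X : ℕ → Bool) :
    okL (1, a, v, d) (restr X M) = true ↔ (a < M → X a = decide (v = 1)) := by
  have h : okL (1, a, v, d) (restr X M) =
      decide (((restr X M).getD a (decide (v = 1))) = decide (v = 1)) := by simp [okL]
  rw [h, decide_eq_true_eq, List.getD_eq_getElem?_getD]
  by_cases ha : a < M
  · rw [restr_getElem? X M a ha]; simp [ha]
  · rw [List.getElem?_eq_none (by rw [restr_length]; omega)]; simp [ha]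

theorem okL_two (e n d M : ℕ) (X : ℕ → Bool) :
    okL (2, e, n, d) (restr X M) = true ↔
      ∀ s, n ≤ s → s ≤ M → conv e (restr X M) (restr (Aof e s) n) = false := by
  have h : okL (2, e, n, d) (restr X M) =
      allLT (fun i => !(conv e (restr X M) (restr (Aof e (n + i)) n)))
        ((restr X M).length + 1 - n) := by simp [okL]
  rw [h, allLT_iff, restr_length]
  constructor
  · intro h s h1 h2
    have := h (s - n) (by omega)
    rw [show n + (s - n) = s by omega] at this
    simpa using this
  · intro h i hi
    have := h (n + i) (by omega) (by omega)
    simpa using this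

theorem okL_three (e n d M : ℕ) (X : ℕ → Bool) :
    okL (3, e, n, d) (restr X M) = true ↔
      conv e (restr X M) (restr (Aof e d) n) = false := by
  simp [okL]

theorem okL_ge_three (k e n d : ℕ) (σ : List Bool) (h : 3 ≤ k) :
    okL (k, e, n, d) σ = okL (3, e, n, d) σ := by
  have h0 : k ≠ 0 := by omega
  have h1 : k ≠ 1 := by omega
  have h2 : k ≠ 2 := by omega
  simp [okL, h0, h1, h2]

theorem conv_anti {e : ℕ} {X : ℕ → Bool} {t t' : ℕ} {α : List Bool} (h : t ≤ t')
    (hc : conv e (restr X t') α = false) : conv e (restr X t) α = false := by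
  cases h' : conv e (restr X t) α
  · rfl
  · rw [conv_mono h h'] at hc; exact absurd hc (by simp)

theorem okL_anti (l : Lab) {X : ℕ → Bool} {t t' : ℕ} (h : t ≤ t')
    (ho : okL l (restr X t') = true) : okL l (restr X t) = true := by
  obtain ⟨k, e, n, d⟩ := l
  rcases Nat.lt_or_ge k 3 with hk | hk
  · interval_cases k
    · exact okL_zero _ _ _ _
    · rw [okL_one] at ho ⊢
      intro h1; exact ho (by omega)
    · rw [okL_two] at ho ⊢
      intro s h1 h2
      exact conv_anti h (ho s h1 (by omega))
  · rw [okL_ge_three _ _ _ _ _ hk, okL_three] at ho ⊢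
    exact conv_anti h ho

namespace Par
variable (Q : Par)

theorem okP_iff (X : ℕ → Bool) (t : ℕ) : Q.okP (restr X t) = true ↔
    ∀ i < t, ∀ ρ, Q.f i = some ρ → ρ.length ≤ t → ¬ InitSeg ρ X := by
  unfold okP
  rw [allLT_iff, restr_length]
  refine forall_congr' fun i => forall_congr' fun hi => ?_
  cases hf : Q.f i with
  | none => simp
  | some ρ =>
    simp only [Bool.not_eq_true', decide_eq_false_iff_not, Option.some.injEq, forall_eq']
    constructor
    · intro h hl hI
      apply h
      rw [restr_take X hl]
      exact hI.symm
    · intro h hI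
      have hl : ρ.length ≤ t := by
        have := congrArg List.length hI
        rw [List.length_take, restr_length] at this
        omega
      apply h hl
      rw [restr_take X hl] at hI
      exact hI.symm

theorem okAll_iff (τ : List Lab) (σ : List Bool) :
    Q.okAll τ σ = true ↔ Q.okP σ = true ∧ ∀ l ∈ τ, okL l σ = true := by
  unfold okAll
  rw [Bool.and_eq_true, allL_iff]

theorem okAll_cons (l : Lab) (τ : List Lab) (σ : List Bool) :
    Q.okAll (l :: τ) σ = true ↔ okL l σ = true ∧ Q.okAll τ σ = true := by
  rw [okAll_iff, okAll_iff]
  simp only [List.mem_cons, forall_eq_or_imp]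
  tauto

theorem okAll_anti (τ : List Lab) {X : ℕ → Bool} {t t' : ℕ} (h : t ≤ t')
    (ho : Q.okAll τ (restr X t') = true) : Q.okAll τ (restr X t) = true := by
  rw [okAll_iff] at ho ⊢
  refine ⟨?_, fun l hl => okL_anti l h (ho.2 l hl)⟩
  have h1 := ho.1
  rw [okP_iff] at h1 ⊢
  intro i hi ρ h2 h3
  exact h1 i (by omega) ρ h2 (by omega)

theorem alive_iff (τ : List Lab) (t : ℕ) :
    Q.alive τ t = true ↔ ∃ X, Q.okAll τ (restr X t) = true := by
  unfold alive
  rw [anyLT_iff]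
  constructor
  · rintro ⟨x, _, h⟩
    exact ⟨_, h⟩
  · rintro ⟨X, h⟩
    refine ⟨Nat.ofBits fun i : Fin t => X i, Nat.ofBits_lt_two_pow _, ?_⟩
    rw [← h]
    congr 1
    rw [restr_eq_iff]
    intro i hi
    rw [Nat.testBit_ofBits_lt _ _ hi]

theorem alive_anti (τ : List Lab) {t t' : ℕ} (h : t ≤ t') (ha : Q.alive τ t' = true) :
    Q.alive τ t = true := by
  rw [alive_iff] at ha ⊢
  obtain ⟨X, hX⟩ := ha
  exact ⟨X, Q.okAll_anti τ h hX⟩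

theorem state_stab (τ : List Lab) : ∃ s0, ∀ s ≥ s0, Q.state τ s = Q.state τ s0 := by
  have hfin : (Set.range fun s => wt (Q.state τ s)).Finite := by
    refine (Set.finite_lt_nat (Q.W (rho τ.length))).subset ?_
    rintro _ ⟨s, rfl⟩
    exact Q.wt_lt τ s
  obtain ⟨_, ⟨s0, rfl⟩, hmax⟩ := hfin.exists_maximal ⟨_, 0, rfl⟩
  refine ⟨s0, fun s hs => Q.state_const hs ?_⟩
  have h1 := Q.wt_mono (τ := τ) hs
  exact le_antisymm h1 (hmax ⟨s, rfl⟩ h1)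

/-- The final state. -/
noncomputable def fs (τ : List Lab) : St := Q.state τ (Q.state_stab τ).choose

theorem fs_spec (τ : List Lab) : ∃ s0, ∀ s ≥ s0, Q.state τ s = Q.fs τ :=
  ⟨_, (Q.state_stab τ).choose_spec⟩

theorem fs_fix (τ : List Lab) : ∃ s0, ∀ s ≥ s0, Q.step τ s (Q.fs τ) = Q.fs τ := by
  obtain ⟨s0, h⟩ := Q.fs_spec τ
  refine ⟨s0 + 1, fun s hs => ?_⟩
  obtain ⟨t, rfl⟩ : ∃ t, s = t + 1 := ⟨s - 1, by omega⟩
  have h1 := h t (by omega)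
  have h2 := h (t + 1) (by omega)
  rw [state_succ, h1] at h2
  exact h2

theorem fs_inv (τ : List Lab) : ∃ s0, ∀ s ≥ s0, Q.Inv τ s (Q.fs τ) := by
  obtain ⟨s0, h⟩ := Q.fs_spec τ
  refine ⟨s0, fun s hs => ?_⟩
  rw [← h s hs]
  exact Q.inv_state τ s

/-- The true path. -/
noncomputable def tp (p : ℕ) : List Lab := Nat.rec [] (fun _ τ => labOf τ (Q.fs τ) :: τ) p

/-- True labels. -/
noncomputable def lbt (q : ℕ) : Lab := labOf (Q.tp q) (Q.fs (Q.tp q))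

theorem tp_succ (p : ℕ) : Q.tp (p + 1) = Q.lbt p :: Q.tp p := rfl

theorem tp_length (p : ℕ) : (Q.tp p).length = p := by
  induction p with
  | zero => rfl
  | succ p ih => rw [tp_succ, List.length_cons, ih]

theorem mem_tp (p : ℕ) (l : Lab) : l ∈ Q.tp p ↔ ∃ q < p, l = Q.lbt q := by
  induction p with
  | zero =>
    have : Q.tp 0 = [] := rfl
    simp [this]
  | succ p ih =>
    rw [tp_succ, List.mem_cons, ih]
    constructor
    · rintro (h | ⟨q, h1, h2⟩)
      · exact ⟨p, by omega, h⟩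
      · exact ⟨q, by omega, h2⟩
    · rintro ⟨q, h1, h2⟩
      rcases Nat.lt_succ_iff_lt_or_eq.1 h1 with h | h
      · exact Or.inr ⟨q, h, h2⟩
      · subst h; exact Or.inl h2

theorem path_lim (p : ℕ) : ∃ s0, ∀ s ≥ s0, Q.path s p = Q.tp p := by
  induction p with
  | zero => exact ⟨0, fun _ _ => rfl⟩
  | succ p ih =>
    obtain ⟨s0, h0⟩ := ih
    obtain ⟨s1, h1⟩ := Q.fs_spec (Q.tp p)
    refine ⟨max s0 s1, fun s hs => ?_⟩
    rw [path_succ, h0 s (by omega), h1 s (by omega)]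
    rfl

theorem state_lim (q : ℕ) : ∃ s0, ∀ s ≥ s0, Q.path s q = Q.tp q ∧
    Q.state (Q.tp q) s = Q.fs (Q.tp q) := by
  obtain ⟨s0, h0⟩ := Q.path_lim q
  obtain ⟨s1, h1⟩ := Q.fs_spec (Q.tp q)
  exact ⟨max s0 s1, fun s hs => ⟨h0 s (by omega), h1 s (by omega)⟩⟩

theorem labOf_bit {τ : List Lab} (st : St) (h : isBit τ.length) :
    labOf τ st = (1, (blk τ.length).1, st.2.1, 0) := by
  have h' : (blk τ.length).2 = (blk τ.length).1 := h
  simp [labOf, h']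

theorem labOf_zero {τ : List Lab} {st : St} (h : ¬ isBit τ.length) (h0 : st.2.1 = 0) :
    labOf τ st = (0, 0, 0, 0) := by
  have h' : ¬ (blk τ.length).2 = (blk τ.length).1 := h
  simp [labOf, h', h0]

theorem labOf_p1 {τ : List Lab} {st : St} (h : ¬ isBit τ.length) (h0 : st.2.1 = 1) :
    labOf τ st = (2, (blk τ.length).2, st.2.2.1, 0) := by
  have h' : ¬ (blk τ.length).2 = (blk τ.length).1 := h
  simp [labOf, h', h0]

theorem labOf_p2 {τ : List Lab} {st : St} (h : ¬ isBit τ.length) (h0 : st.2.1 = 2) :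
    labOf τ st = (3, (blk τ.length).2, st.2.2.1, st.2.2.2) := by
  have h' : ¬ (blk τ.length).2 = (blk τ.length).1 := h
  simp [labOf, h', h0]

theorem alive_tp (p : ℕ) : ∀ t, Q.alive (Q.tp p) t = true := by
  induction p with
  | zero =>
    intro t
    rw [alive_iff]
    refine ⟨Q.X0, ?_⟩
    rw [okAll_iff, okP_iff]
    refine ⟨fun i _ ρ h _ => Q.hX0 i ρ h, ?_⟩
    have : Q.tp 0 = [] := rfl
    simp [this]
  | succ p ih =>
    intro t
    rw [tp_succ]
    obtain ⟨s0, h0⟩ := Q.fs_fix (Q.tp p)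
    obtain ⟨s1, h1⟩ := Q.fs_inv (Q.tp p)
    have hinv := h1 s1 le_rfl
    have hfix := h0 (max s0 t) (le_max_left _ _)
    have hph := hinv.ph
    change Q.alive (labOf (Q.tp p) (Q.fs (Q.tp p)) :: Q.tp p) t = true
    have triv : ¬ isBit (Q.tp p).length → (Q.fs (Q.tp p)).2.1 = 0 →
        Q.alive (labOf (Q.tp p) (Q.fs (Q.tp p)) :: Q.tp p) t = true := by
      intro h2 h3
      rw [labOf_zero h2 h3]
      have := ih t
      rw [alive_iff] at this ⊢
      obtain ⟨X, hX⟩ := this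
      exact ⟨X, (Q.okAll_cons _ _ _).2 ⟨okL_zero _ _ _ _, hX⟩⟩
    generalize hst : Q.fs (Q.tp p) = st at *
    generalize hτ : Q.tp p = τ at *
    rcases Q.step_cases τ (max s0 t) st with ⟨h1, ⟨h2, h3, h4⟩ | ⟨h2, h4⟩⟩ | ⟨h1, h2, h4⟩ |
      ⟨h1, h2, h3, ⟨h5, h4⟩ | ⟨n, h5, h4⟩⟩ | ⟨h1, h2, h3, h5, h4⟩ | ⟨h1, h2, h3, h5, h4⟩ |
      ⟨h1, h2, h3, h3', h5, h4⟩
    · rw [h4] at hfix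
      rw [← hfix] at h2
      exact absurd h2 (by simp)
    · by_cases h6 : st.2.1 = 0
      · exact Q.alive_anti _ (le_max_right _ _) (h2 h6)
      · have h7 : st.2.1 = 1 := by
          have := (hinv.bit h1).2
          omega
        obtain ⟨t0, _, h8⟩ := hinv.bit1 h1 h7
        rw [labOf_bit _ h1, h7]
        have h9 := ih (max t t0)
        rw [alive_iff] at h9 ⊢
        obtain ⟨X, hX⟩ := h9
        refine ⟨X, (Q.okAll_cons _ _ _).2 ⟨?_, Q.okAll_anti _ (le_max_left _ _) hX⟩⟩
        rw [okL_one]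
        intro _
        by_contra hne
        have : Q.alive ((1, (blk τ.length).1, 0, 0) :: τ) t0 = true := by
          rw [alive_iff]
          refine ⟨X, (Q.okAll_cons _ _ _).2 ⟨?_, Q.okAll_anti _ (le_max_right _ _) hX⟩⟩
          rw [okL_one]
          intro _
          simpa using hne
        rw [h8] at this
        exact absurd this (by simp)
    · apply triv h1
      rw [hinv.idle h1 h2]
    · exact triv h1 h3
    · exact triv h1 h3
    · exact Q.alive_anti _ (le_max_right _ _) h5
    · rw [h4] at hfix
      rw [← hfix] at h3
      exact absurd h3 (by simp)
    · rw [h4] at hfix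
      rw [← hfix] at h3
      exact absurd h3 (by simp)

/-- The set constructed. -/
noncomputable def Z (m : ℕ) : Bool := decide ((Q.fs (Q.tp (tri m + m))).2.1 = 1)

/-- Its approximation. -/
def Zs (s m : ℕ) : Bool := decide ((Q.state (Q.path s (tri m + m)) s).2.1 = 1)

theorem isBit_tri (m : ℕ) : isBit (tri m + m) := by
  unfold isBit; rw [blk_tri le_rfl]

theorem okAll_Z (p M : ℕ) : Q.okAll (Q.tp p) (restr Q.Z M) = true := by
  have h := Q.alive_tp (max p (tri M)) M
  rw [alive_iff] at h
  obtain ⟨X, hX⟩ := h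
  rw [okAll_iff] at hX
  have hXZ : restr Q.Z M = restr X M := by
    rw [restr_eq_iff]
    intro m hm
    have h1 : tri m + m < max p (tri M) := by
      have := tri_mono (Nat.succ_le_of_lt hm)
      rw [Nat.succ_eq_add_one, tri_succ] at this
      exact lt_of_lt_of_le (by omega) (le_max_right _ _)
    have h2 := hX.2 _ ((Q.mem_tp _ _).2 ⟨_, h1, rfl⟩)
    have h3 : isBit (Q.tp (tri m + m)).length := by rw [tp_length]; exact isBit_tri m
    unfold lbt at h2
    rw [labOf_bit _ h3, tp_length, blk_tri le_rfl, okL_one] at h2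
    rw [h2 hm]
    rfl
  rw [hXZ, okAll_iff]
  refine ⟨hX.1, fun l hl => hX.2 l ?_⟩
  obtain ⟨q, h1, h2⟩ := (Q.mem_tp _ _).1 hl
  exact (Q.mem_tp _ _).2 ⟨q, lt_of_lt_of_le h1 (le_max_left _ _), h2⟩

theorem Z_mem : ∀ i σ, Q.f i = some σ → ¬ InitSeg σ Q.Z := by
  intro i σ h
  have h1 := ((Q.okAll_iff _ _).1 (Q.okAll_Z 0 (max (i+1) σ.length))).1
  rw [okP_iff] at h1
  exact h1 i (by omega) σ h (le_max_right _ _)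

theorem Zs_approx : CompApprox Q.Zs Q.Z := by
  constructor
  · have h1 : Computable fun q : ℕ × ℕ => tri q.2 + q.2 :=
      comp_add (comp_tri.comp Computable.snd) Computable.snd
    have h2 : Computable fun q : ℕ × ℕ => Q.path q.1 (tri q.2 + q.2) :=
      comp_path Q Computable.fst h1
    have h3 : Computable fun q : ℕ × ℕ => Q.state (Q.path q.1 (tri q.2 + q.2)) q.1 :=
      comp_state Q h2 Computable.fst
    have h4 : Computable fun q : ℕ × ℕ => (Q.state (Q.path q.1 (tri q.2 + q.2)) q.1).2.1 :=
      Computable.fst.comp (Computable.snd.comp h3)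
    exact comp_eq h4 (Computable.const 1)
  · intro m
    obtain ⟨s0, h0⟩ := Q.state_lim (tri m + m)
    refine ⟨s0, fun s hs => ?_⟩
    unfold Zs Z
    rw [(h0 s hs).1, (h0 s hs).2]

theorem Zs_eq_of_path {s s' n : ℕ} (h : Q.path s (tri n) = Q.path s' (tri n)) :
    restr (Q.Zs s) n = restr (Q.Zs s') n := by
  rw [restr_eq_iff]
  intro m hm
  have h1 : tri m + m < tri n := by
    have := tri_mono (Nat.succ_le_of_lt hm)
    rw [Nat.succ_eq_add_one, tri_succ] at this
    omega
  have h2 := Q.lb_eq_of_path_eq h _ h1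
  unfold lb at h2
  have hb : ∀ s, isBit (Q.path s (tri m + m)).length := by
    intro s; rw [path_length]; exact isBit_tri m
  rw [labOf_bit _ (hb s), labOf_bit _ (hb s')] at h2
  simp only [Prod.mk.injEq] at h2
  unfold Zs
  rw [h2.2.2.1]

theorem Z_omegaCA : OmegaCA Q.Z := by
  refine ⟨fun n => Q.G (tri n), (comp_G Q).comp comp_tri, Q.Zs, Q.Zs_approx, fun n => ?_⟩
  have key : ∀ F : Finset ℕ, (F : Set ℕ) ⊆ changeStages Q.Zs n → F.card ≤ Q.G (tri n) := by
    intro F hF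
    have hinj : Set.InjOn (fun s => s - 1) (F : Set ℕ) := by
      intro a ha b hb hab
      have h1 := (hF ha).1
      have h2 := (hF hb).1
      simp only at hab
      omega
    rw [← Finset.card_image_of_injOn hinj]
    refine (Q.counting id monotone_id (tri n) (Finset.range (tri n)) _ 0 ?_ ?_).trans
      (Q.prod_le_G _ _ fun q hq => rho_lt_tri (Finset.mem_range.1 hq))
    · intro j hj
      refine ⟨Nat.zero_le _, fun hp => ?_⟩
      obtain ⟨s, hs, rfl⟩ := Finset.mem_image.1 hj
      obtain ⟨h1, h2⟩ := hF hs
      simp only [id] at hp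
      rw [show s - 1 + 1 = s by omega] at hp
      exact h2 (Q.Zs_eq_of_path hp.symm)
    · intro q hq hS
      exact absurd (Finset.mem_range.2 hq) hS
  have hfin : (changeStages Q.Zs n).Finite := by
    by_contra hinf
    obtain ⟨F, h1, h2⟩ := (Set.not_finite.1 hinf).exists_subset_card_eq (Q.G (tri n) + 1)
    have := key F h1
    omega
  refine ⟨hfin, ?_⟩
  rw [Set.ncard_eq_toFinset_card _ hfin]
  exact key _ (by simp)

end Par

end

section
/-! Part H: requirements along the true path. -/

theorem hasLab_false_iff (e : ℕ) (τ : List Lab) :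
    hasLab e τ = false ↔ ∀ l ∈ τ, 2 ≤ l.1 → l.2.1 ≠ e := by
  unfold hasLab
  rw [Bool.not_eq_false', allL_iff]
  refine forall_congr' fun l => forall_congr' fun _ => ?_
  simp
  omega

namespace Par
variable (Q : Par)

theorem certs_length_le {τ : List Lab} {s : ℕ} {st : St} (h : Q.Inv τ s st)
    (hb : ¬ isBit τ.length) : st.1.length ≤ (Q.N (Q.mm (rho τ.length)) s).length := by
  by_contra hlt
  push Not at hlt
  have := h.cert hb _ _ (List.getElem?_eq_getElem hlt)
  rw [List.getElem?_eq_none le_rfl] at this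
  exact absurd this (by simp)

/-- Eventually all requirement levels of index at most `e` are in phase zero. -/
theorem exists_ps (e : ℕ) : ∃ ps, ∀ q ≥ ps, ¬ isBit q → (blk q).2 ≤ e →
    (Q.fs (Q.tp q)).2.1 = 0 := by
  let S : Set ℕ := {q | ¬ isBit q ∧ (blk q).2 ≤ e ∧ (Q.fs (Q.tp q)).2.1 ≠ 0}
  have key : ∀ q ∈ S, ∀ q' ∈ S, q < q' → (blk q).2 = (blk q').2 → False := by
    rintro q ⟨h1, h2, h3⟩ q' ⟨h1', h2', h3'⟩ hlt heq
    obtain ⟨s1, hs1⟩ := Q.fs_inv (Q.tp q')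
    obtain ⟨s2, hs2⟩ := Q.fs_inv (Q.tp q)
    have hi := hs1 s1 le_rfl
    have hph := (hs2 s2 le_rfl).ph
    have h1t : ¬ isBit (Q.tp q).length := by rwa [tp_length]
    have hl : hasLab (blk q').2 (Q.tp q') = true := by
      by_contra hl
      rw [Bool.not_eq_true, hasLab_false_iff] at hl
      have h4 := hl _ ((Q.mem_tp _ _).2 ⟨q, hlt, rfl⟩)
      unfold lbt at h4
      rcases (by omega : (Q.fs (Q.tp q)).2.1 = 1 ∨ (Q.fs (Q.tp q)).2.1 = 2) with h5 | h5
      · rw [labOf_p1 h1t h5, tp_length] at h4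
        exact h4 (by simp) heq
      · rw [labOf_p2 h1t h5, tp_length] at h4
        exact h4 (by simp) heq
    have := hi.idle (by rwa [tp_length]) (by rwa [tp_length])
    apply h3'
    rw [this]
  have hfin : S.Finite := by
    have hinj : Set.InjOn (fun q => (blk q).2) S := by
      intro q hq q' hq' heq
      rcases lt_trichotomy q q' with h | h | h
      · exact (key q hq q' hq' h heq).elim
      · exact h
      · exact (key q' hq' q hq h heq.symm).elim
    refine Set.Finite.of_finite_image ((Set.finite_le_nat e).subset ?_) hinj
    rintro _ ⟨q, hq, rfl⟩
    exact hq.2.1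
  obtain ⟨B, hB⟩ := hfin.bddAbove
  refine ⟨B + 1, fun q hq h1 h2 => ?_⟩
  by_contra h3
  have := hB (show q ∈ S from ⟨h1, h2, h3⟩)
  omega

section
variable {A : ℕ → Bool} {e : ℕ}

theorem A_settle1
    (hA : ∀ x, A x = true ↔ ∃ s, Aof e s x = true)
    (x : ℕ) : ∃ s0, ∀ s ≥ s0, Aof e s x = A x := by
  cases hx : A x
  · refine ⟨0, fun s _ => ?_⟩
    by_contra h
    rw [Bool.not_eq_false] at h
    rw [(hA x).2 ⟨s, h⟩] at hx
    exact absurd hx (by simp)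
  · obtain ⟨s0, h0⟩ := (hA x).1 hx
    exact ⟨s0, fun s hs => Aof_mono hs h0⟩

theorem A_settle
    (hA : ∀ x, A x = true ↔ ∃ s, Aof e s x = true)
    (n : ℕ) : ∃ s0, ∀ s ≥ s0, restr (Aof e s) n = restr A n := by
  induction n with
  | zero => exact ⟨0, fun _ _ => rfl⟩
  | succ n ih =>
    obtain ⟨s0, h0⟩ := ih
    obtain ⟨s1, h1⟩ := A_settle1 hA n
    refine ⟨max s0 s1, fun s hs => ?_⟩
    have h2 := h0 s (by omega)
    rw [restr_eq_iff] at h2 ⊢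
    intro i hi
    rcases Nat.lt_succ_iff_lt_or_eq.1 hi with h | h
    · exact h2 i h
    · rw [h]; exact h1 s (by omega)

theorem A_settled
    (hA : ∀ x, A x = true ↔ ∃ s, Aof e s x = true)
    {n s T : ℕ} (h : s ≤ T) (hs : restr (Aof e s) n = restr A n) :
    restr (Aof e T) n = restr A n := by
  rw [restr_eq_iff] at hs ⊢
  intro i hi
  cases hx : A i
  · by_contra h
    rw [Bool.not_eq_false] at h
    rw [(hA i).2 ⟨T, h⟩] at hx
    exact absurd hx (by simp)
  · exact Aof_mono h ((hs i hi).trans hx)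

theorem phase_zero
    (hΦ : ∀ α, (∃ M, conv e (restr Q.Z M) α = true) ↔ α = restr A α.length)
    (hA : ∀ x, A x = true ↔ ∃ s, Aof e s x = true)
    (q : ℕ) (hb : ¬ isBit q) (he : (blk q).2 = e) :
    (Q.fs (Q.tp q)).2.1 = 0 := by
  have hbt : ¬ isBit (Q.tp q).length := by rwa [tp_length]
  obtain ⟨s1, hs1⟩ := Q.fs_inv (Q.tp q)
  have hi := hs1 s1 le_rfl
  have hph := hi.ph
  have hZ := fun M => ((Q.okAll_iff _ _).1 (Q.okAll_Z (q + 1) M)).2 _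
    ((Q.mem_tp _ _).2 ⟨q, Nat.lt_succ_self q, rfl⟩)
  unfold lbt at hZ
  by_contra h0
  rcases (by omega : (Q.fs (Q.tp q)).2.1 = 1 ∨ (Q.fs (Q.tp q)).2.1 = 2) with h5 | h5
  · rw [labOf_p1 hbt h5, tp_length, he] at hZ
    generalize (Q.fs (Q.tp q)).2.2.1 = n at hZ
    obtain ⟨s0, h1⟩ := A_settle hA n
    obtain ⟨M0, h2⟩ := (hΦ (restr A n)).2 (by rw [restr_length])
    have h3 := hZ (max M0 (max s0 n))
    rw [okL_two] at h3
    have h4 := h3 (max s0 n) (le_max_right _ _) (le_max_right _ _)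
    rw [h1 _ (le_max_left _ _), conv_mono (le_max_left _ _) h2] at h4
    exact absurd h4 (by simp)
  · have hd := hi.ph2 hbt h5
    rw [labOf_p2 hbt h5, tp_length, he] at hZ
    rw [tp_length, he] at hd
    generalize (Q.fs (Q.tp q)).2.2.1 = n at hZ hd
    generalize (Q.fs (Q.tp q)).2.2.2 = T at hZ hd
    have hne : restr (Aof e T) n ≠ restr A n := by
      intro heq
      obtain ⟨M, hM⟩ := (hΦ (restr (Aof e T) n)).2 (by rw [restr_length]; exact heq)
      have := hZ M
      rw [okL_three, hM] at this
      exact absurd this (by simp)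
    have hno : ¬ okL (2, e, n, 0) (restr Q.Z T) = true := by
      intro ho
      have : Q.alive ((2, e, n, 0) :: Q.tp q) T = true := by
        rw [alive_iff]
        exact ⟨Q.Z, (Q.okAll_cons _ _ _).2 ⟨ho, Q.okAll_Z q T⟩⟩
      rw [hd] at this
      exact absurd this (by simp)
    rw [okL_two] at hno
    push Not at hno
    obtain ⟨s, _, h2, h3⟩ := hno
    rw [ne_eq, Bool.not_eq_false] at h3
    have h4 := (hΦ _).1 ⟨_, h3⟩
    rw [restr_length] at h4
    exact hne (A_settled hA h2 h4)

theorem cert_correct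
    (hΦ : ∀ α, (∃ M, conv e (restr Q.Z M) α = true) ↔ α = restr A α.length)
    (_hA : ∀ x, A x = true ↔ ∃ s, Aof e s x = true)
    (q : ℕ) (hb : ¬ isBit q) (he : (blk q).2 = e) :
    ∀ r ∈ (Q.fs (Q.tp q)).1, restr (Aof e r.2) r.1 = restr A r.1 := by
  intro r hr
  obtain ⟨s1, hs1⟩ := Q.fs_inv (Q.tp q)
  obtain ⟨t, _, hd⟩ := (hs1 s1 le_rfl).dead (by rwa [tp_length]) r hr
  rw [tp_length, he] at hd
  have hno : ¬ okL (3, e, r.1, r.2) (restr Q.Z t) = true := by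
    intro ho
    have : Q.alive ((3, e, r.1, r.2) :: Q.tp q) t = true := by
      rw [alive_iff]
      exact ⟨Q.Z, (Q.okAll_cons _ _ _).2 ⟨ho, Q.okAll_Z q t⟩⟩
    rw [hd] at this
    exact absurd this (by simp)
  rw [okL_three, Bool.not_eq_false] at hno
  have h4 := (hΦ _).1 ⟨_, hno⟩
  rwa [restr_length] at h4

theorem no_lab
    (hΦ : ∀ α, (∃ M, conv e (restr Q.Z M) α = true) ↔ α = restr A α.length)
    (hA : ∀ x, A x = true ↔ ∃ s, Aof e s x = true)
    (p : ℕ) : hasLab e (Q.tp p) = false := by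
  rw [hasLab_false_iff]
  intro l hl h2 heq
  obtain ⟨q, _, rfl⟩ := (Q.mem_tp _ _).1 hl
  unfold lbt at h2 heq
  by_cases hb : isBit q
  · have hbt : isBit (Q.tp q).length := by rwa [tp_length]
    rw [labOf_bit _ hbt] at h2
    exact absurd h2 (by simp)
  · have hbt : ¬ isBit (Q.tp q).length := by rwa [tp_length]
    obtain ⟨s1, hs1⟩ := Q.fs_inv (Q.tp q)
    have hph := (hs1 s1 le_rfl).ph
    rcases (by omega : (Q.fs (Q.tp q)).2.1 = 0 ∨ (Q.fs (Q.tp q)).2.1 = 1 ∨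
      (Q.fs (Q.tp q)).2.1 = 2) with h5 | h5 | h5
    · rw [labOf_zero hbt h5] at h2
      exact absurd h2 (by simp)
    · rw [labOf_p1 hbt h5, tp_length] at heq
      have := Q.phase_zero hΦ hA q hb heq
      omega
    · rw [labOf_p2 hbt h5, tp_length] at heq
      have := Q.phase_zero hΦ hA q hb heq
      omega

theorem all_certs
    (hΦ : ∀ α, (∃ M, conv e (restr Q.Z M) α = true) ↔ α = restr A α.length)
    (hA : ∀ x, A x = true ↔ ∃ s, Aof e s x = true)
    (q : ℕ) (hb : ¬ isBit q) (he : (blk q).2 = e) :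
    ∃ s0, ∀ s ≥ s0, (Q.fs (Q.tp q)).1.length = (Q.N (Q.mm (rho q)) s).length := by
  obtain ⟨s0, h0⟩ := Q.fs_fix (Q.tp q)
  obtain ⟨s1, h1⟩ := Q.fs_inv (Q.tp q)
  have hp0 := Q.phase_zero hΦ hA q hb he
  have hl := Q.no_lab hΦ hA q
  have hbt : ¬ isBit (Q.tp q).length := by rwa [tp_length]
  refine ⟨max s0 s1, fun s hs => ?_⟩
  have hfix := h0 s (by omega)
  have hle := Q.certs_length_le (h1 s (by omega)) hbt
  rw [tp_length] at hle
  rcases Q.step_cases (Q.tp q) s (Q.fs (Q.tp q)) with ⟨h1, _⟩ | ⟨h1, h2, h4⟩ |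
      ⟨h1, h2, h3, ⟨h5, h4⟩ | ⟨n, h5, h4⟩⟩ | ⟨h1, h2, h3, _⟩ | ⟨h1, h2, h3, _⟩ |
      ⟨h1, h2, h3, _⟩
  · exact absurd h1 hbt
  · rw [tp_length, he, hl] at h2
    exact absurd h2 (by simp)
  · rw [tp_length, List.getElem?_eq_none_iff] at h5
    omega
  · rw [h4] at hfix
    rw [← hfix] at hp0
    exact absurd hp0 (by simp)
  · exact absurd hp0 h3
  · omega
  · exact absurd hp0 h3

end

/-- Level condition. -/
def goodL (e ps q s : ℕ) : Bool :=
  decide (q < ps) || (decide ((blk q).2 = (blk q).1) || (decide (e < (blk q).2) ||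
    (decide ((Q.state (Q.path s q) s).2.1 = 0) && (!(decide ((blk q).2 = e)) ||
      (decide ((Q.state (Q.path s q) s).1.length = (Q.N (Q.mm (rho q)) s).length) &&
        allL (fun r : ℕ × ℕ => decide (restr (Aof e r.2) r.1 = restr (Aof e s) r.1))
          (Q.state (Q.path s q) s).1)))))

theorem goodL_iff (e ps q s : ℕ) : Q.goodL e ps q s = true ↔
    (ps ≤ q → ¬ isBit q → (blk q).2 ≤ e → (Q.state (Q.path s q) s).2.1 = 0 ∧
      ((blk q).2 = e →
        (Q.state (Q.path s q) s).1.length = (Q.N (Q.mm (rho q)) s).length ∧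
        ∀ r ∈ (Q.state (Q.path s q) s).1, restr (Aof e r.2) r.1 = restr (Aof e s) r.1)) := by
  unfold goodL isBit
  simp only [Bool.or_eq_true, Bool.and_eq_true, allL_iff, decide_eq_true_eq, Bool.not_eq_true',
    decide_eq_false_iff_not, ← not_le]
  tauto

/-- Stage condition. -/
def good (e ps : ℕ) (σs : List Lab) (j s : ℕ) : Bool :=
  decide (Q.path s ps = σs) && (!(decide (((1 : ℚ) / 2) ^ j ≤ Q.c s (j + 1))) &&
    allLT (fun q => Q.goodL e ps q s) (tri j + e + 1))

theorem good_iff (e ps : ℕ) (σs : List Lab) (j s : ℕ) : Q.good e ps σs j s = true ↔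
    Q.path s ps = σs ∧ Q.c s (j + 1) < ((1 : ℚ) / 2) ^ j ∧
      ∀ q < tri j + e + 1, Q.goodL e ps q s = true := by
  unfold good
  simp only [Bool.and_eq_true, decide_eq_true_eq, Bool.not_eq_true', decide_eq_false_iff_not,
    allLT_iff, not_le]

theorem comp_goodL (e ps : ℕ) : Computable fun q : ℕ × ℕ => Q.goodL e ps q.1 q.2 := by
  have f1 : Computable fun q : ℕ × ℕ => q.1 := Computable.fst
  have f2 : Computable fun q : ℕ × ℕ => q.2 := Computable.snd
  have b1 : Computable fun q : ℕ × ℕ => (blk q.1).1 := comp_blk1.comp f1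
  have b2 : Computable fun q : ℕ × ℕ => (blk q.1).2 := comp_blk2.comp f1
  have hst : Computable fun q : ℕ × ℕ => Q.state (Q.path q.2 q.1) q.2 :=
    comp_state Q (comp_path Q f2 f1) f2
  have hst1 : Computable fun q : ℕ × ℕ => (Q.state (Q.path q.2 q.1) q.2).1 :=
    Computable.fst.comp hst
  have hst2 : Computable fun q : ℕ × ℕ => (Q.state (Q.path q.2 q.1) q.2).2.1 :=
    Computable.fst.comp (Computable.snd.comp hst)
  have hl : Computable fun q : ℕ × ℕ => (Q.state (Q.path q.2 q.1) q.2).1.length :=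
    Computable.list_length.comp hst1
  have hm : Computable fun q : ℕ × ℕ => Q.mm (rho q.1) := (comp_mm Q).comp (comp_rho.comp f1)
  have hN : Computable fun q : ℕ × ℕ => Q.N (Q.mm (rho q.1)) q.2 := Q.hN.comp hm f2
  have hNl : Computable fun q : ℕ × ℕ => (Q.N (Q.mm (rho q.1)) q.2).length :=
    Computable.list_length.comp hN
  have r1 : Computable fun q : (ℕ × ℕ) × (ℕ × ℕ) => q.2.1 := Computable.fst.comp Computable.snd
  have r2 : Computable fun q : (ℕ × ℕ) × (ℕ × ℕ) => q.2.2 := Computable.snd.comp Computable.snd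
  have r3 : Computable fun q : (ℕ × ℕ) × (ℕ × ℕ) => q.1.2 := Computable.snd.comp Computable.fst
  have re : Computable fun _ : (ℕ × ℕ) × (ℕ × ℕ) => e := Computable.const e
  have hr : Computable fun q : (ℕ × ℕ) × (ℕ × ℕ) =>
      decide (restr (Aof e q.2.2) q.2.1 = restr (Aof e q.1.2) q.2.1) :=
    comp_eq (comp_restrA re r2 r1) (comp_restrA re r3 r1)
  have hall : Computable fun q : ℕ × ℕ =>
      allL (fun r : ℕ × ℕ => decide (restr (Aof e r.2) r.1 = restr (Aof e q.2) r.1))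
          (Q.state (Q.path q.2 q.1) q.2).1 := comp_allL hst1 hr
  exact comp_or (comp_lt f1 (Computable.const ps)) (comp_or (comp_eq b2 b1)
    (comp_or (comp_lt (Computable.const e) b2) (comp_and (comp_eq hst2 (Computable.const 0))
      (comp_or (comp_not (comp_eq b2 (Computable.const e))) (comp_and (comp_eq hl hNl) hall)))))

theorem comp_good (e ps : ℕ) (σs : List Lab) : Computable₂ (Q.good e ps σs) := by
  have f1 : Computable fun q : ℕ × ℕ => q.1 := Computable.fst
  have f2 : Computable fun q : ℕ × ℕ => q.2 := Computable.snd
  have hp : Computable fun q : ℕ × ℕ => Q.path q.2 ps := comp_path Q f2 (Computable.const ps)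
  have hc : Computable fun q : ℕ × ℕ => Q.c q.2 (q.1 + 1) :=
    Q.hc.1.comp f2 (comp_add f1 (Computable.const 1))
  have ht : Computable fun q : ℕ × ℕ => tri q.1 + e + 1 :=
    comp_add (comp_add (comp_tri.comp f1) (Computable.const e)) (Computable.const 1)
  have hg : Computable fun q : (ℕ × ℕ) × ℕ => Q.goodL e ps q.2 q.1.2 :=
    (Q.comp_goodL e ps).comp (g := fun q : (ℕ × ℕ) × ℕ => (q.2, q.1.2))
      (Computable.pair Computable.snd (Computable.snd.comp Computable.fst))
  have ha : Computable fun q : ℕ × ℕ =>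
      allLT (fun i => Q.goodL e ps i q.2) (tri q.1 + e + 1) := comp_allLT ht hg
  exact comp_and (comp_eq hp (Computable.const σs)) (comp_and (comp_not (comp_pow_le f1 hc)) ha)

end Par

end

section
/-! Part I: obedience. -/

theorem exists_u (g : ℕ → ℕ → Bool) (hg : Computable₂ g)
    (hlim : ∀ j, ∃ s0, ∀ s ≥ s0, g j s = true) :
    ∃ u : ℕ → ℕ, Computable u ∧ StrictMono u ∧ (∀ j, j + 1 ≤ u j) ∧ ∀ j, g j (u j) = true := by
  have hex : ∀ r : ℕ × ℕ, ∃ s, (decide (r.2 < s) && g r.1 s) = true := by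
    intro r
    obtain ⟨s0, h0⟩ := hlim r.1
    refine ⟨max s0 (r.2 + 1), ?_⟩
    rw [h0 _ (le_max_left _ _)]
    simp
  obtain ⟨nxt, hs1, hs2⟩ : ∃ nxt : ℕ × ℕ → ℕ,
      (∀ r, (decide (r.2 < nxt r) && g r.1 (nxt r)) = true) ∧
      ∀ r, ∀ m < nxt r, (decide (r.2 < m) && g r.1 m) = false :=
    ⟨fun r => Nat.find (hex r), fun r => Nat.find_spec (hex r), fun r m hm => by
      have := Nat.find_min (hex r) hm
      rwa [Bool.not_eq_true] at this⟩
  have hn : Computable nxt := by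
    have f1 : Computable fun q : (ℕ × ℕ) × ℕ => q.1.1 := Computable.fst.comp Computable.fst
    have f2 : Computable fun q : (ℕ × ℕ) × ℕ => q.1.2 := Computable.snd.comp Computable.fst
    have f3 : Computable fun q : (ℕ × ℕ) × ℕ => q.2 := Computable.snd
    have f4 : Computable fun q : (ℕ × ℕ) × ℕ => g q.1.1 q.2 := hg.comp f1 f3
    have f5 : Computable fun q : (ℕ × ℕ) × ℕ => (decide (q.1.2 < q.2) && g q.1.1 q.2) :=
      comp_and (comp_lt f2 f3) f4
    have f6 : Computable₂ fun (r : ℕ × ℕ) (m : ℕ) => (decide (r.2 < m) && g r.1 m) := f5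
    exact comp_find f6 nxt hs1 hs2
  have hspec : ∀ j a, a < nxt (j, a) ∧ g j (nxt (j, a)) = true := by
    intro j a
    have := hs1 (j, a)
    rw [Bool.and_eq_true, decide_eq_true_eq] at this
    exact this
  let u : ℕ → ℕ := fun j => Nat.rec (nxt (0, 0)) (fun j a => nxt (j + 1, a)) j
  have hus : ∀ j, u (j + 1) = nxt (j + 1, u j) := fun j => rfl
  have hmono : StrictMono u := strictMono_nat_of_lt_succ fun j => by
    rw [hus]; exact (hspec _ _).1
  refine ⟨u, ?_, hmono, ?_, ?_⟩
  · have h1 : Computable fun q : ℕ × ℕ × ℕ => (q.2.1 + 1, q.2.2) :=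
      Computable.pair (comp_add (Computable.fst.comp Computable.snd) (Computable.const 1))
        (Computable.snd.comp Computable.snd)
    have h2 : Computable fun q : ℕ × ℕ × ℕ => nxt (q.2.1 + 1, q.2.2) := hn.comp h1
    exact Computable.nat_rec (h := fun _ (q : ℕ × ℕ) => nxt (q.1 + 1, q.2)) Computable.id
      (Computable.const (nxt (0, 0))) h2
  · intro j
    induction j with
    | zero => exact (hspec 0 0).1
    | succ j ih =>
      have := hmono (Nat.lt_succ_self j)
      rw [Nat.succ_eq_add_one] at this
      omega
  · intro j
    cases j with
    | zero => exact (hspec 0 0).2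
    | succ j => rw [hus]; exact (hspec _ _).2

namespace Par
variable (Q : Par)

theorem good_lim {A : ℕ → Bool} {e : ℕ}
    (hΦ : ∀ α, (∃ M, conv e (restr Q.Z M) α = true) ↔ α = restr A α.length)
    (hA : ∀ x, A x = true ↔ ∃ s, Aof e s x = true) (ps : ℕ)
    (hps : ∀ q ≥ ps, ¬ isBit q → (blk q).2 ≤ e → (Q.fs (Q.tp q)).2.1 = 0) (j : ℕ) :
    ∃ s0, ∀ s ≥ s0, Q.good e ps (Q.tp ps) j s = true := by
  have hlev : ∀ q, ∃ s0, ∀ s ≥ s0, Q.goodL e ps q s = true := by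
    intro q
    obtain ⟨s0, h0⟩ := Q.state_lim q
    by_cases hq : ¬ isBit q ∧ (blk q).2 = e
    · obtain ⟨s1, h1⟩ := Q.all_certs hΦ hA q hq.1 hq.2
      have hc := Q.cert_correct hΦ hA q hq.1 hq.2
      have hset : ∃ s2, ∀ s ≥ s2, ∀ r ∈ (Q.fs (Q.tp q)).1,
          restr (Aof e r.2) r.1 = restr (Aof e s) r.1 := by
        generalize (Q.fs (Q.tp q)).1 = l at hc
        clear h1
        induction l with
        | nil => exact ⟨0, by simp⟩
        | cons a l ih =>
          obtain ⟨s2, h2⟩ := ih fun r hr => hc r (List.mem_cons_of_mem _ hr)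
          obtain ⟨s3, h3⟩ := A_settle hA a.1
          refine ⟨max s2 s3, fun s hs r hr => ?_⟩
          rcases List.mem_cons.1 hr with rfl | hr
          · rw [h3 s (by omega)]
            exact hc r List.mem_cons_self
          · exact h2 s (by omega) r hr
      obtain ⟨s2, h2⟩ := hset
      refine ⟨max s0 (max s1 s2), fun s hs => ?_⟩
      rw [goodL_iff, (h0 s (by omega)).1, (h0 s (by omega)).2]
      intro h3 h4 h5
      exact ⟨hps q h3 h4 h5, fun _ => ⟨h1 s (by omega), h2 s (by omega)⟩⟩
    · refine ⟨s0, fun s hs => ?_⟩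
      rw [goodL_iff, (h0 s hs).1, (h0 s hs).2]
      intro h3 h4 h5
      exact ⟨hps q h3 h4 h5, fun h6 => absurd ⟨h4, h6⟩ hq⟩
  have hall : ∀ n, ∃ s0, ∀ s ≥ s0, ∀ q < n, Q.goodL e ps q s = true := by
    intro n
    induction n with
    | zero => exact ⟨0, fun s _ q hq => absurd hq (by omega)⟩
    | succ n ih =>
      obtain ⟨s0, h0⟩ := ih
      obtain ⟨s1, h1⟩ := hlev n
      refine ⟨max s0 s1, fun s hs q hq => ?_⟩
      rcases Nat.lt_succ_iff_lt_or_eq.1 hq with h | h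
      · exact h0 s (by omega) q h
      · rw [h]; exact h1 s (by omega)
  obtain ⟨s0, h0⟩ := hall (tri j + e + 1)
  obtain ⟨s1, h1⟩ := Q.path_lim ps
  obtain ⟨s2, h2⟩ := Q.lim j
  refine ⟨max s0 (max s1 s2), fun s hs => ?_⟩
  rw [good_iff]
  exact ⟨h1 s (by omega), h2 s (by omega) _, h0 s (by omega)⟩

section
variable {e ps : ℕ} {σs : List Lab} {u : ℕ → ℕ}

theorem charge (hu : StrictMono u)
    (hgood : ∀ j, Q.good e ps σs j (u j) = true)
    {j k x : ℕ} (hk : k ≤ j) (hek : e < k) (hp : ps ≤ tri k + e) (hx : x < u j)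
    (hc : ((1 : ℚ) / 2) ^ (Q.mm (rho (tri k + e))) ≤ Q.c x (u j))
    (hch : Aof e (u (j + 1)) x ≠ Aof e (u j) x) :
    Q.path (u j) (tri k + e) ≠ Q.path (u (j + 1)) (tri k + e) := by
  intro hpath
  have hblk : blk (tri k + e) = (k, e) := blk_tri hek.le
  have hnb : ¬ isBit (tri k + e) := by
    unfold isBit; rw [hblk]; simp only; omega
  have htri := tri_mono hk
  have htri' := tri_mono (Nat.le_succ_of_le hk)
  obtain ⟨n, hn, hxn⟩ := Q.N_spec _ x (u j) hx hc
  have g1 := ((Q.good_iff _ _ _ _ _).1 (hgood j)).2.2 (tri k + e) (by omega)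
  have g2 := ((Q.good_iff _ _ _ _ _).1 (hgood (j + 1))).2.2 (tri k + e) (by
    rw [Nat.succ_eq_add_one] at htri'; omega)
  rw [goodL_iff] at g1 g2
  have g1 := (g1 hp hnb (by rw [hblk])).2 (by rw [hblk])
  have g2 := (g2 hp hnb (by rw [hblk])).2 (by rw [hblk])
  obtain ⟨i, hi, hin⟩ := List.getElem_of_mem hn
  have hi' : i < (Q.state (Q.path (u j) (tri k + e)) (u j)).1.length := by rw [g1.1]; exact hi
  obtain ⟨r, hr⟩ : ∃ r, (Q.state (Q.path (u j) (tri k + e)) (u j)).1[i]? = some r :=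
    ⟨_, List.getElem?_eq_getElem hi'⟩
  have hcert := (Q.inv_state (Q.path (u j) (tri k + e)) (u j)).cert (by rwa [path_length]) i r hr
  rw [path_length, List.getElem?_eq_getElem hi, hin, Option.some.injEq] at hcert
  have hmem := List.mem_of_getElem? hr
  have hmem' := (Q.certs_mono (τ := Q.path (u j) (tri k + e))
    (hu (Nat.lt_succ_self j)).le).subset hmem
  rw [Nat.succ_eq_add_one] at hmem'
  rw [← hpath] at g2
  have e1 := g1.2 r hmem
  have e2 := g2.2 r hmem'
  rw [e1, ← hcert, restr_eq_iff] at e2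
  exact hch (e2 x hxn).symm

theorem lb_const (_hu : StrictMono u)
    (hgood : ∀ j, Q.good e ps σs j (u j) = true)
    {j j1 q : ℕ} (hj : j1 ≤ j) (hq : ps ≤ q) (hqj : q < tri j1 + e + 1)
    (hb : ¬ isBit q) (he : (blk q).2 ≤ e) : Q.lb (u j) q = (0, 0, 0, 0) := by
  have htri := tri_mono hj
  have g1 := ((Q.good_iff _ _ _ _ _).1 (hgood j)).2.2 q (by omega)
  rw [goodL_iff] at g1
  exact labOf_zero (by rwa [path_length]) (g1 hq hb he).1

theorem lb_const' (_hu : StrictMono u)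
    (hgood : ∀ j, Q.good e ps σs j (u j) = true)
    {j j' q : ℕ} (hq : q < ps) : Q.lb (u j) q = Q.lb (u j') q := by
  have h1 := ((Q.good_iff _ _ _ _ _).1 (hgood j)).1
  have h2 := ((Q.good_iff _ _ _ _ _).1 (hgood j')).1
  exact Q.lb_eq_of_path_eq (h1.trans h2.symm) q hq

theorem count_k (hu : StrictMono u)
    (hgood : ∀ j, Q.good e ps σs j (u j) = true)
    {k : ℕ} (hek : e < k) (I : Finset ℕ)
    (hI : ∀ j ∈ I, k + 1 ≤ j ∧
      Q.path (u j) (tri (k + 1) + e) ≠ Q.path (u (j + 1)) (tri (k + 1) + e)) :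
    I.card ≤ Q.G (rho (tri k + e)) := by
  refine (Q.counting u hu.monotone (tri (k + 1) + e)
    ((Finset.range (tri (k + 1) + e)).filter fun q => rho q < rho (tri k + e)) I (k + 1) hI
    ?_).trans (Q.prod_le_G _ _ fun q hq => (Finset.mem_filter.1 hq).2)
  intro q hq hS j hj j' hj'
  rcases Nat.lt_or_ge q ps with hps | hps
  · exact Q.lb_const' hu hgood hps
  · have hr : rho (tri k + e) ≤ rho q := by
      by_contra hr
      exact hS (Finset.mem_filter.2 ⟨Finset.mem_range.2 hq, not_le.1 hr⟩)
    rw [rho_tri hek.le, rho_eq] at hr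
    obtain ⟨h1, h2⟩ := blk_spec q
    have hkk : (blk q).2 < (blk q).1 ∧ (blk q).2 ≤ e := by
      generalize (blk q).1 = a at *
      generalize (blk q).2 = b at *
      have ht : tri (k + 1) = tri k + k + 1 := tri_succ k
      rcases lt_trichotomy a k with h | h | h
      · have := tri_mono (Nat.succ_le_of_lt h)
        rw [Nat.succ_eq_add_one, tri_succ] at this
        omega
      · subst h; omega
      · rcases Nat.lt_or_ge (k + 1) a with h' | h'
        · have := tri_mono (Nat.succ_le_of_lt h')
          rw [Nat.succ_eq_add_one, tri_succ] at this
          omega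
        · have : a = k + 1 := by omega
          subst this; omega
    have hb : ¬ isBit q := by unfold isBit; omega
    rw [Q.lb_const hu hgood hj hps (by omega) hb hkk.2,
      Q.lb_const hu hgood hj' hps (by omega) hb hkk.2]

theorem count_0 (hu : StrictMono u)
    (_hgood : ∀ j, Q.good e ps σs j (u j) = true)
    (p : ℕ) (I : Finset ℕ)
    (hI : ∀ j ∈ I, Q.path (u j) p ≠ Q.path (u (j + 1)) p) :
    I.card ≤ ∏ q ∈ Finset.range p, Q.W (rho q) :=
  Q.counting u hu.monotone p (Finset.range p) I 0 (fun j hj => ⟨Nat.zero_le _, hI j hj⟩)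
    fun _ hq hS => absurd (Finset.mem_range.2 hq) hS

end

end Par

end

section
/-! Part J: the total cost. -/

theorem geom_half_le (J : ℕ) : ∑ j ∈ Finset.range J, ((1 : ℚ) / 2) ^ j ≤ 2 := by
  have h : ∑ j ∈ Finset.range J, ((1 : ℚ) / 2) ^ j = 2 - 2 * ((1 : ℚ) / 2) ^ J := by
    induction J with
    | zero => simp
    | succ J ih => rw [Finset.sum_range_succ, ih, pow_succ]; ring
  rw [h]
  have : (0 : ℚ) ≤ ((1 : ℚ) / 2) ^ J := by positivity
  linarith

open Classical in
theorem sum_bound (C : ℕ → ℚ) (hC : ∀ j, 0 ≤ C j) (D : ℕ → ℕ → Prop) (w : ℕ → ℚ)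
    (hw : ∀ k, 0 ≤ w k) (k0 : ℕ)
    (hb : ∀ j ≥ k0, ¬ D k0 j → C j ≤ ((1 : ℚ) / 2) ^ j ∨
      ∃ k, k0 ≤ k ∧ k + 1 ≤ j ∧ D (k + 1) j ∧ C j ≤ w k)
    (hfin : {j | D k0 j}.Finite)
    (hcnt : ∀ k ≥ k0, ∀ I : Finset ℕ, (∀ j ∈ I, k + 1 ≤ j ∧ D (k + 1) j) →
      (I.card : ℚ) * w k ≤ ((1 : ℚ) / 2) ^ k) :
    ∃ B : ℚ, ∀ J, ∑ j ∈ Finset.range J, C j ≤ B := by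
  let Bad : Finset ℕ := hfin.toFinset ∪ Finset.range k0
  refine ⟨∑ j ∈ Bad, C j + 2 + 2, fun J => ?_⟩
  let E : ℕ → ℚ := fun j => if j ∈ Bad then C j else 0
  let T : ℕ → ℕ → ℚ := fun k j => if k0 ≤ k ∧ k + 1 ≤ j ∧ D (k + 1) j then w k else 0
  have hT : ∀ k j, 0 ≤ T k j := fun k j => by
    simp only [T]; split_ifs
    · exact hw k
    · exact le_rfl
  have hE : ∀ j, 0 ≤ E j := fun j => by
    simp only [E]; split_ifs
    · exact hC j
    · exact le_rfl
  have h1 : ∀ j ∈ Finset.range J,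
      C j ≤ E j + ((1 : ℚ) / 2) ^ j + ∑ k ∈ Finset.range J, T k j := by
    intro j hj
    rw [Finset.mem_range] at hj
    have hs : 0 ≤ ∑ k ∈ Finset.range J, T k j := Finset.sum_nonneg fun k _ => hT k j
    have hp : (0 : ℚ) ≤ ((1 : ℚ) / 2) ^ j := by positivity
    by_cases hB : j ∈ Bad
    · have : E j = C j := if_pos hB
      linarith
    · have h2 := hE j
      have hB' : k0 ≤ j ∧ ¬ D k0 j := by
        simp only [Bad, Finset.mem_union, Set.Finite.mem_toFinset, Set.mem_ofPred_eq,
          Finset.mem_range, not_or, not_lt] at hB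
        exact ⟨hB.2, hB.1⟩
      rcases hb j hB'.1 hB'.2 with h | ⟨k, h3, h4, h5, h6⟩
      · linarith
      · have h7 : T k j ≤ ∑ k ∈ Finset.range J, T k j :=
          Finset.single_le_sum (f := fun k => T k j) (fun k _ => hT k j)
            (Finset.mem_range.2 (by omega))
        have h8 : T k j = w k := if_pos ⟨h3, h4, h5⟩
        linarith
  refine (Finset.sum_le_sum h1).trans ?_
  rw [Finset.sum_add_distrib, Finset.sum_add_distrib, Finset.sum_comm]
  have a1 : ∑ j ∈ Finset.range J, E j ≤ ∑ j ∈ Bad, C j := by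
    simp only [E]
    rw [← Finset.sum_filter]
    refine Finset.sum_le_sum_of_subset_of_nonneg ?_ fun j _ _ => hC j
    intro j hj
    exact (Finset.mem_filter.1 hj).2
  have a2 := geom_half_le J
  have a3 : ∑ k ∈ Finset.range J, ∑ j ∈ Finset.range J, T k j ≤ 2 := by
    refine (Finset.sum_le_sum fun k _ => ?_).trans a2
    by_cases hk : k0 ≤ k
    · refine le_trans (le_of_eq ?_) (hcnt k hk
        ((Finset.range J).filter fun j => k + 1 ≤ j ∧ D (k + 1) j)
        fun j hj => (Finset.mem_filter.1 hj).2)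
      simp only [T, hk, true_and]
      rw [← Finset.sum_filter, Finset.sum_const, nsmul_eq_mul]
    · have : ∀ j ∈ Finset.range J, T k j = 0 := fun j _ => if_neg fun h => hk h.1
      rw [Finset.sum_eq_zero this]
      positivity
  linarith

theorem stageCost_nonneg {c : ℕ → ℕ → ℚ} (hc : CostFunction c) (As : ℕ → ℕ → Bool) (s : ℕ) :
    0 ≤ stageCost c As s := by
  unfold stageCost
  split_ifs
  · exact le_rfl
  · exact hc.2.1 _ _
  · exact le_rfl

theorem stageCost_succ {c : ℕ → ℕ → ℚ} (As : ℕ → ℕ → Bool) (j : ℕ) :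
    stageCost c As (j + 1) = 0 ∨
      ∃ x, As (j + 1) x ≠ As j x ∧ stageCost c As (j + 1) = c x (j + 1) := by
  unfold stageCost
  rw [if_neg (Nat.succ_ne_zero j)]
  split_ifs with h
  · exact Or.inr ⟨_, Nat.find_spec h, rfl⟩
  · exact Or.inl rfl

theorem half_pow_mul (g t : ℕ) : (g : ℚ) * ((1 : ℚ) / 2) ^ (g + t) ≤ ((1 : ℚ) / 2) ^ t := by
  have h1 : (g : ℚ) ≤ 2 ^ g := by exact_mod_cast (Nat.lt_two_pow_self (n := g)).le
  have h2 : (2 : ℚ) ^ g * ((1 : ℚ) / 2) ^ g = 1 := by rw [← mul_pow]; norm_num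
  have h3 : (0 : ℚ) ≤ ((1 : ℚ) / 2) ^ g := by positivity
  have h4 : (0 : ℚ) ≤ ((1 : ℚ) / 2) ^ t := by positivity
  have h5 : (g : ℚ) * ((1 : ℚ) / 2) ^ g ≤ 1 := by
    exact (mul_le_mul_of_nonneg_right h1 h3).trans h2.le
  rw [pow_add, ← mul_assoc]
  calc _ ≤ 1 * ((1 : ℚ) / 2) ^ t := mul_le_mul_of_nonneg_right h5 h4
    _ = _ := one_mul _

theorem half_pow_anti {a b : ℕ} (h : a ≤ b) : ((1 : ℚ) / 2) ^ b ≤ ((1 : ℚ) / 2) ^ a :=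
  pow_le_pow_of_le_one (by norm_num) (by norm_num) h

theorem exists_last (P : ℕ → Prop) (k0 j : ℕ) (h : k0 ≤ j) (h0 : P k0) :
    ∃ k, k0 ≤ k ∧ k ≤ j ∧ P k ∧ (k = j ∨ (k + 1 ≤ j ∧ ¬ P (k + 1))) := by
  induction h with
  | refl => exact ⟨k0, le_rfl, le_rfl, h0, Or.inl rfl⟩
  | @step j hj ih =>
    obtain ⟨k, h1, h2, h3, h4⟩ := ih
    rcases h4 with rfl | h4
    · by_cases h5 : P (k + 1)
      · exact ⟨k + 1, by omega, le_rfl, h5, Or.inl rfl⟩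
      · exact ⟨k, h1, by omega, h3, Or.inr ⟨le_rfl, h5⟩⟩
    · exact ⟨k, h1, by omega, h3, Or.inr ⟨by omega, h4.2⟩⟩

namespace Par
variable (Q : Par)

theorem obeys {A : ℕ → Bool} (hCE : CE A) (hT : TuringLE A Q.Z) : Obeys A Q.c := by
  obtain ⟨e, hΦ, hA⟩ := exists_index hCE hT
  obtain ⟨ps, hps⟩ := Q.exists_ps e
  obtain ⟨u, huc, hu, huj, hgood⟩ := exists_u _ (Q.comp_good e ps (Q.tp ps))
    (Q.good_lim hΦ hA ps hps)
  have hcomp : CompApprox (fun j x => Aof e (u j) x) A := by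
    constructor
    · have h1 : Computable fun q : ℕ × ℕ => u q.1 := huc.comp Computable.fst
      have h2 : Computable fun q : ℕ × ℕ => Aof e (u q.1) q.2 :=
        comp_Aof (Computable.const e) h1 Computable.snd
      exact h2
    · intro x
      obtain ⟨s0, h0⟩ := A_settle1 hA x
      exact ⟨s0, fun s hs => h0 (u s) (by have := huj s; omega)⟩
  refine ⟨_, hcomp, ?_⟩
  generalize hAs : (fun j x => Aof e (u j) x) = As
  have hAs' : ∀ j x, As j x = Aof e (u j) x := fun j x => by rw [← hAs]
  have hnn := stageCost_nonneg Q.hc As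
  obtain ⟨-, -, hcs, hcx⟩ := Q.hc
  have key : ∃ B : ℚ, ∀ J, ∑ j ∈ Finset.range J, stageCost Q.c As (j + 1) ≤ B := by
    refine sum_bound (fun j => stageCost Q.c As (j + 1)) (fun j => hnn _)
      (fun k j => Q.path (u j) (tri k + e) ≠ Q.path (u (j + 1)) (tri k + e))
      (fun k => ((1 : ℚ) / 2) ^ (Q.mm (rho (tri k + e)))) (fun k => by positivity)
      (e + 1 + ps) ?_ ?_ ?_
    · intro j hj hD
      have hpj : (0 : ℚ) ≤ ((1 : ℚ) / 2) ^ j := by positivity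
      rcases stageCost_succ (c := Q.c) As j with h | ⟨x, hx, h⟩
      · left; rw [h]; exact hpj
      simp only [h]
      rw [hAs', hAs'] at hx
      rcases Nat.lt_or_ge x (u j) with hxu | hxu
      · obtain ⟨k, h1, h2, h3, h4⟩ := exists_last
          (fun k => Q.path (u j) (tri k + e) = Q.path (u (j + 1)) (tri k + e)) _ j hj
          (not_not.1 hD)
        have hlt : Q.c x (j + 1) ≤ ((1 : ℚ) / 2) ^ (Q.mm (rho (tri k + e))) := by
          refine (hcs x _ _ (huj j)).trans ?_
          by_contra hc
          have := le_tri k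
          exact Q.charge hu hgood h2 (by omega) (by omega) hxu (not_le.1 hc).le hx h3
        rcases h4 with rfl | h4
        · left
          refine hlt.trans (half_pow_anti ?_)
          have h5 := le_tri k
          have h6 := rho_tri (k := k) (e := e) (by omega)
          unfold mm
          omega
        · exact Or.inr ⟨k, h1, h4.1, h4.2, hlt⟩
      · left
        have h5 := ((Q.good_iff _ _ _ _ _).1 (hgood j)).2.1
        exact (hcx _ _ _ hxu).trans h5.le
    · by_contra hinf
      obtain ⟨F, h1, h2⟩ := (Set.not_finite.1 hinf).exists_subset_card_eq
        (∏ q ∈ Finset.range (tri (e + 1 + ps) + e), Q.W (rho q) + 1)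
      have := Q.count_0 hu hgood _ F fun j hj => h1 hj
      omega
    · intro k hk I hI
      have h1 := Q.count_k hu hgood (by omega) I hI
      have h2 : (I.card : ℚ) ≤ Q.G (rho (tri k + e)) := by exact_mod_cast h1
      refine (mul_le_mul_of_nonneg_right h2 (by positivity)).trans ?_
      refine (half_pow_mul _ _).trans (half_pow_anti ?_)
      have h5 := le_tri k
      have h6 := rho_tri (k := k) (e := e) (by omega)
      omega

  obtain ⟨B, hB⟩ := key
  refine ⟨B, fun F => ?_⟩
  obtain ⟨J, hJ⟩ : ∃ J, F ⊆ Finset.range (J + 1) :=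
    ⟨F.sup id, fun i hi => Finset.mem_range.2 (Nat.lt_succ_of_le (Finset.le_sup (f := id) hi))⟩
  refine (Finset.sum_le_sum_of_subset_of_nonneg hJ fun i _ _ => hnn i).trans ?_
  rw [Finset.sum_range_succ']
  have : stageCost Q.c As 0 = 0 := by simp [stageCost]
  rw [this, add_zero]
  exact hB J

end Par

end

section
/-! Part K: the parameters, and the theorem. -/

/-- Thresholds of a cost function. -/
def thr (c : ℕ → ℕ → ℚ) (m s : ℕ) : ℕ × List ℕ :=
  Nat.rec (0, []) (fun s r => bif decide (((1 : ℚ) / 2) ^ m ≤ c r.1 (s + 1)) then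
    (s + 1, r.2 ++ [s + 1]) else r) s

theorem thr_succ (c : ℕ → ℕ → ℚ) (m s : ℕ) :
    (((1 : ℚ) / 2) ^ m ≤ c (thr c m s).1 (s + 1) ∧
      thr c m (s + 1) = (s + 1, (thr c m s).2 ++ [s + 1])) ∨
    (¬ ((1 : ℚ) / 2) ^ m ≤ c (thr c m s).1 (s + 1) ∧ thr c m (s + 1) = thr c m s) := by
  have h : thr c m (s + 1) = bif decide (((1 : ℚ) / 2) ^ m ≤ c (thr c m s).1 (s + 1)) then
    (s + 1, (thr c m s).2 ++ [s + 1]) else thr c m s := rfl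
  by_cases hc : ((1 : ℚ) / 2) ^ m ≤ c (thr c m s).1 (s + 1)
  · left; exact ⟨hc, by rw [h, decide_eq_true hc]; rfl⟩
  · right; exact ⟨hc, by rw [h, decide_eq_false hc]; rfl⟩

theorem comp_thr {c : ℕ → ℕ → ℚ} (hc : Computable₂ c) :
    Computable fun q : ℕ × ℕ => thr c q.1 q.2 := by
  have h1 : Computable fun q : (ℕ × ℕ) × ℕ × ℕ × List ℕ => q.1.1 :=
    Computable.fst.comp Computable.fst
  have h2 : Computable fun q : (ℕ × ℕ) × ℕ × ℕ × List ℕ => q.2.2 :=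
    Computable.snd.comp Computable.snd
  have h3 : Computable fun q : (ℕ × ℕ) × ℕ × ℕ × List ℕ => q.2.1 + 1 :=
    comp_add (Computable.fst.comp Computable.snd) (Computable.const 1)
  have h4 : Computable fun q : (ℕ × ℕ) × ℕ × ℕ × List ℕ => q.2.2.1 := Computable.fst.comp h2
  have h5 : Computable fun q : (ℕ × ℕ) × ℕ × ℕ × List ℕ => q.2.2.2 := Computable.snd.comp h2
  have h6 : Computable fun q : (ℕ × ℕ) × ℕ × ℕ × List ℕ => c q.2.2.1 (q.2.1 + 1) :=
    hc.comp h4 h3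
  have h7 : Computable fun q : (ℕ × ℕ) × ℕ × ℕ × List ℕ => q.2.2.2 ++ [q.2.1 + 1] :=
    Computable.list_concat.comp h5 h3
  have h8 : Computable fun q : (ℕ × ℕ) × ℕ × ℕ × List ℕ =>
      (bif decide (((1 : ℚ) / 2) ^ q.1.1 ≤ c q.2.2.1 (q.2.1 + 1)) then
        (q.2.1 + 1, q.2.2.2 ++ [q.2.1 + 1]) else q.2.2) :=
    Computable.cond (comp_pow_le h1 h6) (Computable.pair h3 h7) h2
  exact Computable.nat_rec (f := fun q : ℕ × ℕ => q.2) (g := fun _ => ((0, []) : ℕ × List ℕ))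
    (h := fun (a : ℕ × ℕ) (q : ℕ × ℕ × List ℕ) =>
      (bif decide (((1 : ℚ) / 2) ^ a.1 ≤ c q.2.1 (q.1 + 1)) then
        (q.1 + 1, q.2.2 ++ [q.1 + 1]) else q.2)) Computable.snd (Computable.const (0, [])) h8

theorem thr_inv (c : ℕ → ℕ → ℚ) (m s : ℕ) :
    (∀ i < (thr c m s).2.length, (0 :: (thr c m s).2).getD i 0 < (thr c m s).2.getD i 0 ∧
      ((1 : ℚ) / 2) ^ m ≤ c ((0 :: (thr c m s).2).getD i 0) ((thr c m s).2.getD i 0)) ∧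
    (thr c m s).1 = (0 :: (thr c m s).2).getD (thr c m s).2.length 0 ∧ (thr c m s).1 ≤ s ∧
    ((thr c m s).1 = 0 ∨ (thr c m s).1 ∈ (thr c m s).2) := by
  induction s with
  | zero =>
    have : thr c m 0 = (0, []) := rfl
    simp [this]
  | succ s ih =>
    rcases thr_succ c m s with ⟨h1, h2⟩ | ⟨h1, h2⟩
    · rw [h2]
      generalize thr c m s = r at *
      obtain ⟨a, l⟩ := r
      simp only at *
      obtain ⟨i1, i2, i3, i4⟩ := ih
      refine ⟨?_, ?_, le_rfl, Or.inr (by simp)⟩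
      · intro i hi
        rw [← List.cons_append]
        rw [List.length_append, List.length_singleton] at hi
        rw [List.getD_append _ _ _ _ (by simp only [List.length_cons]; omega)]
        rcases Nat.lt_succ_iff_lt_or_eq.1 hi with h | h
        · rw [List.getD_append _ _ _ _ h]
          exact i1 i h
        · subst h
          rw [← i2, List.getD_append_right _ _ _ _ le_rfl]
          simp only [Nat.sub_self, List.getD_cons_zero]
          exact ⟨by omega, h1⟩
      · rw [List.length_append, List.length_singleton, List.getD_cons_succ,
          List.getD_append_right _ _ _ _ le_rfl]
        simp
    · rw [h2]
      exact ⟨ih.1, ih.2.1, by have := ih.2.2.1; omega, ih.2.2.2⟩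

theorem benign_lim {c : ℕ → ℕ → ℚ} (hc : CostFunction c) (hb : Benign c) (k : ℕ) :
    ∃ y0, ∀ y ≥ y0, ∀ s, c y s < ((1 : ℚ) / 2) ^ k := by
  obtain ⟨b, _, hb⟩ := hb
  by_contra hno
  push Not at hno
  choose Y hY S hS using hno
  let S' : ℕ → ℕ := fun z => max (S z) (Y z + 1)
  let z : ℕ → ℕ := fun i => Nat.rec 0 (fun _ a => S' a) i
  have hz : ∀ i, z (i + 1) = S' (z i) := fun _ => rfl
  have := hb k (b k + 1) (fun i => Y (z i)) (fun i => S' (z i))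
    (fun i _ => lt_of_lt_of_le (Nat.lt_succ_self _) (le_max_right _ _))
    (fun i _ => by rw [← hz]; exact hY _)
    (fun i _ => (hS _).trans (hc.2.2.1 _ _ _ (le_max_left _ _)))
  omega

theorem exists_par {P : Set (ℕ → Bool)} (hP : Pi01 P) (hne : P.Nonempty) {c : ℕ → ℕ → ℚ}
    (hc : CostFunction c) (hb : Benign c) :
    ∃ Q : Par, Q.c = c ∧ P = {Z | ∀ i σ, Q.f i = some σ → ¬ InitSeg σ Z} := by
  obtain ⟨f, hf, hPf⟩ := hP
  obtain ⟨X0, hX0⟩ := hne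
  have hlim := benign_lim hc hb
  obtain ⟨b, hbc, hb⟩ := hb
  refine ⟨Par.mk f hf c hc (fun m s => (thr c m s).2) ?_ b hbc ?_ ?_ ?_ hlim X0 ?_, rfl, hPf⟩
  · exact Computable.snd.comp (comp_thr hc.1)
  · intro m s
    obtain ⟨h1, -, -, -⟩ := thr_inv c m s
    exact hb m _ (fun i => (0 :: (thr c m s).2).getD i 0) (fun i => (thr c m s).2.getD i 0)
      (fun i hi => (h1 i hi).1) (fun i _ => by simp only [List.getD_cons_succ, le_refl])
      (fun i hi => (h1 i hi).2)
  · intro m s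
    rcases thr_succ c m s with ⟨_, h2⟩ | ⟨_, h2⟩
    · simp only [h2]; exact List.prefix_append _ _
    · simp only [h2]; exact List.prefix_rfl
  · intro m x s hx hcx
    obtain ⟨t, rfl⟩ : ∃ t, s = t + 1 := ⟨s - 1, by omega⟩
    have hlt : x < (thr c m (t + 1)).1 := by
      rcases thr_succ c m t with ⟨h1, h2⟩ | ⟨h1, h2⟩
      · rw [h2]; exact hx
      · rw [h2]
        by_contra hle
        exact h1 (hcx.trans (hc.2.2.2 _ _ _ (not_lt.1 hle)))
    rcases (thr_inv c m (t + 1)).2.2.2 with h | h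
    · omega
    · exact ⟨_, h, hlt⟩
  · rw [hPf] at hX0
    exact hX0

end

/-- For any non-empty Π⁰₁ class and any benign cost function `c`,
some ω-c.a. member `Z` has all c.e. sets below it obeying `c`. -/
theorem pi01_omega_ca_member_forcing_obedience (P : Set (ℕ → Bool)) (hP : Pi01 P)
    (hne : P.Nonempty)
    (c : ℕ → ℕ → ℚ) (hc : CostFunction c) (hben : Benign c) :
    ∃ Z ∈ P, OmegaCA Z ∧ ∀ A : ℕ → Bool, CE A → TuringLE A Z → Obeys A c := by
  obtain ⟨Q, hQ, hPQ⟩ := exists_par hP hne hc hben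
  refine ⟨Q.Z, ?_, Q.Z_omegaCA, fun A hA hT => ?_⟩
  · rw [hPQ]
    exact Q.Z_mem
  · rw [← hQ]
    exact Q.obeys hA hT
end

section
/- (Hirschfeldt–Miller) There is a computably enumerable set A that is not computable such that A ≤_T Z for every Martin-Löf random ω-c.a. set Z. -/
open Nat.Partrec (Code)
open Encodable

namespace HM

/-! ### Bounded quantifiers -/

theorem ball {α : Type} [Primcodable α] {p : α → ℕ → Prop} {f : α → ℕ}
    (hp : PrimrecPred fun q : α × ℕ => p q.1 q.2) (hf : Primrec f) :
    PrimrecPred fun a => ∀ n < f a, p a n := by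
  have h : PrimrecRel (fun (n : ℕ) (a : α) => p a n) :=
    hp.comp (Primrec.pair Primrec.snd Primrec.fst)
  exact (h.forall_mem_list.comp (Primrec.list_range.comp hf) Primrec.id).of_eq (by simp)

theorem bex {α : Type} [Primcodable α] {p : α → ℕ → Prop} {f : α → ℕ}
    (hp : PrimrecPred fun q : α × ℕ => p q.1 q.2) (hf : Primrec f) :
    PrimrecPred fun a => ∃ n < f a, p a n := by
  have h : PrimrecRel (fun (n : ℕ) (a : α) => p a n) :=
    hp.comp (Primrec.pair Primrec.snd Primrec.fst)
  exact (h.exists_mem_list.comp (Primrec.list_range.comp hf) Primrec.id).of_eq (by simp)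

/-! ### Unbounded search -/

/-- Unbounded search for a total boolean predicate. -/
def srch (p : ℕ → Bool) : Part ℕ := Nat.rfind (p : ℕ →. Bool)

theorem srch_dom {p : ℕ → Bool} : (srch p).Dom ↔ ∃ s, p s = true := by
  unfold srch
  rw [Nat.rfind_dom]
  constructor
  · rintro ⟨s, hs, -⟩
    exact ⟨s, by simpa using hs⟩
  · rintro ⟨s, hs⟩
    exact ⟨s, by simpa using hs, fun _ => trivial⟩

theorem srch_spec {p : ℕ → Bool} {s : ℕ} (h : s ∈ srch p) : p s = true := by
  have := Nat.rfind_spec h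
  simpa using this

theorem srch_partrec {α : Type} [Primcodable α] {p : α → ℕ → Bool} (h : Computable₂ p) :
    Partrec fun a => srch (p a) :=
  Partrec.rfind (p := fun a => (p a : ℕ →. Bool)) h

theorem computable_decide_eq {α : Type} [Primcodable α] {u v : α → ℕ} (hu : Computable u)
    (hv : Computable v) : Computable fun a => decide (u a = v a) :=
  (Primrec.eq (α := ℕ)).decide.to_comp.comp hu hv

/-! ### A uniform list of convergent approximations containing all ω-c.a. sets -/

/-- Stage `s` of step-bounded evaluation of the `i`-th code. -/
def ev (i s n : ℕ) : Option ℕ := Code.evaln s (Denumerable.ofNat Code i) n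

/-- The `i`-th approximation: value at the least counter `k` seen so far. -/
def Zp (i s x : ℕ) : Bool :=
  decide (((List.range s).filterMap (fun k => ev i s (Nat.pair x k))).head? = some 1)

theorem primrec_ev : Primrec fun q : (ℕ × ℕ) × ℕ => ev q.1.1 q.1.2 q.2 := by
  unfold ev
  exact Code.primrec_evaln.comp (Primrec.pair (Primrec.pair (Primrec.snd.comp Primrec.fst)
    ((Primrec.ofNat Code).comp (Primrec.fst.comp Primrec.fst))) Primrec.snd)

theorem primrec_Zp : Primrec fun q : (ℕ × ℕ) × ℕ => Zp q.1.1 q.1.2 q.2 := by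
  unfold Zp
  apply PrimrecPred.decide
  refine PrimrecRel.comp Primrec.eq (Primrec.list_head?.comp ?_) (Primrec.const _)
  refine Primrec.listFilterMap (Primrec.list_range.comp (Primrec.snd.comp Primrec.fst)) ?_
  exact primrec_ev.comp (Primrec.pair (Primrec.fst.comp Primrec.fst)
    (Primrec₂.natPair.comp (Primrec.snd.comp Primrec.fst) Primrec.snd))

theorem Zp_none {i s x : ℕ} (h : ∀ k, ev i s (Nat.pair x k) = none) : Zp i s x = false := by
  simp [Zp, h]

theorem Zp_some {i s x k v : ℕ} (hk : ev i s (Nat.pair x k) = some v)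
    (h : ∀ j < k, ev i s (Nat.pair x j) = none) : Zp i s x = decide (v = 1) := by
  have hks : k < s := lt_of_le_of_lt (Nat.right_le_pair x k) (Code.evaln_bound hk)
  have : ((List.range s).filterMap (fun k => ev i s (Nat.pair x k))).head? = some v := by
    obtain ⟨d, rfl⟩ := Nat.exists_eq_add_of_le hks
    rw [List.range_add, List.range_succ]
    rw [List.head?_filterMap, List.findSome?_append, List.findSome?_append]
    have h1 : List.findSome? (fun j => ev i (k.succ + d) (Nat.pair x j)) (List.range k) = none := by
      rw [List.findSome?_eq_none_iff]
      intro j hj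
      exact h j (List.mem_range.1 hj)
    have h2 : List.findSome? (fun j => ev i (k.succ + d) (Nat.pair x j)) [k] = some v := by
      simp [hk]
    rw [h1, h2]; simp
  simp [Zp, this]

theorem ev_mono {i s t n v : ℕ} (h : s ≤ t) (hv : ev i s n = some v) : ev i t n = some v :=
  Code.evaln_mono h hv

/-- If the least counter of the `i`-th code at `x` exists, this gives the limit. -/
theorem Zp_lim {i x k v : ℕ} (hk : v ∈ (Denumerable.ofNat Code i).eval (Nat.pair x k))
    (h : ∀ j < k, ¬ ((Denumerable.ofNat Code i).eval (Nat.pair x j)).Dom) :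
    ∃ t, ∀ s, t ≤ s → Zp i s x = decide (v = 1) := by
  obtain ⟨t, ht⟩ := Code.evaln_complete.1 hk
  refine ⟨t, fun s hs => Zp_some (ev_mono hs ht) fun j hj => ?_⟩
  rw [Option.eq_none_iff_forall_not_mem]
  intro w hw
  exact h j hj (Part.dom_iff_mem.2 ⟨w, Code.evaln_sound hw⟩)

theorem Zp_conv (i x : ℕ) : ∃ b t, ∀ s, t ≤ s → Zp i s x = b := by
  classical
  by_cases h : ∃ k, ((Denumerable.ofNat Code i).eval (Nat.pair x k)).Dom
  · obtain ⟨v, hv⟩ := Part.dom_iff_mem.1 (Nat.find_spec h)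
    exact ⟨_, Zp_lim hv fun j hj => Nat.find_min h hj⟩
  · push Not at h
    refine ⟨false, 0, fun s _ => Zp_none fun k => ?_⟩
    rw [Option.eq_none_iff_forall_not_mem]
    intro w hw
    exact h k (Part.dom_iff_mem.2 ⟨w, Code.evaln_sound hw⟩)

/-- Number of changes of bit `x` up to stage `s`. -/
def cnt (Zs : ℕ → ℕ → Bool) (x : ℕ) (s : ℕ) : ℕ :=
  Nat.rec 0 (fun s c => if Zs (s + 1) x = Zs s x then c else c + 1) s

theorem computable_cnt {Zs : ℕ → ℕ → Bool} (h : Computable₂ Zs) : Computable₂ (cnt Zs) := by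
  unfold cnt
  refine Computable.nat_rec (α := ℕ × ℕ) (σ := ℕ) (f := fun q => q.2) (g := fun _ => 0)
    (h := fun q r => if Zs (r.1 + 1) q.1 = Zs r.1 q.1 then r.2 else r.2 + 1)
    Computable.snd (Computable.const 0) ?_
  have h1 : Computable fun q : (ℕ × ℕ) × (ℕ × ℕ) => Zs (q.2.1 + 1) q.1.1 :=
    h.comp (Computable.succ.comp (Computable.fst.comp Computable.snd))
      (Computable.fst.comp Computable.fst)
  have h2 : Computable fun q : (ℕ × ℕ) × (ℕ × ℕ) => Zs (q.2.1) q.1.1 :=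
    h.comp (Computable.fst.comp Computable.snd) (Computable.fst.comp Computable.fst)
  have h3 : Computable fun q : (ℕ × ℕ) × (ℕ × ℕ) =>
      decide (Zs (q.2.1 + 1) q.1.1 = Zs (q.2.1) q.1.1) :=
    (Primrec.eq (α := Bool)).decide.to_comp.comp h1 h2
  refine (Computable.cond h3 (Computable.snd.comp Computable.snd)
    (Computable.succ.comp (Computable.snd.comp Computable.snd))).of_eq ?_
  intro q
  by_cases hq : Zs (q.2.1 + 1) q.1.1 = Zs (q.2.1) q.1.1 <;> simp [hq]

theorem cnt_eq (Zs : ℕ → ℕ → Bool) (x s : ℕ) :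
    cnt Zs x s = ((Finset.Icc 1 s).filter fun t => Zs t x ≠ Zs (t - 1) x).card := by
  induction s with
  | zero => simp [cnt]
  | succ s ih =>
    have : cnt Zs x (s + 1) = if Zs (s + 1) x = Zs s x then cnt Zs x s else cnt Zs x s + 1 := rfl
    rw [this, ← Finset.insert_Icc_right_eq_Icc_add_one (by omega), Finset.filter_insert, ih]
    by_cases hq : Zs (s + 1) x = Zs s x
    · simp [hq]
    · simp [hq]

theorem cnt_le {Zs : ℕ → ℕ → Bool} {g : ℕ → ℕ}
    (h : ∀ n, (changeStages Zs n).Finite ∧ (changeStages Zs n).ncard ≤ g n) (x s : ℕ) :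
    cnt Zs x s ≤ g (x + 1) := by
  rw [cnt_eq]
  refine le_trans ?_ (h (x + 1)).2
  rw [← Set.ncard_coe_finset]
  refine Set.ncard_le_ncard ?_ (h (x + 1)).1
  intro t ht
  simp only [Finset.coe_filter, Finset.mem_Icc, Set.mem_ofPred_eq] at ht
  refine ⟨ht.1.1, fun he => ht.2 ?_⟩
  have := (List.map_inj_left.1 he) x (by simp)
  exact this

theorem cnt_mono (Zs : ℕ → ℕ → Bool) (x : ℕ) : Monotone (cnt Zs x) := by
  apply monotone_nat_of_le_succ
  intro s
  have : cnt Zs x (s + 1) = if Zs (s + 1) x = Zs s x then cnt Zs x s else cnt Zs x s + 1 := rfl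
  rw [this]; split_ifs <;> omega

theorem cnt_stable {Zs : ℕ → ℕ → Bool} {x s : ℕ} (h : ∀ t, cnt Zs x t ≤ cnt Zs x s) :
    ∀ t, s ≤ t → Zs t x = Zs s x := by
  intro t ht
  induction t, ht using Nat.le_induction with
  | base => rfl
  | succ t ht ih =>
    have e : cnt Zs x (t + 1) = if Zs (t + 1) x = Zs t x then cnt Zs x t else cnt Zs x t + 1 := rfl
    have h1 := h (t + 1)
    have h2 := cnt_mono Zs x ht
    by_contra hne
    rw [if_neg (by rwa [ih])] at e
    omega

theorem exists_index {Z : ℕ → Bool} (h : OmegaCA Z) : ∃ i, Approx (Zp i) Z := by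
  classical
  obtain ⟨g, hg, Zs, ⟨hZc, hZ⟩, hch⟩ := h
  let F : ℕ →. ℕ := fun n =>
    (srch fun s => decide (cnt Zs n.unpair.1 s + n.unpair.2 = g (n.unpair.1 + 1))).map
      fun s => encode (Zs s n.unpair.1)
  have hF : Partrec F := by
    have hx : Computable fun q : ℕ × ℕ => q.1.unpair.1 :=
      Computable.fst.comp (Computable.unpair.comp Computable.fst)
    have hy : Computable fun q : ℕ × ℕ => q.1.unpair.2 :=
      Computable.snd.comp (Computable.unpair.comp Computable.fst)
    have h1 : Computable₂ fun (n s : ℕ) =>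
        decide (cnt Zs n.unpair.1 s + n.unpair.2 = g (n.unpair.1 + 1)) := by
      refine computable_decide_eq (α := ℕ × ℕ)
        (u := fun q => cnt Zs q.1.unpair.1 q.2 + q.1.unpair.2)
        (v := fun q => g (q.1.unpair.1 + 1)) ?_ ?_
      · exact Primrec.nat_add.to_comp.comp ((computable_cnt hZc).comp hx Computable.snd) hy
      · exact hg.comp (Computable.succ.comp hx)
    refine Partrec.map (srch_partrec h1) ?_
    exact Computable.encode.comp (hZc.comp Computable.snd hx)
  obtain ⟨c, hc⟩ := Code.exists_code.1 (Partrec.nat_iff.1 hF)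
  refine ⟨encode c, fun x => ?_⟩
  have hmem : ∀ k v, v ∈ c.eval (Nat.pair x k) →
      ∃ s, cnt Zs x s + k = g (x + 1) ∧ v = encode (Zs s x) := by
    intro k v hv
    rw [hc] at hv
    simp only [F, Part.mem_map_iff, Nat.unpair_pair] at hv
    obtain ⟨s, hs, rfl⟩ := hv
    have := srch_spec hs
    exact ⟨s, by simpa using this, rfl⟩
  have hdom : ∀ k, (∃ s, cnt Zs x s + k = g (x + 1)) → (c.eval (Nat.pair x k)).Dom := by
    rintro k ⟨s, hs⟩
    rw [hc]
    show (srch _).Dom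
    rw [srch_dom]
    exact ⟨s, by simp [hs]⟩
  have hex : ∃ k, (c.eval (Nat.pair x k)).Dom :=
    ⟨g (x + 1) - cnt Zs x 0, hdom _ ⟨0, by have := cnt_le hch x 0; omega⟩⟩
  obtain ⟨v, hv⟩ := Part.dom_iff_mem.1 (Nat.find_spec hex)
  obtain ⟨s, hs, hvs⟩ := hmem _ _ hv
  have hlim : ∃ t, ∀ r, t ≤ r → Zp (encode c) r x = decide (v = 1) := by
    refine Zp_lim (k := Nat.find hex) ?_ ?_
    · simpa using hv
    · intro j hj; simpa using Nat.find_min hex hj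
  obtain ⟨t, ht⟩ := hlim
  have hst : ∀ r, cnt Zs x r ≤ cnt Zs x s := by
    intro r
    have h1 := cnt_le hch x r
    have h2 : Nat.find hex ≤ g (x + 1) - cnt Zs x r :=
      Nat.find_min' hex (hdom _ ⟨r, by omega⟩)
    omega
  have hZs : Z x = Zs s x := by
    obtain ⟨u, hu⟩ := hZ x
    rw [← hu (max u s) (le_max_left _ _), cnt_stable hst _ (le_max_right _ _)]
  refine ⟨t, fun r hr => ?_⟩
  rw [ht r hr, hZs, hvs]
  cases Zs s x <;> simp

/-! ### The construction -/

/-- Requirement `e` may act with witness `⟨e, m⟩` at stage `t`, where `w = ⟨m, t⟩`. -/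
def P (e w : ℕ) : Prop :=
  Nat.pair e w.unpair.1 ≤ w.unpair.2 ∧
  ev e w.unpair.2 (Nat.pair e w.unpair.1) = some 0 ∧
  ∀ i < e + 1, ∀ u < w.unpair.2, ∀ y < e,
    ¬ Nat.pair e w.unpair.1 ≤ u ∨ Zp i u y = Zp i w.unpair.2 y

/-- Requirement `e` acts at `w`. -/
def Act (e w : ℕ) : Prop := P e w ∧ ∀ w' < w, ¬ P e w'

theorem primrec_P : PrimrecPred fun q : ℕ × ℕ => P q.1 q.2 := by
  have hm : Primrec fun q : ℕ × ℕ => q.2.unpair.1 :=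
    Primrec.fst.comp (Primrec.unpair.comp Primrec.snd)
  have ht : Primrec fun q : ℕ × ℕ => q.2.unpair.2 :=
    Primrec.snd.comp (Primrec.unpair.comp Primrec.snd)
  have hx : Primrec fun q : ℕ × ℕ => Nat.pair q.1 q.2.unpair.1 :=
    Primrec₂.natPair.comp Primrec.fst hm
  unfold P
  refine PrimrecPred.and (Primrec.nat_le.comp hx ht) (PrimrecPred.and ?_ ?_)
  · exact PrimrecRel.comp Primrec.eq
      (primrec_ev.comp (Primrec.pair (Primrec.pair Primrec.fst ht) hx)) (Primrec.const _)
  · refine ball (p := fun (q : ℕ × ℕ) i => ∀ u < q.2.unpair.2, ∀ y < q.1,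
      ¬ Nat.pair q.1 q.2.unpair.1 ≤ u ∨ Zp i u y = Zp i q.2.unpair.2 y) ?_
      (Primrec.succ.comp Primrec.fst)
    refine ball (p := fun (q : (ℕ × ℕ) × ℕ) u => ∀ y < q.1.1,
      ¬ Nat.pair q.1.1 q.1.2.unpair.1 ≤ u ∨ Zp q.2 u y = Zp q.2 q.1.2.unpair.2 y) ?_
      (ht.comp Primrec.fst)
    refine ball (p := fun (q : ((ℕ × ℕ) × ℕ) × ℕ) y =>
      ¬ Nat.pair q.1.1.1 q.1.1.2.unpair.1 ≤ q.2 ∨ Zp q.1.2 q.2 y = Zp q.1.2 q.1.1.2.unpair.2 y) ?_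
      (Primrec.fst.comp (Primrec.fst.comp Primrec.fst))
    have a1 : Primrec fun q : (((ℕ × ℕ) × ℕ) × ℕ) × ℕ => q.1.1.1 :=
      Primrec.fst.comp (Primrec.fst.comp Primrec.fst)
    have a2 : Primrec fun q : (((ℕ × ℕ) × ℕ) × ℕ) × ℕ => q.1.1.2 :=
      Primrec.snd.comp (Primrec.fst.comp Primrec.fst)
    have a3 : Primrec fun q : (((ℕ × ℕ) × ℕ) × ℕ) × ℕ => q.1.2 :=
      Primrec.snd.comp Primrec.fst
    refine PrimrecPred.or (PrimrecPred.not (Primrec.nat_le.comp (hx.comp a1) a3)) ?_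
    exact PrimrecRel.comp Primrec.eq
      (primrec_Zp.comp (Primrec.pair (Primrec.pair a2 a3) Primrec.snd))
      (primrec_Zp.comp (Primrec.pair (Primrec.pair a2 (ht.comp a1)) Primrec.snd))

theorem primrec_Act : PrimrecPred fun q : ℕ × ℕ => Act q.1 q.2 := by
  unfold Act
  refine PrimrecPred.and primrec_P ?_
  refine ball (p := fun (q : ℕ × ℕ) w => ¬ P q.1 w) (PrimrecPred.not ?_) Primrec.snd
  exact primrec_P.comp (Primrec.pair (Primrec.fst.comp Primrec.fst) Primrec.snd)

theorem Act_unique {e w w' : ℕ} (h : Act e w) (h' : Act e w') : w = w' := by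
  rcases lt_trichotomy w w' with hl | hl | hl
  · exact absurd h.1 (h'.2 _ hl)
  · exact hl
  · exact absurd h'.1 (h.2 _ hl)

theorem exists_Act {e w : ℕ} (h : P e w) : ∃ w, Act e w := by
  classical
  exact ⟨Nat.find ⟨w, h⟩, Nat.find_spec ⟨w, h⟩, fun w' hw' => Nat.find_min ⟨w, h⟩ hw'⟩

/-- `x` is enumerated at stage `t`. -/
def En (x t : ℕ) : Prop := Act x.unpair.1 (Nat.pair x.unpair.2 t)

theorem primrec_En : PrimrecPred fun q : ℕ × ℕ => En q.1 q.2 := by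
  have h : Primrec fun q : ℕ × ℕ => q.1.unpair := Primrec.unpair.comp Primrec.fst
  exact primrec_Act.comp (Primrec.pair (Primrec.fst.comp h)
    (Primrec₂.natPair.comp (Primrec.snd.comp h) Primrec.snd))

open Classical in
/-- The set we build. -/
noncomputable def A (x : ℕ) : Bool := decide (∃ t, En x t)

theorem A_iff (x : ℕ) : A x = true ↔ ∃ t, En x t := by simp [A]

theorem A_ce : CE A := by
  classical
  refine ⟨fun x => srch fun t => decide (En x t), ?_, fun x => ?_⟩
  · refine Partrec.nat_iff.1 (srch_partrec (p := fun x t => decide (En x t)) ?_)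
    exact primrec_En.decide.to_comp
  · rw [A_iff, srch_dom]
    simp

theorem A_not_computable : ¬ Computable A := by
  intro hA
  have h1 : Partrec (fun x => Part.some (encode (A x)) : ℕ →. ℕ) := Computable.encode.comp hA
  obtain ⟨c, hc⟩ := Code.exists_code.1 (Partrec.nat_iff.1 h1)
  set e := encode c with he
  have hev : ∀ n, (Denumerable.ofNat Code e).eval n = Part.some (encode (A n)) := by
    intro n; simp [he, hc]
  by_cases hact : ∃ w, Act e w
  · obtain ⟨w, hw⟩ := hact
    have hx : A (Nat.pair e w.unpair.1) = true := by
      rw [A_iff]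
      refine ⟨w.unpair.2, ?_⟩
      simpa [En] using hw
    have h0 : (0 : ℕ) ∈ (Denumerable.ofNat Code e).eval (Nat.pair e w.unpair.1) :=
      Code.evaln_sound hw.1.2.1
    rw [hev, hx] at h0
    simp at h0
  · choose b T hT using fun i y => Zp_conv i y
    let M := ∑ i ∈ Finset.range (e + 1), ∑ y ∈ Finset.range e, T i y
    have hM : ∀ i < e + 1, ∀ y < e, T i y ≤ M := by
      intro i hi y hy
      calc T i y ≤ ∑ y ∈ Finset.range e, T i y :=
            Finset.single_le_sum (f := fun y => T i y) (fun _ _ => Nat.zero_le _)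
              (Finset.mem_range.2 hy)
        _ ≤ M := Finset.single_le_sum (f := fun i => ∑ y ∈ Finset.range e, T i y)
              (fun _ _ => Nat.zero_le _) (Finset.mem_range.2 hi)
    have hfalse : A (Nat.pair e M) = false := by
      rw [Bool.eq_false_iff]
      intro h
      obtain ⟨t, ht⟩ := (A_iff _).1 h
      exact hact ⟨_, by simpa [En] using ht⟩
    have h0 : (0 : ℕ) ∈ (Denumerable.ofNat Code e).eval (Nat.pair e M) := by
      rw [hev, hfalse]; simp
    obtain ⟨t, ht⟩ := Code.evaln_complete.1 h0
    refine hact (exists_Act (w := Nat.pair M (max t (Nat.pair e M))) ⟨?_, ?_, ?_⟩)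
    · simp
    · simp only [Nat.unpair_pair]
      exact ev_mono (le_max_left _ _) ht
    · intro i hi u hu y hy
      simp only [Nat.unpair_pair] at hu ⊢
      by_cases hle : Nat.pair e M ≤ u
      · right
        have hMu : T i y ≤ u := (hM i hi y hy).trans ((Nat.right_le_pair e M).trans hle)
        rw [hT i y u hMu, hT i y _ (hMu.trans hu.le)]
      · exact Or.inl hle

/-! ### The test -/

open Classical in
/-- The Solovay test for the `i`-th approximation. -/
noncomputable def tst (i j : ℕ) : List Bool :=
  if Act j.unpair.1 j.unpair.2 then
    restr (Zp i j.unpair.2.unpair.2) j.unpair.1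
  else List.replicate j false

theorem tst_computable (i : ℕ) : Computable (tst i) := by
  classical
  apply Primrec.to_comp
  unfold tst
  refine Primrec.ite ?_ ?_ ?_
  · exact primrec_Act.comp (Primrec.pair (Primrec.fst.comp Primrec.unpair)
      (Primrec.snd.comp Primrec.unpair))
  · unfold restr
    refine Primrec.list_map (Primrec.list_range.comp (Primrec.fst.comp Primrec.unpair)) ?_
    refine primrec_Zp.comp (Primrec.pair (Primrec.pair (Primrec.const i) ?_) Primrec.snd)
    exact (Primrec.snd.comp (Primrec.unpair.comp
      (Primrec.snd.comp (Primrec.unpair.comp Primrec.fst))))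
  · refine (Primrec.list_map (f := fun j : ℕ => List.range j) (g := fun _ _ => false)
      Primrec.list_range (Primrec.const false).to₂).of_eq ?_
    intro n; simp

theorem tst_summable (i : ℕ) : Summable (fun j => ((1 : ℝ) / 2) ^ (tst i j).length) := by
  classical
  have hgeo : Summable (fun j : ℕ => ((1 : ℝ) / 2) ^ j) := summable_geometric_two
  have hact : Summable (fun j : ℕ =>
      if Act j.unpair.1 j.unpair.2 then ((1 : ℝ) / 2) ^ j.unpair.1 else 0) := by
    let S : Set ℕ := {j | Act j.unpair.1 j.unpair.2}
    have hinj : Function.Injective (fun j : S => (j : ℕ).unpair.1) := by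
      rintro ⟨a, ha⟩ ⟨b, hb⟩ hab
      simp only at hab
      have h2 : a.unpair.2 = b.unpair.2 := by
        apply Act_unique (e := a.unpair.1) ha
        rw [hab]; exact hb
      apply Subtype.ext
      show a = b
      rw [← Nat.pair_unpair a, ← Nat.pair_unpair b, hab, h2]
    have hs := hgeo.comp_injective hinj
    have := (summable_subtype_iff_indicator (f := fun j : ℕ => ((1 : ℝ) / 2) ^ j.unpair.1)
      (s := S)).1 hs
    refine this.congr fun j => ?_
    simp [Set.indicator, S]
  refine Summable.of_nonneg_of_le (fun _ => by positivity) (fun j => ?_) (hact.add hgeo)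
  unfold tst
  split_ifs with h
  · simp only [restr, List.length_map, List.length_range]
    have : (0 : ℝ) ≤ (1 / 2) ^ j := by positivity
    linarith
  · simp

/-! ### The reduction -/

/-- Elements that the reduction from `Z` could miss. -/
def Bad (i : ℕ) (Z : ℕ → Bool) : Set ℕ :=
  {x | ∃ t, En x t ∧ (x.unpair.1 < i ∨ InitSeg (restr (Zp i t) x.unpair.1) Z)}

theorem Bad_finite {i : ℕ} {Z : ℕ → Bool} (hZ : MLRandom Z) : (Bad i Z).Finite := by
  have h1 := hZ (tst i) (tst_computable i) (tst_summable i)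
  have h2 : ((fun j : ℕ => Nat.pair j.unpair.1 j.unpair.2.unpair.1) ''
      {j | InitSeg (tst i j) Z}).Finite := h1.image _
  have h3 : {x : ℕ | x.unpair.1 < i ∧ ∃ t, En x t}.Finite := by
    refine Set.Finite.of_finite_image (f := fun x : ℕ => x.unpair.1)
      ((Set.finite_lt_nat i).subset ?_) ?_
    · rintro _ ⟨x, hx, rfl⟩
      exact hx.1
    · rintro a ⟨-, s, hs⟩ b ⟨-, t, ht⟩ hab
      simp only at hab
      unfold En at hs ht
      rw [← hab] at ht
      have := Act_unique hs ht
      have h4 := (Nat.pair_eq_pair.1 this).1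
      rw [← Nat.pair_unpair a, ← Nat.pair_unpair b, hab, h4]
  refine (h2.union h3).subset ?_
  rintro x ⟨t, ht, hx | hx⟩
  · exact Or.inr ⟨hx, t, ht⟩
  · left
    refine ⟨Nat.pair x.unpair.1 (Nat.pair x.unpair.2 t), ?_, by simp⟩
    have ht' : Act x.unpair.1 (Nat.pair x.unpair.2 t) := ht
    simpa [tst, ht'] using hx

/-- Correctness of the reduction. -/
theorem A_correct {i : ℕ} {Z : ℕ → Bool} {x s : ℕ} (hxs : x ≤ s)
    (hs : ∀ y < x, Zp i s y = Z y) :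
    A x = true ↔ (x ∈ Bad i Z ∨ ∃ t < s + 1, En x t) := by
  rw [A_iff]
  constructor
  · rintro ⟨t, ht⟩
    by_cases hts : t < s + 1
    · exact Or.inr ⟨t, hts, ht⟩
    left
    refine ⟨t, ht, ?_⟩
    by_cases hi : x.unpair.1 < i
    · exact Or.inl hi
    right
    unfold InitSeg
    simp only [restr, List.length_map, List.length_range]
    apply List.map_congr_left
    intro y hy
    rw [List.mem_range] at hy
    have := ht.1.2.2 i (by omega) s (by simp; omega) y hy
    simp only [Nat.unpair_pair, Nat.pair_unpair] at this
    rw [← this.resolve_left (by simpa using hxs)]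
    exact hs y (lt_of_lt_of_le hy (Nat.unpair_left_le x))
  · rintro (⟨t, ht, -⟩ | ⟨t, -, ht⟩) <;> exact ⟨t, ht⟩

theorem RecIn_of_partrec {O f : ℕ →. ℕ} (h : Nat.Partrec f) : RecIn O f := by
  induction h with
  | zero => exact RecIn.zero
  | succ => exact RecIn.succ
  | left => exact RecIn.left
  | right => exact RecIn.right
  | pair _ _ h1 h2 => exact RecIn.pair h1 h2
  | comp _ _ h1 h2 => exact RecIn.comp h1 h2
  | prec _ _ h1 h2 => exact RecIn.prec h1 h2
  | rfind _ h1 => exact RecIn.rfind h1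

theorem RecIn_of_prim {O : ℕ →. ℕ} {f : ℕ → ℕ} (h : Primrec f) : RecIn O (f : ℕ →. ℕ) :=
  RecIn_of_partrec (Nat.Partrec.of_primrec (Primrec.nat_iff.1 h))

theorem RecIn_comp_tot {O : ℕ →. ℕ} {f g : ℕ → ℕ} (hf : RecIn O (f : ℕ →. ℕ))
    (hg : RecIn O (g : ℕ →. ℕ)) : RecIn O ((fun n => f (g n) : ℕ → ℕ) : ℕ →. ℕ) := by
  refine (congrArg (RecIn O) ?_).mpr (RecIn.comp hf hg)
  funext n
  exact (Part.bind_some (g n) (f : ℕ →. ℕ)).symm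

theorem RecIn_pair_tot {O : ℕ →. ℕ} {f g : ℕ → ℕ} (hf : RecIn O (f : ℕ →. ℕ))
    (hg : RecIn O (g : ℕ →. ℕ)) : RecIn O ((fun n => Nat.pair (f n) (g n) : ℕ → ℕ) : ℕ →. ℕ) := by
  refine (congrArg (RecIn O) ?_).mpr (RecIn.pair hf hg)
  funext n
  simp [Seq.seq]

/-- Step appending the bit coded by `n.unpair.2` to the list coded in `n.unpair.1`. -/
def app (n : ℕ) : ℕ :=
  encode (((decode (α := List Bool) n.unpair.1).getD []) ++ [decide (n.unpair.2 = 1)])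

theorem app_prim : Primrec app := by
  unfold app
  refine Primrec.encode.comp (Primrec.list_concat.comp ?_ ?_)
  · exact Primrec.option_getD.comp (Primrec.decode.comp (Primrec.fst.comp Primrec.unpair))
      (Primrec.const [])
  · exact PrimrecPred.decide (PrimrecRel.comp Primrec.eq (Primrec.snd.comp Primrec.unpair)
      (Primrec.const 1))

theorem RecIn_restr (Z : ℕ → Bool) :
    RecIn (charFn Z) ((fun n => encode (restr Z n) : ℕ → ℕ) : ℕ →. ℕ) := by
  let sel1 : ℕ → ℕ := fun n => n.unpair.2.unpair.2
  let sel2 : ℕ → ℕ := fun n => n.unpair.2.unpair.1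
  have hsel1 : Primrec sel1 := Primrec.snd.comp (Primrec.unpair.comp
    (Primrec.snd.comp Primrec.unpair))
  have hsel2 : Primrec sel2 := Primrec.fst.comp (Primrec.unpair.comp
    (Primrec.snd.comp Primrec.unpair))
  have hor : RecIn (charFn Z) ((fun n => cond (Z n) 1 0 : ℕ → ℕ) : ℕ →. ℕ) := RecIn.oracle
  have hstep := RecIn_comp_tot (RecIn_of_prim (O := charFn Z) app_prim)
    (RecIn_pair_tot (RecIn_of_prim hsel1) (RecIn_comp_tot hor (RecIn_of_prim hsel2)))
  have h0 : RecIn (charFn Z) ((fun _ => encode ([] : List Bool) : ℕ → ℕ) : ℕ →. ℕ) :=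
    RecIn_of_prim (Primrec.const _)
  have hd : Primrec (fun n : ℕ => Nat.pair 0 n) := Primrec₂.natPair.comp (Primrec.const 0) Primrec.id
  have := RecIn.comp (RecIn.prec h0 hstep) (RecIn_of_prim hd)
  refine (congrArg (RecIn (charFn Z)) ?_).mpr this
  funext n
  simp only [PFun.coe_val, Part.bind_eq_bind, Part.bind_some, Nat.unpaired, Nat.unpair_pair]
  induction n with
  | zero => simp [restr]
  | succ n ih =>
    simp only
    rw [← ih]
    simp [sel1, sel2, app, restr, List.range_succ]
    cases Z n <;> simp

theorem reduction {i : ℕ} {Z : ℕ → Bool} (hZ : MLRandom Z) (hi : Approx (Zp i) Z) :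
    TuringLE A Z := by
  classical
  let B : List ℕ := (Bad_finite (i := i) hZ).toFinset.toList
  have hB : ∀ x, x ∈ B ↔ x ∈ Bad i Z := by intro x; simp [B]
  let Q : (ℕ × List Bool) → ℕ → Prop := fun p s =>
    p.1 ≤ s ∧ ∀ y < p.1, Zp i s y = p.2.getD y false
  let H : (ℕ × List Bool) → ℕ → Prop := fun p s => p.1 ∈ B ∨ ∃ t < s + 1, En p.1 t
  have hQ : PrimrecPred fun q : (ℕ × List Bool) × ℕ => Q q.1 q.2 := by
    refine PrimrecPred.and (Primrec.nat_le.comp (Primrec.fst.comp Primrec.fst) Primrec.snd) ?_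
    refine ball (p := fun (q : (ℕ × List Bool) × ℕ) y => Zp i q.2 y = q.1.2.getD y false) ?_
      (Primrec.fst.comp Primrec.fst)
    refine PrimrecRel.comp Primrec.eq
      (primrec_Zp.comp (Primrec.pair (Primrec.pair (Primrec.const i)
        (Primrec.snd.comp Primrec.fst)) Primrec.snd))
      ((Primrec.list_getD false).comp (Primrec.snd.comp (Primrec.fst.comp Primrec.fst))
        Primrec.snd)
  have hH : PrimrecPred fun q : (ℕ × List Bool) × ℕ => H q.1 q.2 := by
    refine PrimrecPred.or ?_ ?_
    · have h1 : PrimrecRel fun (L : List ℕ) (b : ℕ) => ∃ a ∈ L, a = b :=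
        PrimrecRel.exists_mem_list Primrec.eq
      refine (h1.comp (Primrec.const B) (Primrec.fst.comp Primrec.fst)).of_eq ?_
      intro q; simp
    · refine bex (p := fun (q : (ℕ × List Bool) × ℕ) t => En q.1.1 t) ?_
        (Primrec.succ.comp Primrec.snd)
      exact primrec_En.comp (Primrec.pair (Primrec.fst.comp (Primrec.fst.comp Primrec.fst))
        Primrec.snd)
  let G : (ℕ × List Bool) →. ℕ := fun p =>
    (srch fun s => decide (Q p s)).map fun s => cond (decide (H p s)) 1 0
  have hG : Partrec G := by
    refine Partrec.map (srch_partrec (p := fun p s => decide (Q p s))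
      hQ.decide.to_comp) ?_
    exact (Primrec.cond hH.decide (Primrec.const 1) (Primrec.const 0)).to_comp
  have hGA : ∀ x, G (x, restr Z x) = charFn A x := by
    intro x
    have hex : ∃ s, Q (x, restr Z x) s := by
      choose T hT using hi
      refine ⟨x + ∑ y ∈ Finset.range x, T y, by simp, fun y hy => ?_⟩
      have hle : T y ≤ ∑ y ∈ Finset.range x, T y :=
        Finset.single_le_sum (f := T) (fun _ _ => Nat.zero_le _) (Finset.mem_range.2 hy)
      rw [hT y _ (by omega)]
      have hy' : y < x := hy
      simp [restr, List.getD, hy']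
    have hdom : (srch fun s => decide (Q (x, restr Z x) s)).Dom := by
      rw [srch_dom]
      obtain ⟨s, hs⟩ := hex
      exact ⟨s, by simp [hs]⟩
    obtain ⟨s, hs⟩ := Part.dom_iff_mem.1 hdom
    have hQs : Q (x, restr Z x) s := by simpa using srch_spec hs
    have hA := A_correct (i := i) (Z := Z) hQs.1 (fun y hy => by
      rw [hQs.2 y hy]
      have hy' : y < x := hy
      simp [restr, List.getD, hy'])
    have hAH : A x = decide (H (x, restr Z x) s) := by
      rw [Bool.eq_iff_iff, hA]
      simp [H, hB]
    simp only [G, charFn]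
    rw [Part.eq_some_iff.2 hs, Part.map_some, hAH]
  have hin : RecIn (charFn Z) ((fun n => encode (n, restr Z n) : ℕ → ℕ) : ℕ →. ℕ) := by
    have := RecIn.pair (RecIn_of_prim (O := charFn Z) Primrec.id) (RecIn_restr Z)
    refine (congrArg (RecIn (charFn Z)) ?_).mpr this
    funext n
    simp [Seq.seq]
  have := RecIn.comp (RecIn_of_partrec (O := charFn Z) hG) hin
  unfold TuringLE
  refine (congrArg (RecIn (charFn Z)) ?_).mpr this
  funext n
  rw [PFun.coe_val, Part.bind_eq_bind, Part.bind_some]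
  simp only [encodek, Part.coe_some, Part.bind_some, hGA]
  simp [charFn]

end HM

/-- Hirschfeldt–Miller: There is an incomputable c.e. set below
every ML-random ω-c.a. set. -/
theorem hirschfeldt_miller :
    ∃ A : ℕ → Bool, CE A ∧ ¬ Computable A ∧
      ∀ Z : ℕ → Bool, MLRandom Z → OmegaCA Z → TuringLE A Z := by
  refine ⟨HM.A, HM.A_ce, HM.A_not_computable, fun Z hZ hO => ?_⟩
  obtain ⟨i, hi⟩ := HM.exists_index hO
  exact HM.reduction hZ hi
end
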